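/- Let H be a separable infinite-dimensional complex Hilbert space and let Q(H) = B(H)/K(H) be the Calkin algebra. Then every C*-algebra A that has a dense subset of cardinality at most ℵ₁ admits an injective *-homomorphism into Q(H); that is, A is isomorphic to a C*-subalgebra of the Calkin algebra. -/

import Mathlib

open Cardinal

set_option linter.unusedSectionVars false
set_option linter.unusedVariables false

namespace CalkinUniv

open scoped InnerProductSpace InnerProduct
open ContinuousLinearMap

section Cpt

variable {H H' H'' : Type*} [NormedAddCommGroup H] [InnerProductSpace ℂ H] [CompleteSpace H]
  [NormedAddCommGroup H'] [InnerProductSpace ℂ H'] [CompleteSpace H']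
  [NormedAddCommGroup H''] [InnerProductSpace ℂ H''] [CompleteSpace H'']

def Cpt (T : H →L[ℂ] H') : Prop :=
  ∀ ε > 0, ∃ N : Submodule ℂ H, FiniteDimensional ℂ N ∧ ∀ x ∈ Nᗮ, ‖T x‖ ≤ ε * ‖x‖

theorem Cpt.add {S T : H →L[ℂ] H'} (hS : Cpt S) (hT : Cpt T) : Cpt (S + T) := by
  intro ε hε
  obtain ⟨N, hN, h1⟩ := hS (ε / 2) (by positivity)
  obtain ⟨M, hM, h2⟩ := hT (ε / 2) (by positivity)
  refine ⟨N ⊔ M, inferInstance, fun x hx => ?_⟩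
  have hxN : x ∈ Nᗮ := Submodule.orthogonal_le le_sup_left hx
  have hxM : x ∈ Mᗮ := Submodule.orthogonal_le le_sup_right hx
  calc ‖(S + T) x‖ ≤ ‖S x‖ + ‖T x‖ := norm_add_le _ _
    _ ≤ ε / 2 * ‖x‖ + ε / 2 * ‖x‖ := add_le_add (h1 x hxN) (h2 x hxM)
    _ = ε * ‖x‖ := by ring

theorem Cpt.zero : Cpt (0 : H →L[ℂ] H') := by
  intro ε hε
  exact ⟨⊥, inferInstance, fun x _ => by simp; positivity⟩

theorem Cpt.comp_left {T : H →L[ℂ] H'} (hT : Cpt T) (S : H' →L[ℂ] H'') : Cpt (S ∘L T) := by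
  intro ε hε
  obtain ⟨N, hN, h⟩ := hT (ε / (‖S‖ + 1)) (by positivity)
  refine ⟨N, hN, fun x hx => ?_⟩
  calc ‖S (T x)‖ ≤ ‖S‖ * ‖T x‖ := S.le_opNorm _
    _ ≤ (‖S‖ + 1) * (ε / (‖S‖ + 1) * ‖x‖) := by
        gcongr
        · linarith
        · exact h x hx
    _ = ε * ‖x‖ := by field_simp

theorem Cpt.comp_right {T : H' →L[ℂ] H''} (hT : Cpt T) (S : H →L[ℂ] H') : Cpt (T ∘L S) := by
  intro ε hε
  obtain ⟨N, hN, h⟩ := hT (ε / (‖S‖ + 1)) (by positivity)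
  refine ⟨N.map (S†).toLinearMap, inferInstance, fun x hx => ?_⟩
  have hSx : S x ∈ Nᗮ := by
    rw [Submodule.mem_orthogonal] at hx ⊢
    intro n hn
    have := hx ((S†) n) (Submodule.mem_map_of_mem hn)
    rwa [adjoint_inner_left] at this
  calc ‖T (S x)‖ ≤ ε / (‖S‖ + 1) * ‖S x‖ := h _ hSx
    _ ≤ ε / (‖S‖ + 1) * ((‖S‖ + 1) * ‖x‖) := by
        gcongr
        refine (S.le_opNorm x).trans ?_
        gcongr; linarith
    _ = ε * ‖x‖ := by field_simp

theorem Cpt.smul {T : H →L[ℂ] H'} (hT : Cpt T) (c : ℂ) : Cpt (c • T) := by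
  have : c • T = (c • ContinuousLinearMap.id ℂ H') ∘L T := by ext; simp
  rw [this]; exact hT.comp_left _

theorem Cpt.neg {T : H →L[ℂ] H'} (hT : Cpt T) : Cpt (-T) := by
  have := hT.smul (-1); simpa using this

theorem Cpt.sub {S T : H →L[ℂ] H'} (hS : Cpt S) (hT : Cpt T) : Cpt (S - T) := by
  rw [sub_eq_add_neg]; exact hS.add hT.neg

theorem Cpt.sum {ι : Type*} (s : Finset ι) {T : ι → H →L[ℂ] H'} (hT : ∀ i ∈ s, Cpt (T i)) :
    Cpt (∑ i ∈ s, T i) := by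
  classical
  induction s using Finset.induction_on with
  | empty => simpa using Cpt.zero
  | insert a s ha ih =>
    rw [Finset.sum_insert ha]
    exact (hT a (by simp)).add (ih fun i hi => hT i (by simp [hi]))

theorem Cpt.of_approx {T : H →L[ℂ] H'} (h : ∀ ε > 0, ∃ S : H →L[ℂ] H', Cpt S ∧ ‖T - S‖ ≤ ε) :
    Cpt T := by
  intro ε hε
  obtain ⟨S, hS, hTS⟩ := h (ε / 2) (by positivity)
  obtain ⟨N, hN, h1⟩ := hS (ε / 2) (by positivity)
  refine ⟨N, hN, fun x hx => ?_⟩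
  calc ‖T x‖ = ‖(T - S) x + S x‖ := by simp
    _ ≤ ‖(T - S) x‖ + ‖S x‖ := norm_add_le _ _
    _ ≤ ε / 2 * ‖x‖ + ε / 2 * ‖x‖ :=
        add_le_add (((T - S).le_opNorm x).trans (by gcongr)) (h1 x hx)
    _ = ε * ‖x‖ := by ring

theorem Cpt.adj {T : H →L[ℂ] H'} (hT : Cpt T) : Cpt (T†) := by
  intro ε hε
  obtain ⟨N, hN, h⟩ := hT ε hε
  refine ⟨N.map T.toLinearMap, inferInstance, fun x hx => ?_⟩
  have hy : (T†) x ∈ Nᗮ := by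
    rw [Submodule.mem_orthogonal] at hx ⊢
    intro n hn
    rw [adjoint_inner_right]
    exact hx (T n) (Submodule.mem_map_of_mem hn)
  have h1 : ‖(T†) x‖ * ‖(T†) x‖ ≤ ε * ‖x‖ * ‖(T†) x‖ := by
    have h2 : ‖(T†) x‖ * ‖(T†) x‖ = ‖⟪T ((T†) x), x⟫_ℂ‖ := by
      rw [← adjoint_inner_right, inner_self_eq_norm_sq_to_K]
      simp [sq]
    rw [h2]
    calc ‖⟪T ((T†) x), x⟫_ℂ‖ ≤ ‖T ((T†) x)‖ * ‖x‖ := norm_inner_le_norm _ _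
      _ ≤ (ε * ‖(T†) x‖) * ‖x‖ := by gcongr; exact h _ hy
      _ = _ := by ring
  rcases eq_or_ne (‖(T†) x‖) 0 with h0 | h0
  · rw [h0]; positivity
  · exact le_of_mul_le_mul_right h1 (lt_of_le_of_ne (norm_nonneg _) (Ne.symm h0))

theorem Cpt.of_adjoint_comp {T : H →L[ℂ] H'} (hT : Cpt (T† ∘L T)) : Cpt T := by
  intro ε hε
  obtain ⟨N, hN, h⟩ := hT (ε ^ 2) (by positivity)
  refine ⟨N, hN, fun x hx => ?_⟩
  refine le_of_sq_le_sq ?_ (by positivity)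
  have h2 : ‖T x‖ ^ 2 = ‖⟪(T† ∘L T) x, x⟫_ℂ‖ := by
    rw [comp_apply, adjoint_inner_left, inner_self_eq_norm_sq_to_K]
    simp
  rw [h2]
  calc ‖⟪(T† ∘L T) x, x⟫_ℂ‖ ≤ ‖(T† ∘L T) x‖ * ‖x‖ := norm_inner_le_norm _ _
      _ ≤ (ε ^ 2 * ‖x‖) * ‖x‖ := by gcongr; exact h _ hx
      _ = _ := by ring

/-- finite rank operators: range inside a finite dimensional space. -/
theorem Cpt.of_range {T : H →L[ℂ] H'} (R : Submodule ℂ H') [FiniteDimensional ℂ R]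
    (h : ∀ x, T x ∈ R) : Cpt T := by
  intro ε hε
  refine ⟨R.map (T†).toLinearMap, inferInstance, fun x hx => ?_⟩
  have : ⟪T x, T x⟫_ℂ = 0 := by
    rw [← adjoint_inner_left]
    exact hx _ (Submodule.mem_map_of_mem (h x))
  rw [inner_self_eq_zero] at this
  rw [this]; simp; positivity

theorem Cpt.exists_finite {T : H →L[ℂ] H'} (hT : Cpt T) {ε : ℝ} (hε : 0 < ε) :
    ∃ N : Submodule ℂ H, ∃ _ : FiniteDimensional ℂ N, ‖T - T ∘L N.starProjection‖ ≤ ε := by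
  obtain ⟨N, hN, h⟩ := hT ε hε
  refine ⟨N, hN, opNorm_le_bound _ hε.le fun x => ?_⟩
  have : (T - T ∘L N.starProjection) x = T (x - N.starProjection x) := by simp
  rw [this]
  refine (h _ (N.sub_starProjection_mem_orthogonal x)).trans ?_
  gcongr
  have : x - N.starProjection x = Nᗮ.starProjection x := by
    rw [Submodule.starProjection_orthogonal]; simp
  rw [this]
  exact Submodule.norm_starProjection_apply_le _ _

theorem cpt_iff (T : H →L[ℂ] H') : Cpt T ↔ IsCompactOperator T := by
  constructor
  · intro hT
    choose N hN h using fun n : ℕ => hT.exists_finite (ε := 1 / ((n : ℝ) + 1)) (by positivity)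
    refine isCompactOperator_of_tendsto (l := Filter.atTop) (F := fun n => T ∘L (N n).starProjection)
      ?_ (Filter.Eventually.of_forall fun n => ?_)
    · rw [tendsto_iff_norm_sub_tendsto_zero]
      refine squeeze_zero (fun _ => norm_nonneg _) (fun n => ?_)
        tendsto_one_div_add_atTop_nhds_zero_nat
      rw [norm_sub_rev]; exact h n
    · have := hN n
      have : ProperSpace (N n) := FiniteDimensional.proper ℂ (N n)
      have h1 : IsCompactOperator ((N n).orthogonalProjectionOnto : H →L[ℂ] N n) :=
        isCompactOperator_of_locallyCompactSpace_dom (N n).orthogonalProjectionOnto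
      exact h1.clm_comp (T ∘L (N n).subtypeL)
  · intro hT ε hε
    have h1 : TotallyBounded (T '' Metric.closedBall 0 1) := by
      obtain ⟨K, hK, hs⟩ := hT.image_closedBall_subset_compact (r := 1) (f := T.toLinearMap)
      exact hK.totallyBounded.subset hs
    obtain ⟨t, ht, hcov⟩ := Metric.totallyBounded_iff.1 h1 ε hε
    have : FiniteDimensional ℂ (Submodule.span ℂ t) := FiniteDimensional.span_of_finite ℂ ht
    refine ⟨(Submodule.span ℂ t).map (T†).toLinearMap, inferInstance, ?_⟩
    have key : ∀ x ∈ ((Submodule.span ℂ t).map (T†).toLinearMap)ᗮ, ‖x‖ ≤ 1 → ‖T x‖ ≤ ε := by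
      intro x hx hx1
      have hTx : T x ∈ T '' Metric.closedBall 0 1 := ⟨x, by simpa using hx1, rfl⟩
      have := hcov hTx
      simp only [Set.mem_iUnion, Metric.mem_ball] at this
      obtain ⟨y, hy, hd⟩ := this
      have h0 : ⟪y, T x⟫_ℂ = 0 := by
        rw [← adjoint_inner_left]
        exact hx _ (Submodule.mem_map_of_mem (Submodule.subset_span hy))
      have h2 : ‖T x‖ * ‖T x‖ ≤ ε * ‖T x‖ := by
        have h3 : ‖T x‖ * ‖T x‖ = ‖⟪T x - y, T x⟫_ℂ‖ := by
          rw [inner_sub_left, h0, inner_self_eq_norm_sq_to_K]; simp [sq]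
        rw [h3]
        refine (norm_inner_le_norm _ _).trans ?_
        rw [← dist_eq_norm]; gcongr
      rcases eq_or_ne (‖T x‖) 0 with h0 | h0
      · rw [h0]; positivity
      · exact le_of_mul_le_mul_right h2 (lt_of_le_of_ne (norm_nonneg _) (Ne.symm h0))
    intro x hx
    rcases eq_or_ne x 0 with rfl | h0
    · simp
    have hn : 0 < ‖x‖ := norm_pos_iff.2 h0
    have := key ((‖x‖⁻¹ : ℂ) • x) (Submodule.smul_mem _ _ hx) (by simp [norm_smul, hn.ne'])
    rw [map_smul, norm_smul] at this
    simp at this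
    rwa [inv_mul_le_iff₀ hn, mul_comm] at this

end Cpt

end CalkinUniv

namespace CalkinUniv

open scoped InnerProductSpace InnerProduct
open ContinuousLinearMap

section Quasi

variable {H : Type*} [NormedAddCommGroup H] [InnerProductSpace ℂ H] [CompleteSpace H]

/-- Growing sequence of finite dimensional subspaces. -/
noncomputable def growSub (B : Finset (H →L[ℂ] H)) (G : Submodule ℂ H) : ℕ → Submodule ℂ H
  | 0 => G
  | k + 1 => growSub B G k ⊔ ((⨆ b : B, (growSub B G k).map b.1.toLinearMap) ⊔
      (⨆ b : B, (growSub B G k).map (star b.1).toLinearMap))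

theorem growSub_fd (B : Finset (H →L[ℂ] H)) (G : Submodule ℂ H) [FiniteDimensional ℂ G] (k : ℕ) :
    FiniteDimensional ℂ (growSub B G k) := by
  induction k with
  | zero => simpa [growSub]
  | succ k ih => rw [growSub]; infer_instance

theorem growSub_le_succ (B : Finset (H →L[ℂ] H)) (G : Submodule ℂ H) (k : ℕ) :
    growSub B G k ≤ growSub B G (k + 1) := by
  conv_rhs => rw [growSub]
  exact le_sup_left

theorem growSub_mono (B : Finset (H →L[ℂ] H)) (G : Submodule ℂ H) : Monotone (growSub B G) :=
  monotone_nat_of_le_succ (growSub_le_succ B G)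

theorem growSub_map (B : Finset (H →L[ℂ] H)) (G : Submodule ℂ H) (k : ℕ) {b : H →L[ℂ] H}
    (hb : b ∈ B) {x : H} (hx : x ∈ growSub B G k) : b x ∈ growSub B G (k + 1) := by
  rw [growSub]
  refine Submodule.mem_sup_right (Submodule.mem_sup_left ?_)
  exact Submodule.mem_iSup_of_mem (⟨b, hb⟩ : B) (Submodule.mem_map_of_mem hx)

theorem growSub_map' (B : Finset (H →L[ℂ] H)) (G : Submodule ℂ H) (k : ℕ) {b : H →L[ℂ] H}
    (hb : b ∈ B) {x : H} (hx : x ∈ growSub B G k) : (star b) x ∈ growSub B G (k + 1) := by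
  rw [growSub]
  refine Submodule.mem_sup_right (Submodule.mem_sup_right ?_)
  exact Submodule.mem_iSup_of_mem (⟨b, hb⟩ : B) (Submodule.mem_map_of_mem hx)

theorem growSub_le (B : Finset (H →L[ℂ] H)) (G D : Submodule ℂ H) (hG : G ≤ D)
    (h1 : ∀ b ∈ B, ∀ x ∈ D, b x ∈ D) (h2 : ∀ b ∈ B, ∀ x ∈ D, (star b) x ∈ D) (k : ℕ) :
    growSub B G k ≤ D := by
  induction k with
  | zero => simpa [growSub]
  | succ k ih =>
    rw [growSub]
    refine sup_le ih (sup_le (iSup_le fun b => ?_) (iSup_le fun b => ?_))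
    · rintro _ ⟨x, hx, rfl⟩; exact h1 _ b.2 _ (ih hx)
    · rintro _ ⟨x, hx, rfl⟩; exact h2 _ b.2 _ (ih hx)

/-- Abstract off-diagonal estimate. -/
theorem offdiag_bound (P : ℕ → H →L[ℂ] H) (hs : ∀ k, star (P k) = P k)
    (hP : ∀ j k, j ≤ k → P k * P j = P j) (b : H →L[ℂ] H)
    (hb : ∀ k, P (k + 1) * b * P k = b * P k) (m : ℕ) :
    ‖∑ k ∈ Finset.range m, (1 - P k) * b * P k‖ ≤ ‖b‖ := by
  have hP' : ∀ j k, j ≤ k → P j * P k = P j := by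
    intro j k hjk
    have := congrArg star (hP j k hjk)
    simpa [hs] using this
  have orth : ∀ (k : ℕ) (x y : H), P k x = x → P k y = 0 → ⟪x, y⟫_ℂ = 0 := by
    intro k x y hx hy
    have h1 : ⟪P k x, y⟫_ℂ = ⟪x, P k y⟫_ℂ := by
      conv_lhs => rw [← hs k, star_eq_adjoint, adjoint_inner_left]
    rw [hx, hy] at h1; simpa using h1
  have pyth : ∀ (k : ℕ) (x y : H), P k x = x → P k y = 0 → ‖x + y‖ ^ 2 = ‖x‖ ^ 2 + ‖y‖ ^ 2 := by
    intro k x y hx hy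
    have := norm_add_sq_eq_norm_sq_add_norm_sq_of_inner_eq_zero x y (orth k x y hx hy)
    simpa [sq] using this
  have pw : ∀ {S T : H →L[ℂ] H} (h : S = T) (x : H), S x = T x := by
    rintro S T rfl x; rfl
  have mulP : ∀ j k, j ≤ k → ∀ x, P k (P j x) = P j x := fun j k h x => pw (hP j k h) x
  have mulP' : ∀ j k, j ≤ k → ∀ x, P j (P k x) = P j x := fun j k h x => pw (hP' j k h) x
  have hbx : ∀ k x, P (k + 1) (b (P k x)) = b (P k x) := fun k x => pw (hb k) x
  have normP : ∀ k x, ‖P k x‖ ^ 2 ≤ ‖x‖ ^ 2 := by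
    intro k x
    have := pyth k (P k x) (x - P k x) (mulP k k le_rfl x) (by simp [mulP k k le_rfl x])
    simp only [add_sub_cancel] at this
    rw [this]; nlinarith [norm_nonneg (x - P k x)]
  have normQ : ∀ k x, ‖x - P k x‖ ^ 2 ≤ ‖x‖ ^ 2 := by
    intro k x
    have := pyth k (P k x) (x - P k x) (mulP k k le_rfl x) (by simp [mulP k k le_rfl x])
    simp only [add_sub_cancel] at this
    rw [this]; nlinarith [norm_nonneg (P k x)]
  have normb : ∀ x, ‖b x‖ ^ 2 ≤ ‖b‖ ^ 2 * ‖x‖ ^ 2 := by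
    intro x
    rw [← mul_pow]
    exact pow_le_pow_left₀ (norm_nonneg _) (b.le_opNorm x) 2
  have main : ∀ m (x : H), P (m + 1) ((∑ k ∈ Finset.range (m + 1), (1 - P k) * b * P k) x) =
      (∑ k ∈ Finset.range (m + 1), (1 - P k) * b * P k) x ∧
      ‖(∑ k ∈ Finset.range (m + 1), (1 - P k) * b * P k) x‖ ^ 2 ≤ ‖b‖ ^ 2 * ‖P m x‖ ^ 2 := by
    intro m
    induction m with
    | zero =>
      intro x
      simp only [zero_add, Finset.range_one, Finset.sum_singleton]
      have e : ((1 - P 0) * b * P 0) x = b (P 0 x) - P 0 (b (P 0 x)) := by simp [mul_apply_eq_comp]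
      rw [e]
      constructor
      · rw [map_sub, mulP 0 1 (by simp), hbx 0 x]
      · exact (normQ 0 _).trans (normb _)
    | succ m ih =>
      intro x
      rw [Finset.sum_range_succ]
      set Z := ∑ k ∈ Finset.range (m + 1), (1 - P k) * b * P k with hZ
      obtain ⟨i1, i2⟩ := ih x
      have e : (Z + (1 - P (m + 1)) * b * P (m + 1)) x
          = Z x + (b (P (m + 1) x) - P (m + 1) (b (P (m + 1) x))) := by simp [mul_apply_eq_comp]
      rw [e]
      constructor
      · rw [map_add, map_sub, mulP _ _ (Nat.le_succ _), hbx (m + 1) x]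
        congr 1
        rw [← i1, mulP _ _ (Nat.le_succ _)]
      · rw [pyth (m + 1) _ _ i1 (by rw [map_sub, mulP _ _ le_rfl, sub_self])]
        have e2 : b (P (m + 1) x) - P (m + 1) (b (P (m + 1) x)) =
            b (P (m + 1) x - P m x) - P (m + 1) (b (P (m + 1) x - P m x)) := by
          rw [map_sub, map_sub, hbx m x]; abel
        have e3 := pyth m (P m x) (P (m + 1) x - P m x) (mulP m m le_rfl x)
          (by rw [map_sub, mulP m m le_rfl, mulP' m (m + 1) (Nat.le_succ _), sub_self])
        rw [add_sub_cancel] at e3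
        rw [e2, e3, mul_add]
        exact add_le_add i2 ((normQ _ _).trans (normb _))
  refine opNorm_le_bound _ (norm_nonneg _) fun x => ?_
  rcases m with _ | m
  · simp; positivity
  · refine le_of_sq_le_sq ?_ (by positivity)
    rw [mul_pow]
    exact ((main m x).2).trans (mul_le_mul_of_nonneg_left (normP m x) (by positivity))

theorem quasicentral (D : Submodule ℂ H) (B : Finset (H →L[ℂ] H))
    (h1 : ∀ b ∈ B, ∀ x ∈ D, b x ∈ D) (h2 : ∀ b ∈ B, ∀ x ∈ D, (star b) x ∈ D)
    (G : Submodule ℂ H) [FiniteDimensional ℂ G] (hG : G ≤ D) {ε : ℝ} (hε : 0 < ε) :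
    ∃ (e : H →L[ℂ] H) (R : Submodule ℂ H), FiniteDimensional ℂ R ∧ R ≤ D ∧ G ≤ R ∧
      star e = e ∧ ‖e‖ ≤ 1 ∧ (∀ x ∈ G, e x = x) ∧ (∀ x, e x ∈ R) ∧
      ∀ b ∈ B, ‖e * b - b * e‖ ≤ ε := by
  obtain ⟨C, hC⟩ : ∃ C : ℝ, ∀ b ∈ B, ‖b‖ ≤ C :=
    ⟨∑ b ∈ B, ‖b‖, fun b hb => Finset.single_le_sum (f := fun b : H →L[ℂ] H => ‖b‖)
      (fun i _ => norm_nonneg i) hb⟩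
  obtain ⟨m, hm⟩ := exists_nat_gt (2 * C / ε)
  have hfd := growSub_fd B G
  let P : ℕ → H →L[ℂ] H := fun k => (growSub B G k).starProjection
  have hs : ∀ k, star (P k) = P k := fun k => isSelfAdjoint_starProjection _
  have hPx : ∀ k x, x ∈ growSub B G k → P k x = x := fun k x hx =>
    Submodule.starProjection_eq_self_iff.2 hx
  have hPm : ∀ k x, P k x ∈ growSub B G k := fun k x => Submodule.starProjection_apply_mem _ _
  have hP : ∀ j k, j ≤ k → P k * P j = P j := by
    intro j k hjk
    ext x
    exact hPx k _ (growSub_mono B G hjk (hPm j x))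
  have hb1 : ∀ b ∈ B, ∀ k, P (k + 1) * b * P k = b * P k := by
    intro b hb k; ext x; exact hPx _ _ (growSub_map B G k hb (hPm k x))
  have hb2 : ∀ b ∈ B, ∀ k, P (k + 1) * (star b) * P k = (star b) * P k := by
    intro b hb k; ext x; exact hPx _ _ (growSub_map' B G k hb (hPm k x))
  refine ⟨((m : ℂ) + 1)⁻¹ • ∑ k ∈ Finset.range (m + 1), P k, growSub B G (m + 1), inferInstance,
    growSub_le B G D hG h1 h2 _, growSub_mono B G (Nat.zero_le _), ?_, ?_, ?_, ?_, ?_⟩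
  · rw [star_smul, star_sum]; simp [hs]
  · rw [norm_smul]
    have : ‖∑ k ∈ Finset.range (m + 1), P k‖ ≤ (m + 1 : ℝ) := by
      refine (norm_sum_le_of_le _ (fun k _ => Submodule.starProjection_norm_le _)).trans ?_
      simp
    have e : ‖((m : ℂ) + 1)⁻¹‖ = ((m : ℝ) + 1)⁻¹ := by
      rw [norm_inv]; norm_cast
    rw [e, inv_mul_le_iff₀ (by positivity)]; simpa using this
  · intro x hx
    have : ∀ k ∈ Finset.range (m + 1), P k x = x := fun k _ =>
      hPx k x (growSub_mono B G (Nat.zero_le k) hx)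
    rw [smul_apply, sum_apply, Finset.sum_congr rfl this]
    have h0 : ((m : ℂ) + 1) ≠ 0 := by norm_cast
    simp [← Nat.cast_smul_eq_nsmul ℂ, smul_smul, h0]
  · intro x
    rw [smul_apply, sum_apply]
    exact Submodule.smul_mem _ _ (Submodule.sum_mem _ fun k hk =>
      growSub_mono B G (by have := Finset.mem_range.1 hk; omega) (hPm k x))
  · intro b hb
    have hZ1 := offdiag_bound P hs hP b (hb1 b hb) (m + 1)
    have hZ2 := offdiag_bound P hs hP (star b) (hb2 b hb) (m + 1)
    set Z1 := ∑ k ∈ Finset.range (m + 1), (1 - P k) * b * P k with hZ1d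
    set Z2 := ∑ k ∈ Finset.range (m + 1), (1 - P k) * (star b) * P k with hZ2d
    have key : (((m : ℂ) + 1)⁻¹ • ∑ k ∈ Finset.range (m + 1), P k) * b
        - b * (((m : ℂ) + 1)⁻¹ • ∑ k ∈ Finset.range (m + 1), P k)
        = ((m : ℂ) + 1)⁻¹ • (star Z2 - Z1) := by
      rw [smul_mul_assoc, mul_smul_comm, ← smul_sub, Finset.sum_mul, Finset.mul_sum, hZ1d, hZ2d,
        star_sum, ← Finset.sum_sub_distrib, ← Finset.sum_sub_distrib]
      congr 1
      refine Finset.sum_congr rfl fun k _ => ?_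
      simp only [star_mul, star_star, star_sub, star_one, hs]
      noncomm_ring
    rw [key, norm_smul]
    have e : ‖((m : ℂ) + 1)⁻¹‖ = ((m : ℝ) + 1)⁻¹ := by
      rw [norm_inv]; norm_cast
    rw [e, inv_mul_le_iff₀ (by positivity)]
    have h3 : ‖star Z2 - Z1‖ ≤ 2 * C := by
      refine (norm_sub_le _ _).trans ?_
      rw [norm_star] at *
      have := hC b hb
      linarith
    refine h3.trans ?_
    rw [div_lt_iff₀ hε] at hm
    nlinarith

end Quasi

end CalkinUniv

namespace CalkinUniv

open scoped InnerProductSpace InnerProduct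
open ContinuousLinearMap

section Cayley

variable {H : Type*} [NormedAddCommGroup H] [InnerProductSpace ℂ H] [CompleteSpace H]

theorem mul_ap (S T : H →L[ℂ] H) (x : H) : (S * T) x = S (T x) := rfl

theorem norm_le_one_of_isom {C : H →L[ℂ] H} (h : star C * C = 1) : ‖C‖ ≤ 1 := by
  have h1 : ‖C‖ * ‖C‖ ≤ 1 := by
    rw [← CStarRing.norm_star_mul_self, h]; exact norm_id_le
  nlinarith [norm_nonneg C]

theorem exists_cayInv (h : H →L[ℂ] H) (hs : star h = h) :
    ∃ g : H →L[ℂ] H, (1 - Complex.I • h) * g = 1 ∧ g * (1 - Complex.I • h) = 1 := by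
  have h1 : IsUnit (algebraMap ℂ (H →L[ℂ] H) (-Complex.I) - h) := by
    by_contra hc
    have h2 : -Complex.I ∈ spectrum ℂ h := by rwa [spectrum.mem_iff]
    have := IsSelfAdjoint.mem_spectrum_eq_re (show IsSelfAdjoint h from hs) h2
    simpa using congrArg Complex.im this
  obtain ⟨u, hu⟩ := h1
  have e : (1 - Complex.I • h) = Complex.I • (u : H →L[ℂ] H) := by
    rw [hu, smul_sub, Algebra.algebraMap_eq_smul_one, smul_smul]; simp
  refine ⟨(-Complex.I) • ((u⁻¹ : _ˣ) : H →L[ℂ] H), ?_, ?_⟩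
  · rw [e, smul_mul_smul_comm]; simp
  · rw [e, smul_mul_smul_comm]; simp

open Classical in
/-- The inverse of `1 - i h`. -/
noncomputable def cayInv (h : H →L[ℂ] H) : H →L[ℂ] H :=
  if hs : star h = h then (exists_cayInv h hs).choose else 0

theorem mul_cayInv {h : H →L[ℂ] H} (hs : star h = h) : (1 - Complex.I • h) * cayInv h = 1 := by
  rw [cayInv, dif_pos hs]; exact (exists_cayInv h hs).choose_spec.1

theorem cayInv_mul {h : H →L[ℂ] H} (hs : star h = h) : cayInv h * (1 - Complex.I • h) = 1 := by
  rw [cayInv, dif_pos hs]; exact (exists_cayInv h hs).choose_spec.2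

theorem cayInv_unique {h g : H →L[ℂ] H} (hs : star h = h) (hg : (1 - Complex.I • h) * g = 1) :
    cayInv h = g := by
  calc cayInv h = cayInv h * ((1 - Complex.I • h) * g) := by rw [hg, mul_one]
    _ = g := by rw [← mul_assoc, cayInv_mul hs, one_mul]

/-- The Cayley transform. -/
noncomputable def cay (h : H →L[ℂ] H) : H →L[ℂ] H := 2 • cayInv h - 1

theorem cay_eq {h : H →L[ℂ] H} (hs : star h = h) : cay h = (1 + Complex.I • h) * cayInv h := by
  have := mul_cayInv hs
  have e : (1 + Complex.I • h) = 2 • (1 : H →L[ℂ] H) - (1 - Complex.I • h) := by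
    rw [two_smul]; abel
  rw [e, sub_mul, this, cay, smul_mul_assoc, one_mul]

theorem cay_eq' {h : H →L[ℂ] H} (hs : star h = h) : cay h = cayInv h * (1 + Complex.I • h) := by
  have := cayInv_mul hs
  have e : (1 + Complex.I • h) = 2 • (1 : H →L[ℂ] H) - (1 - Complex.I • h) := by
    rw [two_smul]; abel
  rw [e, mul_sub, this, cay, mul_smul_comm, mul_one]

theorem star_cay_mul {h : H →L[ℂ] H} (hs : star h = h) : star (cay h) * cay h = 1 := by
  have e1 : star (1 + Complex.I • h) = 1 - Complex.I • h := by
    rw [star_add, star_smul, hs]; simp [sub_eq_add_neg]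
  have e2 : star (1 - Complex.I • h) = 1 + Complex.I • h := by
    rw [star_sub, star_smul, hs]; simp
  have e3 : (1 - Complex.I • h) * (1 + Complex.I • h) =
    (1 + Complex.I • h) * (1 - Complex.I • h) := by
    simp only [mul_add, mul_sub, add_mul, sub_mul, one_mul, mul_one]; abel
  have e4 : star (cayInv h) * (1 + Complex.I • h) = 1 := by
    have := congrArg star (mul_cayInv hs)
    rwa [star_mul, e2, star_one] at this
  rw [cay_eq hs, star_mul, e1]
  calc star (cayInv h) * (1 - Complex.I • h) * ((1 + Complex.I • h) * cayInv h)
      = star (cayInv h) * ((1 - Complex.I • h) * (1 + Complex.I • h)) * cayInv h := by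
        simp only [mul_assoc]
    _ = (star (cayInv h) * (1 + Complex.I • h)) * ((1 - Complex.I • h) * cayInv h) := by
        rw [e3]; simp only [mul_assoc]
    _ = 1 := by rw [e4, mul_cayInv hs, mul_one]

theorem cay_mul_star {h : H →L[ℂ] H} (hs : star h = h) : cay h * star (cay h) = 1 := by
  have e1 : star (1 + Complex.I • h) = 1 - Complex.I • h := by
    rw [star_add, star_smul, hs]; simp [sub_eq_add_neg]
  have e2 : star (1 - Complex.I • h) = 1 + Complex.I • h := by
    rw [star_sub, star_smul, hs]; simp
  have e3 : (1 - Complex.I • h) * (1 + Complex.I • h) =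
    (1 + Complex.I • h) * (1 - Complex.I • h) := by
    simp only [mul_add, mul_sub, add_mul, sub_mul, one_mul, mul_one]; abel
  have e4 : (1 + Complex.I • h) * star (cayInv h) = 1 := by
    have := congrArg star (cayInv_mul hs)
    rwa [star_mul, e2, star_one] at this
  rw [cay_eq' hs, star_mul, e1]
  calc cayInv h * (1 + Complex.I • h) * ((1 - Complex.I • h) * star (cayInv h))
      = cayInv h * ((1 + Complex.I • h) * (1 - Complex.I • h)) * star (cayInv h) := by
        simp only [mul_assoc]
    _ = (cayInv h * (1 - Complex.I • h)) * ((1 + Complex.I • h) * star (cayInv h)) := by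
        rw [← e3]; simp only [mul_assoc]
    _ = 1 := by rw [e4, cayInv_mul hs, mul_one]

theorem norm_cayInv_le {h : H →L[ℂ] H} (hs : star h = h) : ‖cayInv h‖ ≤ 1 := by
  have h1 := norm_le_one_of_isom (star_cay_mul hs)
  have e : cayInv h = (2⁻¹ : ℂ) • (cay h + 1) := by
    rw [cay, sub_add_cancel, ← Nat.cast_smul_eq_nsmul ℂ, smul_smul]; simp
  rw [e, norm_smul]
  have h2 : ‖cay h + 1‖ ≤ 1 + 1 := (norm_add_le _ _).trans (add_le_add h1 norm_id_le)
  have h3 : ‖(2⁻¹ : ℂ)‖ = 2⁻¹ := by simp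
  rw [h3]; linarith

theorem cay_comm {h : H →L[ℂ] H} (hs : star h = h) (b : H →L[ℂ] H) :
    ‖cay h * b - b * cay h‖ ≤ 2 * ‖h * b - b * h‖ := by
  have e : cay h * b - b * cay h =
      (2 * Complex.I) • (cayInv h * (h * b - b * h) * cayInv h) := by
    have e1 : cayInv h * b = cayInv h * b * ((1 - Complex.I • h) * cayInv h) := by
      rw [mul_cayInv hs, mul_one]
    have e2 : b * cayInv h = (cayInv h * (1 - Complex.I • h)) * b * cayInv h := by
      rw [cayInv_mul hs, one_mul]
    have e3 : cay h * b - b * cay h = (2 : ℂ) • (cayInv h * b - b * cayInv h) := by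
      simp only [cay, two_smul]; noncomm_ring
    rw [e3, e1, e2, mul_smul]
    congr 1
    simp only [mul_sub, sub_mul, mul_one, one_mul, smul_sub, mul_assoc, smul_mul_assoc,
      mul_smul_comm]
    abel
  rw [e, norm_smul]
  have h1 := norm_cayInv_le hs
  have h2 : ‖cayInv h * (h * b - b * h) * cayInv h‖ ≤ 1 * ‖h * b - b * h‖ * 1 := by
    refine (norm_mul_le _ _).trans ?_
    gcongr
    refine (norm_mul_le _ _).trans ?_
    gcongr
  have h3 : ‖(2 * Complex.I : ℂ)‖ = 2 := by simp
  rw [h3]; linarith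

theorem Cpt.mul_left {S : H →L[ℂ] H} (hS : Cpt S) (T : H →L[ℂ] H) : Cpt (T * S) := hS.comp_left T
theorem Cpt.mul_right {S : H →L[ℂ] H} (hS : Cpt S) (T : H →L[ℂ] H) : Cpt (S * T) :=
  hS.comp_right T

theorem cay_sub_cay {h h' : H →L[ℂ] H} (hs : star h = h) (hs' : star h' = h')
    (hc : Cpt (h - h')) : Cpt (cay h - cay h') := by
  have e : cay h - cay h' = (2 * Complex.I) • (cayInv h * (h - h') * cayInv h') := by
    have e1 : cayInv h = cayInv h * ((1 - Complex.I • h') * cayInv h') := by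
      rw [mul_cayInv hs', mul_one]
    have e2 : cayInv h' = (cayInv h * (1 - Complex.I • h)) * cayInv h' := by
      rw [cayInv_mul hs, one_mul]
    have e3 : cay h - cay h' = (2 : ℂ) • (cayInv h - cayInv h') := by
      simp only [cay, two_smul]; abel
    rw [e3, mul_smul]
    congr 1
    have e4 : cayInv h - cayInv h' = cayInv h * ((1 - Complex.I • h') * cayInv h') -
      (cayInv h * (1 - Complex.I • h)) * cayInv h' := by rw [← e1, ← e2]
    rw [e4]
    simp only [mul_sub, sub_mul, mul_one, one_mul, smul_sub, mul_assoc, smul_mul_assoc,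
      mul_smul_comm]
    abel
  rw [e]
  exact ((hc.mul_left _).mul_right _).smul _

theorem cay_proj {q : H →L[ℂ] H} (hs : star q = q) (hq : q * q = q) :
    cay q * cay q = 1 - 2 • q := by
  have h1 : cayInv q = 1 + ((Complex.I - 1) / 2) • q := by
    refine cayInv_unique hs ?_
    rw [sub_mul, one_mul, mul_add, mul_one, smul_mul_smul_comm, hq]
    have : (1 : H →L[ℂ] H) + ((Complex.I - 1) / 2) • q
        - (Complex.I • q + (Complex.I * ((Complex.I - 1) / 2)) • q)
      = 1 + (((Complex.I - 1) / 2) - (Complex.I + Complex.I * ((Complex.I - 1) / 2))) • q := by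
      module
    rw [this]
    have h0 : ((Complex.I - 1) / 2) - (Complex.I + Complex.I * ((Complex.I - 1) / 2)) = 0 := by
      ring_nf; rw [Complex.I_sq]; ring
    rw [h0]; simp
  have h2 : cay q = 1 + (Complex.I - 1) • q := by
    rw [cay, h1]; module
  rw [h2, mul_add, add_mul, add_mul, smul_mul_smul_comm, hq, one_mul, mul_one, one_mul]
  have : (1 : H →L[ℂ] H) + (Complex.I - 1) • q +
      ((Complex.I - 1) • q + ((Complex.I - 1) * (Complex.I - 1)) • q) =
      1 + ((Complex.I - 1) + (Complex.I - 1) + (Complex.I - 1) * (Complex.I - 1)) • q := by module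
  rw [this]
  have h0 : (Complex.I - 1) + (Complex.I - 1) + (Complex.I - 1) * (Complex.I - 1) = -2 := by
    ring_nf; rw [Complex.I_sq]; ring
  rw [h0]; module

/-- Cosine and sine cutoffs. -/
theorem exists_cs (D : Submodule ℂ H) (B : Finset (H →L[ℂ] H))
    (h1 : ∀ b ∈ B, ∀ x ∈ D, b x ∈ D) (h2 : ∀ b ∈ B, ∀ x ∈ D, (star b) x ∈ D)
    (G : Submodule ℂ H) [FiniteDimensional ℂ G] (hG : G ≤ D) {ε : ℝ} (hε : 0 < ε) :
    ∃ (c s : H →L[ℂ] H) (R : Submodule ℂ H), FiniteDimensional ℂ R ∧ R ≤ D ∧ G ≤ R ∧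
      star c = c ∧ star s = s ∧ c * c + s * s = 1 ∧ (∀ x ∈ G, c x = 0) ∧ (∀ x, s x ∈ R) ∧
      (∀ x, c x - x ∈ R) ∧ (∀ b ∈ B, ‖c * b - b * c‖ ≤ ε) ∧ (∀ b ∈ B, ‖s * b - b * s‖ ≤ ε) := by
  classical
  obtain ⟨e, R, hRf, hRD, hGR, hes, hen, heG, heR, heb⟩ := quasicentral D (B ∪ B.image star)
    (by
      intro b hb
      rcases Finset.mem_union.1 hb with hb | hb
      · exact h1 b hb
      · obtain ⟨b', hb', rfl⟩ := Finset.mem_image.1 hb; exact h2 b' hb')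
    (by
      intro b hb
      rcases Finset.mem_union.1 hb with hb | hb
      · exact h2 b hb
      · obtain ⟨b', hb', rfl⟩ := Finset.mem_image.1 hb; rw [star_star]; exact h1 b' hb')
    G hG (show 0 < ε / 2 by positivity)
  set w := cay e with hw
  have w1 : star w * w = 1 := star_cay_mul hes
  have w2 : w * star w = 1 := cay_mul_star hes
  have hwb : ∀ b ∈ B, ‖w * b - b * w‖ ≤ ε := by
    intro b hb
    refine (cay_comm hes b).trans ?_
    have := heb b (Finset.mem_union_left _ hb)
    linarith
  have hwb' : ∀ b ∈ B, ‖star w * b - b * star w‖ ≤ ε := by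
    intro b hb
    have e1 : star w * b - b * star w = star (star b * w - w * star b) := by simp
    rw [e1, norm_star, norm_sub_rev]
    refine (cay_comm hes _).trans ?_
    have := heb (star b) (Finset.mem_union_right _ (Finset.mem_image_of_mem _ hb))
    linarith
  have wR : ∀ x, w x - x ∈ R := by
    intro x
    have e1 : w - 1 = (2 * Complex.I) • (e * cayInv e) := by
      have h3 := mul_cayInv hes
      rw [hw, cay]
      have h4 : cayInv e = 1 + Complex.I • (e * cayInv e) := by
        conv_rhs => rw [← h3]
        rw [sub_mul, smul_mul_assoc, one_mul]; abel
      have h5 : 2 • cayInv e - 1 - 1 = (2 : ℂ) • (cayInv e - 1) := by module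
      rw [h5, mul_smul]; congr 1
      exact sub_eq_of_eq_add' h4
    have e2 : w x - x = (w - 1) x := by simp
    rw [e2, e1]
    exact Submodule.smul_mem _ _ (heR _)
  have wR' : ∀ x, (star w) x - x ∈ R := by
    intro x
    have h3 := wR ((star w) x)
    have h4 : w ((star w) x) = x := by rw [← mul_ap, w2]; rfl
    rw [h4] at h3
    rw [← neg_sub]; exact Submodule.neg_mem _ h3
  have wG : ∀ x ∈ G, w x = Complex.I • x := by
    intro x hx
    have h3 : cayInv e ((1 - Complex.I • e) x) = x := by rw [← mul_ap, cayInv_mul hes]; rfl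
    have h4 : (1 - Complex.I • e) x = (1 - Complex.I) • x := by
      rw [sub_smul]; simp [heG x hx]
    rw [h4, map_smul] at h3
    have h5 : w x = (2:ℂ) • cayInv e x - x := by rw [hw, cay]; simp [two_smul]
    have h6 : cayInv e x = ((1 + Complex.I) / 2) • x := by
      conv_rhs => rw [← h3, smul_smul]
      have : (1 + Complex.I) / 2 * (1 - Complex.I) = 1 := by
        ring_nf; rw [Complex.I_sq]; ring
      rw [this, one_smul]
    rw [h5, h6]; module
  have wG' : ∀ x ∈ G, (star w) x = (-Complex.I) • x := by
    intro x hx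
    have h3 : (star w) (w x) = x := by rw [← mul_ap, w1]; rfl
    rw [wG x hx, map_smul] at h3
    conv_rhs => rw [← h3, smul_smul]
    simp
  have hI : ∀ z : ℂ, star ((2 : ℂ)⁻¹) = (2 : ℂ)⁻¹ := by intro z; simp
  refine ⟨(2 : ℂ)⁻¹ • (w + star w), (-Complex.I / 2) • (w - star w), R, hRf, hRD, hGR,
    ?_, ?_, ?_, ?_, ?_, ?_, ?_, ?_⟩
  · rw [star_smul, hI 0, star_add, star_star, add_comm]
  · rw [star_smul, star_sub, star_star]
    have : star (-Complex.I / 2) = Complex.I / 2 := by simp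
    rw [this]; module
  · simp only [smul_mul_smul_comm, mul_add, add_mul, mul_sub, sub_mul, w1, w2]
    have h3 : (-Complex.I / 2 * (-Complex.I / 2)) = - (2⁻¹ * 2⁻¹ : ℂ) := by
      ring_nf; rw [Complex.I_sq]; ring
    rw [h3]; module
  · intro x hx
    simp [wG x hx, wG' x hx]
  · intro x
    have : (((-Complex.I / 2) • (w - star w)) : H →L[ℂ] H) x =
      (-Complex.I / 2) • ((w x - x) - ((star w) x - x)) := by simp
    rw [this]
    exact Submodule.smul_mem _ _ (Submodule.sub_mem _ (wR x) (wR' x))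
  · intro x
    have : (((2:ℂ)⁻¹ • (w + star w)) : H →L[ℂ] H) x - x =
      (2:ℂ)⁻¹ • ((w x - x) + ((star w) x - x)) := by
      simp only [smul_apply, add_apply]; module
    rw [this]
    exact Submodule.smul_mem _ _ (Submodule.add_mem _ (wR x) (wR' x))
  · intro b hb
    have : ((2 : ℂ)⁻¹ • (w + star w)) * b - b * ((2 : ℂ)⁻¹ • (w + star w)) =
      (2 : ℂ)⁻¹ • ((w * b - b * w) + (star w * b - b * star w)) := by
      rw [smul_mul_assoc, mul_smul_comm, ← smul_sub]; congr 1; noncomm_ring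
    rw [this, norm_smul]
    have h3 : ‖(2⁻¹ : ℂ)‖ = 2⁻¹ := by simp
    have h4 := (norm_add_le (w * b - b * w) (star w * b - b * star w)).trans
      (add_le_add (hwb b hb) (hwb' b hb))
    rw [h3]; linarith
  · intro b hb
    have : ((-Complex.I / 2) • (w - star w)) * b - b * ((-Complex.I / 2) • (w - star w)) =
      (-Complex.I / 2) • ((w * b - b * w) - (star w * b - b * star w)) := by
      rw [smul_mul_assoc, mul_smul_comm, ← smul_sub]; congr 1; noncomm_ring
    rw [this, norm_smul]
    have h3 : ‖(-Complex.I / 2 : ℂ)‖ = 2⁻¹ := by simp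
    have h4 := (norm_sub_le (w * b - b * w) (star w * b - b * star w)).trans
      (add_le_add (hwb b hb) (hwb' b hb))
    rw [h3]; linarith

end Cayley

end CalkinUniv

namespace CalkinUniv

open scoped InnerProductSpace InnerProduct
open ContinuousLinearMap

section LemmaP

variable {H : Type*} [NormedAddCommGroup H] [InnerProductSpace ℂ H] [CompleteSpace H]

theorem star_mul_proj_small {f k : H →L[ℂ] H} {G N : Submodule ℂ H} [FiniteDimensional ℂ N]
    (hNG : N ≤ G) (hf : ∀ x ∈ G, f x = 0) (hfn : ‖f‖ ≤ 2) {δ : ℝ}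
    (hk : ‖star k - star k * N.starProjection‖ ≤ δ) : ‖f * k‖ ≤ 2 * δ := by
  have h1 : f * N.starProjection = 0 := by
    ext x; exact hf _ (hNG (Submodule.starProjection_apply_mem _ _))
  have hs : star N.starProjection = N.starProjection := isSelfAdjoint_starProjection N
  have e : f * k = f * (k - N.starProjection * k) := by
    rw [mul_sub, ← mul_assoc, h1]; simp
  have h2 : ‖k - N.starProjection * k‖ ≤ δ := by
    rw [← norm_star, star_sub, star_mul, hs]; exact hk
  rw [e]
  refine (norm_mul_le _ _).trans ?_
  gcongr

theorem reflection_conj (F : Finset (H →L[ℂ] H)) {R : H →L[ℂ] H} (hRs : star R = R)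
    (hR : R * R = 1) (hF : ∀ b ∈ F, Cpt (R * b - b * R)) {ε : ℝ} (hε : 0 < ε) :
    ∃ u : H →L[ℂ] H, star u * u = 1 ∧ u * star u = 1 ∧ Cpt (u - 1) ∧
      ∀ b ∈ F, ‖u * (R * b * R) * star u - b‖ ≤ ε := by
  classical
  set q : H →L[ℂ] H := (2⁻¹ : ℂ) • (1 - R) with hq
  have hI : star ((2 : ℂ)⁻¹) = (2 : ℂ)⁻¹ := by simp
  have hqs : star q = q := by rw [hq, star_smul, star_sub, star_one, hRs, hI]
  have hqq : q * q = q := by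
    rw [hq, smul_mul_smul_comm]
    simp only [mul_sub, sub_mul, mul_one, one_mul, hR]; module
  have hRq : R = 1 - 2 • q := by rw [hq]; module
  have hqn : ‖q‖ ≤ 1 := by
    have : ‖q‖ * ‖q‖ = ‖q‖ := by
      conv_rhs => rw [← hqq]
      conv_rhs => rw [← hqs]
      rw [hqs]
      conv_rhs => rw [← hqs]
      rw [hqs]
      have := CStarRing.norm_star_mul_self (x := q)
      rw [hqs] at this; exact this.symm
    nlinarith [norm_nonneg q]
  have hqF : ∀ b ∈ F, Cpt (q * b - b * q) := by
    intro b hb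
    have : q * b - b * q = (-2⁻¹ : ℂ) • (R * b - b * R) := by
      rw [hq]; simp only [smul_mul_assoc, mul_smul_comm, sub_mul, mul_sub, one_mul, mul_one]; module
    rw [this]; exact (hF b hb).smul _
  set δ := ε / 80 with hδ
  have hδ0 : 0 < δ := by positivity
  have hN : ∀ b : F, ∃ N : Submodule ℂ H, ∃ _ : FiniteDimensional ℂ N,
      ‖star (q * b.1 - b.1 * q) - star (q * b.1 - b.1 * q) * N.starProjection‖ ≤ δ :=
    fun b => (hqF b.1 b.2).adj.exists_finite hδ0
  choose N hNf hN using hN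
  obtain ⟨e, R', hR'f, -, -, hes, hen, heG, heR, heb⟩ := quasicentral ⊤ F (by simp) (by simp)
    (⨆ b, N b) le_top hδ0
  set f := 1 - e with hf
  have hfs : star f = f := by rw [hf]; simp [hes]
  have hfn : ‖f‖ ≤ 2 := by
    refine (norm_sub_le _ _).trans ?_
    have : ‖(1 : H →L[ℂ] H)‖ ≤ 1 := norm_id_le
    linarith
  have hfb : ∀ b ∈ F, ‖f * b - b * f‖ ≤ δ := by
    intro b hb
    have : f * b - b * f = -(e * b - b * e) := by rw [hf]; noncomm_ring
    rw [this, norm_neg]; exact heb b hb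
  have hfk : ∀ b (hb : b ∈ F), ‖f * (q * b - b * q)‖ ≤ 2 * δ := by
    intro b hb
    have := hNf ⟨b, hb⟩
    exact star_mul_proj_small (le_iSup N ⟨b, hb⟩)
      (fun x hx => by simp [hf, heG x hx]) hfn (hN ⟨b, hb⟩)
  set q' := f * q * f with hq'
  have hq's : star q' = q' := by simp [hq', hfs, hqs, mul_assoc]
  have hq'b : ∀ b ∈ F, ‖q' * b - b * q'‖ ≤ 10 * δ := by
    intro b hb
    have e1 : q' * b - b * q' = f * q * (f * b - b * f) + f * (q * b - b * q) * f
      + (f * b - b * f) * (q * f) := by rw [hq']; noncomm_ring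
    rw [e1]
    have a1 : ‖f * q * (f * b - b * f)‖ ≤ 2 * 1 * δ := by
      refine (norm_mul_le _ _).trans ?_
      gcongr
      · refine (norm_mul_le _ _).trans ?_
        gcongr
      · exact hfb b hb
    have a2 : ‖f * (q * b - b * q) * f‖ ≤ (2 * δ) * 2 := by
      refine (norm_mul_le _ _).trans ?_
      gcongr
      exact hfk b hb
    have a3 : ‖(f * b - b * f) * (q * f)‖ ≤ δ * (1 * 2) := by
      refine (norm_mul_le _ _).trans ?_
      gcongr
      · exact hfb b hb
      · refine (norm_mul_le _ _).trans ?_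
        gcongr
    have := norm_add₃_le (a := f * q * (f * b - b * f)) (b := f * (q * b - b * q) * f)
      (c := (f * b - b * f) * (q * f))
    linarith
  have hec : Cpt e := Cpt.of_range R' heR
  have hqq' : Cpt (q' - q) := by
    have : q' - q = e * (q * e) - e * q - q * e := by rw [hq', hf]; noncomm_ring
    rw [this]
    exact ((hec.mul_right _).sub (hec.mul_right _)).sub (hec.mul_left _)
  set C := cay q' with hC
  have hC1 : star C * C = 1 := star_cay_mul hq's
  have hC2 : C * star C = 1 := cay_mul_star hq's
  have hCn := norm_le_one_of_isom hC1
  have hCc : Cpt (C - cay q) := cay_sub_cay hq's hqs hqq'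
  have hRc : R = cay q * cay q := by rw [cay_proj hqs hqq, ← hRq]
  have hCR : Cpt (C * C - R) := by
    have : C * C - R = C * (C - cay q) + (C - cay q) * cay q := by rw [hRc]; noncomm_ring
    rw [this]
    exact (hCc.mul_left _).add (hCc.mul_right _)
  have y1 : star (C * C) * (C * C) = 1 := by
    rw [star_mul, mul_assoc, ← mul_assoc (star C) C C, hC1, one_mul, hC1]
  have y2 : (C * C) * star (C * C) = 1 := by
    rw [star_mul, mul_assoc, ← mul_assoc C (star C) _, hC2, one_mul, hC2]
  have hYn : ‖star (C * C)‖ ≤ 1 := by rw [norm_star]; exact norm_le_one_of_isom y1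
  refine ⟨C * C * R, ?_, ?_, ?_, ?_⟩
  · rw [star_mul, hRs, mul_assoc, ← mul_assoc (star (C * C)), y1, one_mul, hR]
  · rw [star_mul, hRs, mul_assoc, ← mul_assoc R, hR, one_mul, y2]
  · have : C * C * R - 1 = (C * C - R) * R := by rw [sub_mul, hR]
    rw [this]; exact hCR.mul_right _
  · intro b hb
    have e1 : C * C * R * (R * b * R) * star (C * C * R) - b =
        ((C * C) * b - b * (C * C)) * star (C * C) := by
      have e2 : C * C * R * (R * b * R) * star (C * C * R) = (C * C) * b * star (C * C) := by
        rw [star_mul (C * C) R, hRs]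
        calc _ = (C * C) * (R * R) * b * (R * R) * star (C * C) := by simp only [mul_assoc]
          _ = _ := by rw [hR, mul_one, mul_one]
      rw [e2, sub_mul, mul_assoc b, y2, mul_one]
    rw [e1]
    have e3 : (C * C) * b - b * (C * C) = C * (C * b - b * C) + (C * b - b * C) * C := by
      noncomm_ring
    have e4 : ‖C * b - b * C‖ ≤ 20 * δ := by
      refine (cay_comm hq's b).trans ?_
      have := hq'b b hb
      linarith
    have e5 : ‖(C * C) * b - b * (C * C)‖ ≤ 1 * (20 * δ) + (20 * δ) * 1 := by
      rw [e3]
      refine (norm_add_le _ _).trans (add_le_add ((norm_mul_le _ _).trans ?_)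
        ((norm_mul_le _ _).trans ?_))
      · gcongr
      · gcongr
    calc _ ≤ ‖(C * C) * b - b * (C * C)‖ * ‖star (C * C)‖ := norm_mul_le _ _
      _ ≤ (1 * (20 * δ) + (20 * δ) * 1) * 1 := by gcongr
      _ ≤ ε := by rw [hδ]; linarith

end LemmaP

section Defs

variable {A : Type*} [NonUnitalCStarAlgebra A]
variable {H H' H'' : Type*} [NormedAddCommGroup H] [InnerProductSpace ℂ H] [CompleteSpace H]
  [NormedAddCommGroup H'] [InnerProductSpace ℂ H'] [CompleteSpace H']
  [NormedAddCommGroup H''] [InnerProductSpace ℂ H''] [CompleteSpace H'']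

structure IsRep (E : NonUnitalStarSubalgebra ℂ A) (φ : A → H →L[ℂ] H) : Prop where
  map_add : ∀ a ∈ E, ∀ b ∈ E, φ (a + b) = φ a + φ b
  map_smul : ∀ (c : ℂ), ∀ a ∈ E, φ (c • a) = c • φ a
  map_mul : ∀ a ∈ E, ∀ b ∈ E, φ (a * b) = φ a * φ b
  map_star : ∀ a ∈ E, φ (star a) = star (φ a)
  norm_le : ∀ a ∈ E, ‖φ a‖ ≤ ‖a‖

theorem IsRep.mono {E E' : NonUnitalStarSubalgebra ℂ A} {φ : A → H →L[ℂ] H} (h : IsRep E' φ)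
    (hE : E ≤ E') : IsRep E φ where
  map_add a ha b hb := h.map_add a (hE ha) b (hE hb)
  map_smul c a ha := h.map_smul c a (hE ha)
  map_mul a ha b hb := h.map_mul a (hE ha) b (hE hb)
  map_star a ha := h.map_star a (hE ha)
  norm_le a ha := h.norm_le a (hE ha)

theorem IsRep.map_sub {E : NonUnitalStarSubalgebra ℂ A} {φ : A → H →L[ℂ] H} (h : IsRep E φ)
    {a b : A} (ha : a ∈ E) (hb : b ∈ E) : φ (a - b) = φ a - φ b := by
  have h1 : a - b = a + (-1 : ℂ) • b := by simp [sub_eq_add_neg]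
  rw [h1, h.map_add a ha _ (SMulMemClass.smul_mem _ hb), h.map_smul _ b hb]; simp [sub_eq_add_neg]

/-- Approximate unitary equivalence via unitaries that are compact perturbations of `1`. -/
def Kapp (E : Set A) (Φ Ψ : A → H →L[ℂ] H) : Prop :=
  ∀ F : Finset A, (∀ a ∈ F, a ∈ E) → ∀ ε > 0, ∃ u : H →L[ℂ] H, star u * u = 1 ∧ u * star u = 1 ∧
    Cpt (u - 1) ∧ ∀ a ∈ F, ‖u * Ψ a * star u - Φ a‖ ≤ ε

theorem Kapp.refl (E : Set A) (Φ : A → H →L[ℂ] H) : Kapp E Φ Φ := by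
  intro F _ ε hε
  exact ⟨1, by simp, by simp, by simpa using Cpt.zero, fun a _ => by simpa using hε.le⟩

theorem Kapp.mono {E E' : Set A} {Φ Ψ : A → H →L[ℂ] H} (h : Kapp E' Φ Ψ) (hE : E ⊆ E') :
    Kapp E Φ Ψ := fun F hF => h F fun a ha => hE (hF a ha)

theorem norm_conj_le {u T : H →L[ℂ] H} (hu : star u * u = 1) : ‖u * T * star u‖ ≤ ‖T‖ := by
  have h1 := norm_le_one_of_isom hu
  calc ‖u * T * star u‖ ≤ ‖u * T‖ * ‖star u‖ := norm_mul_le _ _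
    _ ≤ (‖u‖ * ‖T‖) * ‖star u‖ := by gcongr; exact norm_mul_le _ _
    _ ≤ (1 * ‖T‖) * 1 := by rw [norm_star]; gcongr
    _ = ‖T‖ := by ring

theorem cpt_star_sub_one {u : H →L[ℂ] H} (h : Cpt (u - 1)) : Cpt (star u - 1) := by
  have : star u - 1 = star (u - 1) := by simp
  rw [this]; exact h.adj

theorem Kapp.symm {E : Set A} {Φ Ψ : A → H →L[ℂ] H} (h : Kapp E Φ Ψ) : Kapp E Ψ Φ := by
  intro F hF ε hε
  obtain ⟨u, h1, h2, h3, h4⟩ := h F hF ε hε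
  refine ⟨star u, by simpa using h2, by simpa using h1, cpt_star_sub_one h3, fun a ha => ?_⟩
  have e : star u * Φ a * star (star u) - Ψ a =
      - (star u * (u * Ψ a * star u - Φ a) * star (star u)) := by
    rw [star_star]
    have : star u * (u * Ψ a * star u - Φ a) * u =
      (star u * u) * Ψ a * (star u * u) - star u * Φ a * u := by noncomm_ring
    rw [this, h1]; simp
  rw [e, norm_neg]
  exact (norm_conj_le (by simpa using h2)).trans (h4 a ha)

theorem Kapp.trans {E : Set A} {Φ Ψ Θ : A → H →L[ℂ] H} (h : Kapp E Φ Ψ) (h' : Kapp E Ψ Θ) :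
    Kapp E Φ Θ := by
  intro F hF ε hε
  obtain ⟨u, h1, h2, h3, h4⟩ := h F hF (ε / 2) (by positivity)
  obtain ⟨v, g1, g2, g3, g4⟩ := h' F hF (ε / 2) (by positivity)
  refine ⟨u * v, ?_, ?_, ?_, fun a ha => ?_⟩
  · rw [star_mul, mul_assoc, ← mul_assoc (star u), h1, one_mul, g1]
  · rw [star_mul, mul_assoc, ← mul_assoc v, g2, one_mul, h2]
  · have : u * v - 1 = u * (v - 1) + (u - 1) := by noncomm_ring
    rw [this]; exact (g3.mul_left _).add h3
  · have : u * v * Θ a * star (u * v) - Φ a = u * (v * Θ a * star v - Ψ a) * star u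
      + (u * Ψ a * star u - Φ a) := by rw [star_mul]; noncomm_ring
    rw [this]
    refine (norm_add_le _ _).trans ?_
    have := (norm_conj_le (T := v * Θ a * star v - Ψ a) h1).trans (g4 a ha)
    have := h4 a ha
    linarith

theorem Kapp.cpt {E : Set A} {Φ Ψ : A → H →L[ℂ] H} (h : Kapp E Φ Ψ) {a : A} (ha : a ∈ E) :
    Cpt (Φ a - Ψ a) := by
  refine Cpt.of_approx fun ε hε => ?_
  obtain ⟨u, h1, h2, h3, h4⟩ := h {a} (by simpa) ε hε
  refine ⟨u * Ψ a * star u - Ψ a, ?_, ?_⟩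
  · have : u * Ψ a * star u - Ψ a = (u - 1) * (Ψ a * star u) + Ψ a * (star u - 1) := by
      noncomm_ring
    rw [this]
    exact (h3.mul_right _).add ((cpt_star_sub_one h3).mul_left _)
  · have : Φ a - Ψ a - (u * Ψ a * star u - Ψ a) = -(u * Ψ a * star u - Φ a) := by abel
    rw [this, norm_neg]; exact h4 a (by simp)

/-- If `Φ` is a norm limit of maps which are `Kapp` to `Ψ` then it is. -/
theorem Kapp.of_limit {E : Set A} {Φ Ψ : A → H →L[ℂ] H}
    (h : ∀ F : Finset A, (∀ a ∈ F, a ∈ E) → ∀ ε > 0, ∃ Φ' : A → H →L[ℂ] H, Kapp E Φ' Ψ ∧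
      ∀ a ∈ F, ‖Φ' a - Φ a‖ ≤ ε) : Kapp E Φ Ψ := by
  intro F hF ε hε
  obtain ⟨Φ', h1, h2⟩ := h F hF (ε / 2) (by positivity)
  obtain ⟨u, h3, h4, h5, h6⟩ := h1 F hF (ε / 2) (by positivity)
  refine ⟨u, h3, h4, h5, fun a ha => ?_⟩
  have : u * Ψ a * star u - Φ a = (u * Ψ a * star u - Φ' a) + (Φ' a - Φ a) := by abel
  rw [this]
  refine (norm_add_le _ _).trans ?_
  have := h6 a ha
  have := h2 a ha
  linarith

theorem Kapp.reflection {E : Set A} {Ψ : A → H →L[ℂ] H} {R : H →L[ℂ] H} (hRs : star R = R)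
    (hR : R * R = 1) (hF : ∀ a ∈ E, Cpt (R * Ψ a - Ψ a * R)) :
    Kapp E Ψ (fun a => R * Ψ a * R) := by
  classical
  intro F hFE ε hε
  obtain ⟨u, h1, h2, h3, h4⟩ := reflection_conj (F.image Ψ) hRs hR (by
    intro b hb
    obtain ⟨a, ha, rfl⟩ := Finset.mem_image.1 hb
    exact hF a (hFE a ha)) hε
  exact ⟨u, h1, h2, h3, fun a ha => h4 _ (Finset.mem_image_of_mem _ ha)⟩

/-- Conjugating by a unitary between Hilbert spaces. -/
noncomputable def conj (T : H →L[ℂ] H') (Ψ : A → H →L[ℂ] H) : A → H' →L[ℂ] H' := fun a => T ∘L Ψ a ∘L T†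

theorem Kapp.conj {E : Set A} {Φ Ψ : A → H →L[ℂ] H} (h : Kapp E Φ Ψ) (T : H →L[ℂ] H')
    (h1 : T† ∘L T = 1) (h2 : T ∘L T† = 1) : Kapp E (conj T Φ) (CalkinUniv.conj T Ψ) := by
  intro F hF ε hε
  obtain ⟨u, g1, g2, g3, g4⟩ := h F hF ε hε
  have p1 : ∀ x, (T†) (T x) = x := fun x => congrArg (fun S : H →L[ℂ] H => S x) h1
  have p2 : ∀ x, T ((T†) x) = x := fun x => congrArg (fun S : H' →L[ℂ] H' => S x) h2
  have q1 : ∀ x, (star u) (u x) = x := fun x => congrArg (fun S : H →L[ℂ] H => S x) g1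
  have q2 : ∀ x, u ((star u) x) = x := fun x => congrArg (fun S : H →L[ℂ] H => S x) g2
  have es : star (T ∘L u ∘L T†) = T ∘L star u ∘L T† := by
    simp only [star_eq_adjoint, adjoint_comp, adjoint_adjoint, comp_assoc]
  have hT : ‖T‖ ≤ 1 := by
    refine opNorm_le_bound _ zero_le_one fun x => ?_
    rw [one_mul]
    refine le_of_sq_le_sq ?_ (norm_nonneg _)
    have : ‖T x‖ ^ 2 = ‖x‖ ^ 2 := by
      rw [← inner_self_eq_norm_sq (𝕜 := ℂ), ← inner_self_eq_norm_sq (𝕜 := ℂ),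
        ← adjoint_inner_left, p1]
    exact this.le
  refine ⟨T ∘L u ∘L T†, ?_, ?_, ?_, fun a ha => ?_⟩
  · rw [es]; ext x; simp [mul_ap, p1, q1, p2]
  · rw [es]; ext x; simp [mul_ap, p1, q2, p2]
  · have : T ∘L u ∘L T† - 1 = T ∘L ((u - 1) ∘L T†) := by ext x; simp [p2]
    rw [this]; exact (g3.comp_right _).comp_left _
  · rw [es]
    have : (T ∘L u ∘L T†) * CalkinUniv.conj T Ψ a * (T ∘L star u ∘L T†) - CalkinUniv.conj T Φ a =
        T ∘L (u * Ψ a * star u - Φ a) ∘L T† := by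
      ext x; simp [mul_ap, p1, CalkinUniv.conj]
    rw [this]
    calc _ ≤ ‖T‖ * (‖u * Ψ a * star u - Φ a‖ * ‖T†‖) :=
          (opNorm_comp_le _ _).trans (by gcongr; exact opNorm_comp_le _ _)
      _ ≤ 1 * (ε * 1) := by
        rw [LinearIsometryEquiv.norm_map]
        gcongr
        exact g4 a ha
      _ = ε := by ring

end Defs

end CalkinUniv

namespace CalkinUniv

open scoped InnerProductSpace InnerProduct
open ContinuousLinearMap

section LemmaV

variable {H H' : Type*} [NormedAddCommGroup H] [InnerProductSpace ℂ H] [CompleteSpace H]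
  [NormedAddCommGroup H'] [InnerProductSpace ℂ H'] [CompleteSpace H']

theorem opNorm_le_of_inner {T : H →L[ℂ] H'} {C : ℝ} (hC : 0 ≤ C)
    (h : ∀ x y, ‖⟪x, T y⟫_ℂ‖ ≤ C * ‖x‖ * ‖y‖) : ‖T‖ ≤ C := by
  refine opNorm_le_bound _ hC fun y => ?_
  have h1 := h (T y) y
  have h2 : ‖T y‖ * ‖T y‖ = ‖⟪T y, T y⟫_ℂ‖ := by
    rw [inner_self_eq_norm_sq_to_K]; simp [sq]
  rw [← h2] at h1
  rcases eq_or_ne (‖T y‖) 0 with h0 | h0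
  · rw [h0]; positivity
  · refine le_of_mul_le_mul_right (a := ‖T y‖) ?_ (lt_of_le_of_ne (norm_nonneg _) (Ne.symm h0))
    linarith

theorem V_step (D : Submodule ℂ H') (β : ℕ → H →L[ℂ] H) (τ : ℕ → H' →L[ℂ] H')
    (hD1 : ∀ i, ∀ x ∈ D, τ i x ∈ D) (hD2 : ∀ i, ∀ x ∈ D, (star (τ i)) x ∈ D)
    (hApp : ∀ X : Submodule ℂ H', FiniteDimensional ℂ X → X ≤ D → ∀ n : ℕ, ∀ ε > 0,
      ∀ N : Submodule ℂ H, FiniteDimensional ℂ N → ∃ W : H' →L[ℂ] H,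
        (∀ x ∈ X, ∀ y ∈ X, ⟪W x, W y⟫_ℂ = ⟪x, y⟫_ℂ) ∧ (∀ x ∈ X, ∀ ν ∈ N, ⟪ν, W x⟫_ℂ = 0) ∧
        ∀ i ≤ n, ∀ x ∈ X, ∀ y ∈ X, ‖⟪W x, β i (W y)⟫_ℂ - ⟪x, τ i y⟫_ℂ‖ ≤ ε * ‖x‖ * ‖y‖)
    (z : ℕ → H') (hz : ∀ i, z i ∈ D) (n : ℕ) (r : H' →L[ℂ] H') (hrn : ‖r‖ ≤ 1)
    (M : Submodule ℂ H) [FiniteDimensional ℂ M] (T : Submodule ℂ H') [FiniteDimensional ℂ T]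
    (hTD : T ≤ D) (hrT : ∀ x, r x - x ∈ T) {δ : ℝ} (hδ : 0 < δ) :
    ∃ (V : H' →L[ℂ] H) (r' : H' →L[ℂ] H') (M' : Submodule ℂ H) (T' : Submodule ℂ H'),
      ‖r'‖ ≤ 1 ∧ FiniteDimensional ℂ M' ∧ FiniteDimensional ℂ T' ∧ T' ≤ D ∧
      (∀ x, r' x - x ∈ T') ∧
      (∀ x y, ⟪V x, V y⟫_ℂ + ⟪r' x, r' y⟫_ℂ = ⟪r x, r y⟫_ℂ) ∧
      (∀ i ≤ n, r' (z i) = 0) ∧ (∀ i ≤ n, ‖τ i * r' - r' * τ i‖ ≤ δ) ∧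
      (∀ ν ∈ M, ∀ x, ⟪ν, V x⟫_ℂ = 0) ∧ (∀ i ≤ n, ∀ ν ∈ M, ∀ x, ⟪ν, β i (V x)⟫_ℂ = 0) ∧
      (∀ i ≤ n, ∀ ν ∈ M, ∀ x, ⟪β i ν, V x⟫_ℂ = 0) ∧
      (∀ i ≤ n, ∀ x y, ‖⟪V x, β i (V y)⟫_ℂ - ⟪V x, V (τ i y)⟫_ℂ‖ ≤
        (2 * δ + ‖τ i * r - r * τ i‖) * ‖x‖ * ‖y‖) ∧
      M ≤ M' ∧ (∀ x, V x ∈ M') := by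
  classical
  let I := Fin (n + 1)
  have hrD : ∀ x ∈ D, r x ∈ D := by
    intro x hx
    have := D.add_mem (hTD (hrT x)) hx
    simpa using this
  -- the subspace to be killed
  let G : Submodule ℂ H' := (⨆ i : I, Submodule.span ℂ {r (z i)}) ⊔
    (T ⊔ ⨆ i : I, T.map (τ i).toLinearMap)
  have hGD : G ≤ D := by
    refine sup_le (iSup_le fun i => ?_) (sup_le hTD (iSup_le fun i => ?_))
    · rw [Submodule.span_singleton_le_iff_mem]; exact hrD _ (hz _)
    · rintro _ ⟨x, hx, rfl⟩; exact hD1 _ _ (hTD hx)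
  have hGz : ∀ i ≤ n, r (z i) ∈ G := by
    intro i hi
    refine Submodule.mem_sup_left (Submodule.mem_iSup_of_mem (⟨i, by omega⟩ : I) ?_)
    exact Submodule.mem_span_singleton_self _
  have hGc : ∀ i ≤ n, ∀ x, τ i (r x) - r (τ i x) ∈ G := by
    intro i hi x
    have : τ i (r x) - r (τ i x) = τ i (r x - x) - (r (τ i x) - τ i x) := by
      rw [map_sub]; abel
    rw [this]
    refine Submodule.mem_sup_right (Submodule.sub_mem _ (Submodule.mem_sup_right ?_)
      (Submodule.mem_sup_left (hrT _)))
    exact Submodule.mem_iSup_of_mem (⟨i, by omega⟩ : I) (Submodule.mem_map_of_mem (hrT x))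
  let B : Finset (H' →L[ℂ] H') := (Finset.range (n + 1)).image τ
  have hB : ∀ i ≤ n, τ i ∈ B := fun i hi =>
    Finset.mem_image_of_mem _ (Finset.mem_range.2 (by omega))
  obtain ⟨c, s, R, hRf, hRD, hGR, hcs, hss, hcs1, hcG, hsR, hcR, hcb, hsb⟩ := exists_cs D B
    (by intro b hb; obtain ⟨i, -, rfl⟩ := Finset.mem_image.1 hb; exact hD1 i)
    (by intro b hb; obtain ⟨i, -, rfl⟩ := Finset.mem_image.1 hb; exact hD2 i) G hGD hδ
  let N : Submodule ℂ H := M ⊔ ((⨆ i : I, M.map (β i).toLinearMap) ⊔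
    (⨆ i : I, M.map ((β i)†).toLinearMap))
  obtain ⟨W, hW1, hW2, hW3⟩ := hApp R hRf hRD n δ hδ N inferInstance
  have hinner : ∀ x y, ⟪s x, s y⟫_ℂ + ⟪c x, c y⟫_ℂ = ⟪x, y⟫_ℂ := by
    intro x y
    have h1 : ⟪s x, s y⟫_ℂ = ⟪x, (s * s) y⟫_ℂ := by
      conv_lhs => rw [← hss, star_eq_adjoint, adjoint_inner_left, ← star_eq_adjoint, hss]
      rfl
    have h2 : ⟪c x, c y⟫_ℂ = ⟪x, (c * c) y⟫_ℂ := by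
      conv_lhs => rw [← hcs, star_eq_adjoint, adjoint_inner_left, ← star_eq_adjoint, hcs]
      rfl
    rw [h1, h2, ← inner_add_right, ← add_apply, add_comm, hcs1]; rfl
  have hsn : ‖s‖ ≤ 1 := by
    refine opNorm_le_bound _ zero_le_one fun x => ?_
    rw [one_mul]
    refine le_of_sq_le_sq ?_ (norm_nonneg _)
    have := congrArg Complex.re (hinner x x)
    rw [Complex.add_re] at this
    have e1 : ∀ w : H', (⟪w, w⟫_ℂ).re = ‖w‖ ^ 2 := fun w => inner_self_eq_norm_sq (𝕜 := ℂ) w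
    rw [e1, e1, e1] at this
    nlinarith [norm_nonneg (c x)]
  have hcn : ‖c‖ ≤ 1 := by
    refine opNorm_le_bound _ zero_le_one fun x => ?_
    rw [one_mul]
    refine le_of_sq_le_sq ?_ (norm_nonneg _)
    have := congrArg Complex.re (hinner x x)
    rw [Complex.add_re] at this
    have e1 : ∀ w : H', (⟪w, w⟫_ℂ).re = ‖w‖ ^ 2 := fun w => inner_self_eq_norm_sq (𝕜 := ℂ) w
    rw [e1, e1, e1] at this
    nlinarith [norm_nonneg (s x)]
  refine ⟨W ∘L (s * r), c * r, M ⊔ R.map W.toLinearMap, T ⊔ R, ?_, inferInstance, inferInstance,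
    sup_le hTD hRD, ?_, ?_, ?_, ?_, ?_, ?_, ?_, ?_, le_sup_left, ?_⟩
  · refine (norm_mul_le _ _).trans ?_
    exact mul_le_one₀ hcn (norm_nonneg _) hrn
  · intro x
    have : (c * r) x - x = (r x - x) + (c (r x) - r x) := by rw [mul_ap]; abel
    rw [this]
    exact Submodule.add_mem _ (Submodule.mem_sup_left (hrT x)) (Submodule.mem_sup_right (hcR _))
  · intro x y
    have : ⟪(W ∘L (s * r)) x, (W ∘L (s * r)) y⟫_ℂ = ⟪s (r x), s (r y)⟫_ℂ :=
      hW1 _ (hsR _) _ (hsR _)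
    rw [this]
    exact hinner _ _
  · intro i hi
    exact hcG _ (hGz i hi)
  · intro i hi
    have e1 : c * (τ i * r - r * τ i) = 0 := by
      ext x; exact hcG _ (hGc i hi x)
    have e2 : τ i * (c * r) - (c * r) * τ i = -((c * τ i - τ i * c) * r)
        + c * (τ i * r - r * τ i) := by noncomm_ring
    rw [e2, e1, add_zero, norm_neg]
    calc _ ≤ ‖c * τ i - τ i * c‖ * ‖r‖ := norm_mul_le _ _
      _ ≤ δ * 1 := by gcongr; exact hcb _ (hB i hi)
      _ = δ := mul_one _
  · intro ν hν x
    exact hW2 _ (hsR _) ν (Submodule.mem_sup_left hν)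
  · intro i hi ν hν x
    rw [← adjoint_inner_left]
    refine hW2 _ (hsR _) _ (Submodule.mem_sup_right (Submodule.mem_sup_right ?_))
    exact Submodule.mem_iSup_of_mem (⟨i, by omega⟩ : I) (Submodule.mem_map_of_mem hν)
  · intro i hi ν hν x
    refine hW2 _ (hsR _) _ (Submodule.mem_sup_right (Submodule.mem_sup_left ?_))
    exact Submodule.mem_iSup_of_mem (⟨i, by omega⟩ : I) (Submodule.mem_map_of_mem hν)
  · intro i hi x y
    have e1 : ⟪(W ∘L (s * r)) x, (W ∘L (s * r)) (τ i y)⟫_ℂ = ⟪s (r x), s (r (τ i y))⟫_ℂ :=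
      hW1 _ (hsR _) _ (hsR _)
    have e2 := hW3 i hi _ (hsR (r x)) _ (hsR (r y))
    have n1 : ∀ x, ‖s (r x)‖ ≤ ‖x‖ := by
      intro x
      calc ‖s (r x)‖ ≤ 1 * ‖r x‖ := s.le_of_opNorm_le hsn _
        _ ≤ 1 * (1 * ‖x‖) := by gcongr; exact r.le_of_opNorm_le hrn _
        _ = ‖x‖ := by ring
    have e3 : ⟪(W ∘L (s * r)) x, β i ((W ∘L (s * r)) y)⟫_ℂ -
        ⟪(W ∘L (s * r)) x, (W ∘L (s * r)) (τ i y)⟫_ℂ =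
        (⟪W (s (r x)), β i (W (s (r y)))⟫_ℂ - ⟪s (r x), τ i (s (r y))⟫_ℂ) +
        ⟪s (r x), (τ i * (s * r) - (s * r) * τ i) y⟫_ℂ := by
      rw [e1]
      simp only [sub_apply, mul_ap, inner_sub_right, comp_apply]
      ring
    have e4 : ‖τ i * (s * r) - (s * r) * τ i‖ ≤ δ + ‖τ i * r - r * τ i‖ := by
      have : τ i * (s * r) - (s * r) * τ i = -((s * τ i - τ i * s) * r)
        + s * (τ i * r - r * τ i) := by noncomm_ring
      rw [this]
      refine (norm_add_le _ _).trans (add_le_add ?_ ?_)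
      · rw [norm_neg]
        calc _ ≤ ‖s * τ i - τ i * s‖ * ‖r‖ := norm_mul_le _ _
          _ ≤ δ * 1 := by gcongr; exact hsb _ (hB i hi)
          _ = δ := mul_one _
      · calc _ ≤ ‖s‖ * ‖τ i * r - r * τ i‖ := norm_mul_le _ _
          _ ≤ 1 * ‖τ i * r - r * τ i‖ := by gcongr
          _ = _ := one_mul _
    rw [e3]
    refine (norm_add_le _ _).trans ?_
    have a1 : ‖⟪W (s (r x)), β i (W (s (r y)))⟫_ℂ - ⟪s (r x), τ i (s (r y))⟫_ℂ‖
        ≤ δ * ‖x‖ * ‖y‖ := e2.trans (by gcongr <;> exact n1 _)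
    have a2 : ‖⟪s (r x), (τ i * (s * r) - (s * r) * τ i) y⟫_ℂ‖ ≤
        ‖x‖ * ((δ + ‖τ i * r - r * τ i‖) * ‖y‖) := by
      refine (norm_inner_le_norm _ _).trans ?_
      gcongr
      · exact n1 _
      · exact le_of_opNorm_le _ e4 _
    calc _ ≤ _ := add_le_add a1 a2
      _ = _ := by ring
  · intro x
    exact Submodule.mem_sup_right (Submodule.mem_map_of_mem (hsR _))

/-- Finite sums of operators with orthogonality. -/
theorem exists_V_seq (D : Submodule ℂ H') (β : ℕ → H →L[ℂ] H) (τ : ℕ → H' →L[ℂ] H')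
    (hD1 : ∀ i, ∀ x ∈ D, τ i x ∈ D) (hD2 : ∀ i, ∀ x ∈ D, (star (τ i)) x ∈ D)
    (hApp : ∀ X : Submodule ℂ H', FiniteDimensional ℂ X → X ≤ D → ∀ n : ℕ, ∀ ε > 0,
      ∀ N : Submodule ℂ H, FiniteDimensional ℂ N → ∃ W : H' →L[ℂ] H,
        (∀ x ∈ X, ∀ y ∈ X, ⟪W x, W y⟫_ℂ = ⟪x, y⟫_ℂ) ∧ (∀ x ∈ X, ∀ ν ∈ N, ⟪ν, W x⟫_ℂ = 0) ∧
        ∀ i ≤ n, ∀ x ∈ X, ∀ y ∈ X, ‖⟪W x, β i (W y)⟫_ℂ - ⟪x, τ i y⟫_ℂ‖ ≤ ε * ‖x‖ * ‖y‖)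
    (z : ℕ → H') (hz : ∀ i, z i ∈ D) :
    ∃ (V : ℕ → H' →L[ℂ] H) (r : ℕ → H' →L[ℂ] H'), (∀ n, ‖r n‖ ≤ 1) ∧ r 0 = 1 ∧
      (∀ n x y, ⟪V n x, V n y⟫_ℂ + ⟪r (n + 1) x, r (n + 1) y⟫_ℂ = ⟪r n x, r n y⟫_ℂ) ∧
      (∀ n i, i < n → r n (z i) = 0) ∧ (∀ n, Cpt (V n)) ∧
      (∀ m n, m ≠ n → ∀ x y, ⟪V m x, V n y⟫_ℂ = 0) ∧
      (∀ i m n, i ≤ m → i ≤ n → m ≠ n → ∀ x y, ⟪V m x, β i (V n y)⟫_ℂ = 0) ∧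
      (∀ i n, i < n → ∀ x y, ‖⟪V n x, β i (V n y)⟫_ℂ - ⟪V n x, V n (τ i y)⟫_ℂ‖ ≤
        (4 * (1 / 2) ^ n) * ‖x‖ * ‖y‖) := by
  let St := {p : (H' →L[ℂ] H') × Submodule ℂ H × Submodule ℂ H' //
    ‖p.1‖ ≤ 1 ∧ FiniteDimensional ℂ p.2.1 ∧ FiniteDimensional ℂ p.2.2 ∧ p.2.2 ≤ D ∧
      ∀ x, p.1 x - x ∈ p.2.2}
  have step : ∀ (n : ℕ) (p : St), ∃ (V : H' →L[ℂ] H) (p' : St),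
      (∀ x y, ⟪V x, V y⟫_ℂ + ⟪p'.1.1 x, p'.1.1 y⟫_ℂ = ⟪p.1.1 x, p.1.1 y⟫_ℂ) ∧
      (∀ i ≤ n, p'.1.1 (z i) = 0) ∧
      (∀ i ≤ n, ‖τ i * p'.1.1 - p'.1.1 * τ i‖ ≤ (1 / 2) ^ n) ∧
      (∀ ν ∈ p.1.2.1, ∀ x, ⟪ν, V x⟫_ℂ = 0) ∧
      (∀ i ≤ n, ∀ ν ∈ p.1.2.1, ∀ x, ⟪ν, β i (V x)⟫_ℂ = 0) ∧
      (∀ i ≤ n, ∀ ν ∈ p.1.2.1, ∀ x, ⟪β i ν, V x⟫_ℂ = 0) ∧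
      (∀ i ≤ n, ∀ x y, ‖⟪V x, β i (V y)⟫_ℂ - ⟪V x, V (τ i y)⟫_ℂ‖ ≤
        (2 * (1 / 2) ^ n + ‖τ i * p.1.1 - p.1.1 * τ i‖) * ‖x‖ * ‖y‖) ∧
      p.1.2.1 ≤ p'.1.2.1 ∧ (∀ x, V x ∈ p'.1.2.1) := by
    rintro n ⟨⟨r, M, T⟩, h1, h2, h3, h4, h5⟩
    obtain ⟨V, r', M', T', a1, a2, a3, a4, a5, rest⟩ := V_step D β τ hD1 hD2 hApp z hz n r h1 M T h4
      h5 (show (0 : ℝ) < (1 / 2) ^ n by positivity)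
    exact ⟨V, ⟨⟨r', M', T'⟩, a1, a2, a3, a4, a5⟩, rest⟩
  choose V next s1 s2 s3 s4 s5 s6 s7 s8 s9 using step
  let p0 : St := ⟨⟨1, ⊥, ⊥⟩, norm_id_le, inferInstanceAs (FiniteDimensional ℂ (⊥ : Submodule ℂ H)),
    inferInstanceAs (FiniteDimensional ℂ (⊥ : Submodule ℂ H')), bot_le, by simp⟩
  let p : ℕ → St := fun n => Nat.rec p0 (fun n q => next n q) n
  have hp : ∀ n, p (n + 1) = next n (p n) := fun n => rfl
  have hMmono : Monotone fun n => (p n).1.2.1 := by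
    refine monotone_nat_of_le_succ fun n => ?_
    rw [hp]; exact s8 n (p n)
  have hVM : ∀ m n, m < n → ∀ x, V m (p m) x ∈ (p n).1.2.1 := by
    intro m n hmn x
    have h1 := s9 m (p m) x
    rw [← hp] at h1
    exact hMmono (Nat.succ_le_of_lt hmn) h1
  refine ⟨fun n => V n (p n), fun n => (p n).1.1, fun n => (p n).2.1, rfl, ?_, ?_, ?_, ?_, ?_, ?_⟩
  · intro n x y
    simp only [hp]; exact s1 n (p n) x y
  · intro n i hi
    obtain ⟨m, rfl⟩ := Nat.exists_eq_add_of_lt hi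
    exact s2 _ (p (i + m)) i (by omega)
  · intro n
    have := (p (n + 1)).2.2.1
    exact Cpt.of_range (p (n + 1)).1.2.1 (hVM n (n + 1) (Nat.lt_succ_self n))
  · intro m n hmn x y
    rcases lt_or_gt_of_ne hmn with h | h
    · exact s4 n (p n) _ (hVM m n h x) y
    · rw [← inner_conj_symm, s4 m (p m) _ (hVM n m h y) x, map_zero]
  · intro i m n him hin hmn x y
    rcases lt_or_gt_of_ne hmn with h | h
    · exact s5 n (p n) i hin _ (hVM m n h x) y
    · rw [← inner_conj_symm, s6 m (p m) i him _ (hVM n m h y) x, map_zero]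
  · intro i n hin x y
    refine (s7 n (p n) i hin.le x y).trans ?_
    gcongr
    obtain ⟨m, rfl⟩ : ∃ m, n = m + 1 := ⟨n - 1, by omega⟩
    have := s3 m (p m) i (by omega)
    rw [← hp] at this
    rw [pow_succ]
    linarith

end LemmaV

end CalkinUniv

namespace CalkinUniv

open scoped InnerProductSpace InnerProduct Topology
open ContinuousLinearMap Filter

section LemmaV2

theorem re_inner_self' {K : Type*} [NormedAddCommGroup K] [InnerProductSpace ℂ K] (w : K) :
    (⟪w, w⟫_ℂ).re = ‖w‖ ^ 2 := inner_self_eq_norm_sq (𝕜 := ℂ) w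

theorem geom_aux (N m : ℕ) (hm : N ≤ m) :
    ∑ k ∈ Finset.Ico N m, (4 * (1 / 2 : ℝ) ^ k) + 8 * (1 / 2) ^ m = 8 * (1 / 2) ^ N := by
  induction m, hm using Nat.le_induction with
  | base => simp
  | succ m hm ih => 
    rw [Finset.sum_Ico_succ_top hm, ← ih, pow_succ]; ring

variable {H H' : Type*} [NormedAddCommGroup H] [InnerProductSpace ℂ H] [CompleteSpace H]
  [NormedAddCommGroup H'] [InnerProductSpace ℂ H'] [CompleteSpace H']

theorem exists_V_sum (β : ℕ → H →L[ℂ] H) (τ : ℕ → H' →L[ℂ] H')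
    (z : ℕ → H') (hz : DenseRange z)
    (V : ℕ → H' →L[ℂ] H) (r : ℕ → H' →L[ℂ] H') (hr : ∀ n, ‖r n‖ ≤ 1) (hr0 : r 0 = 1)
    (h1 : ∀ n x y, ⟪V n x, V n y⟫_ℂ + ⟪r (n + 1) x, r (n + 1) y⟫_ℂ = ⟪r n x, r n y⟫_ℂ)
    (h2 : ∀ n i, i < n → r n (z i) = 0) (hVc : ∀ n, Cpt (V n))
    (h3 : ∀ m n, m ≠ n → ∀ x y, ⟪V m x, V n y⟫_ℂ = 0)
    (h4 : ∀ i m n, i ≤ m → i ≤ n → m ≠ n → ∀ x y, ⟪V m x, β i (V n y)⟫_ℂ = 0)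
    (h5 : ∀ i n, i < n → ∀ x y, ‖⟪V n x, β i (V n y)⟫_ℂ - ⟪V n x, V n (τ i y)⟫_ℂ‖ ≤
        (4 * (1 / 2) ^ n) * ‖x‖ * ‖y‖) :
    ∃ U : H' →L[ℂ] H, U† ∘L U = 1 ∧ ∀ i, Cpt (U† ∘L β i ∘L U - τ i) := by
  have hr_lim : ∀ x, Tendsto (fun n => r n x) atTop (𝓝 0) := by
    intro x
    rw [Metric.tendsto_atTop]
    intro ε hε
    obtain ⟨i, hi⟩ := hz.exists_dist_lt x hε
    refine ⟨i + 1, fun n hn => ?_⟩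
    have e : r n x = r n (x - z i) := by rw [map_sub, h2 n i (by omega), sub_zero]
    rw [dist_zero_right, e]
    refine ((r n).le_of_opNorm_le (hr n) _).trans_lt ?_
    rw [one_mul, ← dist_eq_norm]; exact hi
  let S : ℕ → H' →L[ℂ] H := fun m => ∑ n ∈ Finset.range m, V n
  have hS : ∀ m x y, ⟪S m x, S m y⟫_ℂ + ⟪r m x, r m y⟫_ℂ = ⟪x, y⟫_ℂ := by
    intro m x y
    induction m with
    | zero => simp [S, hr0]
    | succ m ih =>
      have e : ∀ x, S (m + 1) x = S m x + V m x := fun x => by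
        simp [S, Finset.sum_range_succ]
      have z1 : ⟪S m x, V m y⟫_ℂ = 0 := by
        simp only [S, sum_apply, sum_inner]
        exact Finset.sum_eq_zero fun n hn => h3 _ _ (Finset.mem_range.1 hn).ne _ _
      have z2 : ⟪V m x, S m y⟫_ℂ = 0 := by
        simp only [S, sum_apply, inner_sum]
        exact Finset.sum_eq_zero fun n hn => h3 _ _ (Finset.mem_range.1 hn).ne' _ _
      rw [e, e, inner_add_left, inner_add_right, inner_add_right, z1, z2, ← ih, ← h1 m x y]
      ring
  -- differences
  have hSdiff : ∀ m n, m ≤ n → ∀ x, ‖S n x - S m x‖ ^ 2 + ‖r n x‖ ^ 2 = ‖r m x‖ ^ 2 := by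
    intro m n hmn x
    have z1 : ⟪S m x, S n x - S m x⟫_ℂ = 0 := by
      have : S n x - S m x = ∑ k ∈ Finset.Ico m n, V k x := by
        rw [Finset.sum_Ico_eq_sub _ hmn]; simp [S]
      rw [this]
      simp only [S, sum_apply, sum_inner, inner_sum]
      refine Finset.sum_eq_zero fun i hi => Finset.sum_eq_zero fun j hj => h3 _ _ ?_ _ _
      have := Finset.mem_range.1 (by assumption : _ ∈ Finset.range m)
      have := Finset.mem_Ico.1 (by assumption : _ ∈ Finset.Ico m n)
      omega
    have p := norm_add_sq_eq_norm_sq_add_norm_sq_of_inner_eq_zero _ _ z1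
    rw [add_sub_cancel] at p
    have a1 := congrArg Complex.re (hS m x x)
    have a2 := congrArg Complex.re (hS n x x)
    rw [Complex.add_re, re_inner_self', re_inner_self', re_inner_self'] at a1 a2
    nlinarith
  have hcau : ∀ x, ∃ y, Tendsto (fun n => S n x) atTop (𝓝 y) := by
    intro x
    refine cauchySeq_tendsto_of_complete ?_
    refine cauchySeq_of_le_tendsto_0' (fun n => ‖r n x‖) ?_ ?_
    · intro m n hmn
      rw [dist_comm, dist_eq_norm]
      refine le_of_sq_le_sq ?_ (norm_nonneg _)
      have := hSdiff m n hmn x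
      nlinarith [norm_nonneg (r n x)]
    · simpa using (hr_lim x).norm
  choose f hf using hcau
  let U : H' →L[ℂ] H := continuousLinearMapOfTendsto S (tendsto_pi_nhds.2 hf)
  have hU : ∀ x, Tendsto (fun n => S n x) atTop (𝓝 (U x)) := hf
  have hUU : U† ∘L U = 1 := by
    ext y
    refine ext_inner_left ℂ fun x => ?_
    rw [comp_apply, adjoint_inner_right]
    have t1 := (hU x).inner (hU y) (𝕜 := ℂ)
    have t2 := (hr_lim x).inner (hr_lim y) (𝕜 := ℂ)
    have t3 := t1.add t2
    simp only [hS, inner_zero_left, add_zero] at t3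
    exact tendsto_nhds_unique t3 tendsto_const_nhds
  have hUn : ‖U‖ ≤ 1 := by
    refine opNorm_le_bound _ zero_le_one fun x => ?_
    rw [one_mul]
    refine le_of_sq_le_sq ?_ (norm_nonneg _)
    have : ⟪U x, U x⟫_ℂ = ⟪x, x⟫_ℂ := by
      rw [← adjoint_inner_right, ← comp_apply, hUU]; rfl
    rw [← re_inner_self', ← re_inner_self', this]
  refine ⟨U, hUU, fun i => Cpt.of_approx fun ε hε => ?_⟩
  obtain ⟨N0, hN0⟩ := exists_pow_lt_of_lt_one (show (0 : ℝ) < ε / 8 by positivity)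
    (show (1 / 2 : ℝ) < 1 by norm_num)
  let N := max N0 (i + 1)
  have hN : 8 * (1 / 2 : ℝ) ^ N ≤ ε := by
    have : (1 / 2 : ℝ) ^ N ≤ (1 / 2) ^ N0 :=
      pow_le_pow_of_le_one (by norm_num) (by norm_num) (le_max_left _ _)
    linarith
  have hSc : Cpt (S N) := Cpt.sum _ fun n _ => hVc n
  have hUUx : ∀ x, (U†) (U x) = x := fun x => congrArg (fun T : H' →L[ℂ] H' => T x) hUU
  refine ⟨(S N)† ∘L (β i ∘L (U - S N) - (U - S N) ∘L τ i) + U† ∘L (β i ∘L S N - S N ∘L τ i),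
    ?_, ?_⟩
  · exact (hSc.adj.comp_right _).add (((hSc.comp_left _).sub (hSc.comp_right _)).comp_left _)
  · have e : U† ∘L β i ∘L U - τ i - ((S N)† ∘L (β i ∘L (U - S N) - (U - S N) ∘L τ i)
        + U† ∘L (β i ∘L S N - S N ∘L τ i)) =
        (U - S N)† ∘L (β i ∘L (U - S N) - (U - S N) ∘L τ i) := by
      rw [map_sub]
      ext x
      simp [hUUx]
      abel
    rw [e]
    refine opNorm_le_of_inner hε.le fun x y => ?_
    rw [comp_apply, adjoint_inner_right]
    have lim1 : ∀ x, Tendsto (fun n => S n x - S N x) atTop (𝓝 ((U - S N) x)) := by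
      intro x; exact (hU x).sub_const _
    have lim2 : Tendsto (fun n => β i (S n y - S N y) - (S n (τ i y) - S N (τ i y))) atTop
        (𝓝 ((β i ∘L (U - S N) - (U - S N) ∘L τ i) y)) :=
      (((β i).continuous.tendsto _).comp (lim1 y)).sub (lim1 (τ i y))
    have lim3 := ((lim1 x).inner lim2 (𝕜 := ℂ)).norm
    refine le_of_tendsto lim3 ?_
    filter_upwards [eventually_ge_atTop N] with m hm
    have d : ∀ x, S m x - S N x = ∑ k ∈ Finset.Ico N m, V k x := by
      intro x; rw [Finset.sum_Ico_eq_sub _ hm]; simp [S]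
    have e2 : ⟪S m x - S N x, β i (S m y - S N y) - (S m (τ i y) - S N (τ i y))⟫_ℂ =
        ∑ k ∈ Finset.Ico N m, (⟪V k x, β i (V k y)⟫_ℂ - ⟪V k x, V k (τ i y)⟫_ℂ) := by
      rw [d, d, d, map_sum, ← Finset.sum_sub_distrib, sum_inner]
      refine Finset.sum_congr rfl fun k hk => ?_
      rw [inner_sum, Finset.sum_eq_single k, inner_sub_right]
      · intro l hl hlk
        have hk' := Finset.mem_Ico.1 hk
        have hl' := Finset.mem_Ico.1 hl
        have : i + 1 ≤ N := le_max_right _ _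
        rw [inner_sub_right, h4 i k l (by omega) (by omega) (Ne.symm hlk), h3 _ _ (Ne.symm hlk),
          sub_zero]
      · intro h; exact absurd hk h
    rw [e2]
    have b1 : ∀ k ∈ Finset.Ico N m, ‖⟪V k x, β i (V k y)⟫_ℂ - ⟪V k x, V k (τ i y)⟫_ℂ‖ ≤
        (4 * (1 / 2) ^ k) * (‖x‖ * ‖y‖) := by
      intro k hk
      have hk' := Finset.mem_Ico.1 hk
      have : i + 1 ≤ N := le_max_right _ _
      have := h5 i k (by omega) x y
      linarith
    have b2 := geom_aux N m hm
    refine (norm_sum_le_of_le _ b1).trans ?_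
    rw [← Finset.sum_mul, mul_assoc]
    gcongr
    have : (0 : ℝ) ≤ 8 * (1 / 2) ^ m := by positivity
    linarith

end LemmaV2

section App

variable {A : Type*} [NonUnitalCStarAlgebra A]
variable {H H' H'' : Type*} [NormedAddCommGroup H] [InnerProductSpace ℂ H] [CompleteSpace H]
  [NormedAddCommGroup H'] [InnerProductSpace ℂ H'] [CompleteSpace H']
  [NormedAddCommGroup H''] [InnerProductSpace ℂ H''] [CompleteSpace H'']

def App (S : Set A) (Φ : A → H →L[ℂ] H) (σ : A → H' →L[ℂ] H') (D : Submodule ℂ H') : Prop :=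
  ∀ X : Submodule ℂ H', FiniteDimensional ℂ X → X ≤ D → ∀ F : Finset A, (∀ a ∈ F, a ∈ S) →
    ∀ ε > 0, ∀ N : Submodule ℂ H, FiniteDimensional ℂ N → ∃ W : H' →L[ℂ] H,
      (∀ x ∈ X, ∀ y ∈ X, ⟪W x, W y⟫_ℂ = ⟪x, y⟫_ℂ) ∧ (∀ x ∈ X, ∀ ν ∈ N, ⟪ν, W x⟫_ℂ = 0) ∧
      ∀ a ∈ F, ∀ x ∈ X, ∀ y ∈ X, ‖⟪W x, Φ a (W y)⟫_ℂ - ⟪x, σ a y⟫_ℂ‖ ≤ ε * ‖x‖ * ‖y‖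

theorem App.mono {S S' : Set A} {Φ : A → H →L[ℂ] H} {σ : A → H' →L[ℂ] H'} {D D' : Submodule ℂ H'}
    (h : App S' Φ σ D') (hS : S ⊆ S') (hD : D ≤ D') : App S Φ σ D :=
  fun X hX hXD F hF => h X hX (hXD.trans hD) F fun a ha => hS (hF a ha)

theorem exists_V {E : NonUnitalStarSubalgebra ℂ A} {Φ : A → H →L[ℂ] H} {σ : A → H' →L[ℂ] H'}
    (hΦ : IsRep E Φ) (hσ : IsRep E σ) (b : ℕ → A) (hbE : ∀ i, b i ∈ E)
    (hb : ∀ a ∈ E, ∀ ε > 0, ∃ i, ‖a - b i‖ < ε)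
    (D : Submodule ℂ H') (hD1 : ∀ a ∈ E, ∀ x ∈ D, σ a x ∈ D)
    (z : ℕ → H') (hzD : ∀ i, z i ∈ D) (hz : DenseRange z) (hApp : App E Φ σ D) :
    ∃ U : H' →L[ℂ] H, U† ∘L U = 1 ∧ ∀ a ∈ E, Cpt (Φ a ∘L U - U ∘L σ a) := by
  classical
  obtain ⟨V, r, g1, g2, g3, g4, g5, g6, g7, g8⟩ := exists_V_seq D (fun i => Φ (b i))
    (fun i => σ (b i)) (fun i => hD1 _ (hbE i))
    (fun i x hx => by rw [← hσ.map_star _ (hbE i)]; exact hD1 _ (star_mem (hbE i)) x hx)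
    (by
      intro X hX hXD n ε hε N hN
      obtain ⟨W, w1, w2, w3⟩ := hApp X hX hXD ((Finset.range (n + 1)).image b)
        (by intro a ha; obtain ⟨i, -, rfl⟩ := Finset.mem_image.1 ha; exact hbE i) ε hε N hN
      exact ⟨W, w1, w2, fun i hi => w3 _ (Finset.mem_image_of_mem _ (Finset.mem_range.2 (by omega)))⟩)
    z hzD
  obtain ⟨U, hU1, hU2⟩ := exists_V_sum (fun i => Φ (b i)) (fun i => σ (b i)) z hz V r g1 g2 g3 g4
    g5 g6 g7 g8
  have hUn : ‖U‖ ≤ 1 := by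
    refine opNorm_le_bound _ zero_le_one fun x => ?_
    rw [one_mul]
    refine le_of_sq_le_sq ?_ (norm_nonneg _)
    have : ⟪U x, U x⟫_ℂ = ⟪x, x⟫_ℂ := by
      rw [← adjoint_inner_right, ← comp_apply, hU1]; rfl
    rw [← inner_self_eq_norm_sq (𝕜 := ℂ), ← inner_self_eq_norm_sq (𝕜 := ℂ), this]
  have hk : ∀ a ∈ E, Cpt (U† ∘L Φ a ∘L U - σ a) := by
    intro a ha
    refine Cpt.of_approx fun ε hε => ?_
    obtain ⟨i, hi⟩ := hb a ha (ε / 2) (by positivity)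
    refine ⟨_, hU2 i, ?_⟩
    have e : U† ∘L Φ a ∘L U - σ a - (U† ∘L Φ (b i) ∘L U - σ (b i)) =
        U† ∘L Φ (a - b i) ∘L U - σ (a - b i) := by
      rw [hΦ.map_sub ha (hbE i), hσ.map_sub ha (hbE i)]
      ext x; simp; abel
    rw [e]
    have n1 := hΦ.norm_le _ (sub_mem ha (hbE i))
    have n2 := hσ.norm_le _ (sub_mem ha (hbE i))
    have n3 : ‖U† ∘L Φ (a - b i) ∘L U‖ ≤ 1 * (‖a - b i‖ * 1) := by
      refine (opNorm_comp_le _ _).trans ?_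
      rw [LinearIsometryEquiv.norm_map]
      gcongr
      refine (opNorm_comp_le _ _).trans ?_
      gcongr
    refine (norm_sub_le _ _).trans ?_
    linarith
  refine ⟨U, hU1, fun a ha => Cpt.of_adjoint_comp ?_⟩
  have hUx : ∀ x, (U†) (U x) = x := fun x => congrArg (fun T : H' →L[ℂ] H' => T x) hU1
  have has := star_mem ha
  have e : (Φ a ∘L U - U ∘L σ a)† ∘L (Φ a ∘L U - U ∘L σ a) =
      (U† ∘L Φ (star a * a) ∘L U - σ (star a * a)) -
      (U† ∘L Φ (star a) ∘L U - σ (star a)) ∘L σ a -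
      σ (star a) ∘L (U† ∘L Φ a ∘L U - σ a) := by
    rw [hΦ.map_mul _ has _ ha, hσ.map_mul _ has _ ha, hΦ.map_star _ ha, hσ.map_star _ ha,
      star_eq_adjoint, star_eq_adjoint, map_sub, adjoint_comp, adjoint_comp]
    ext x
    simp [hUx]
    abel
  rw [e]
  exact ((hk _ (mul_mem has ha)).sub ((hk _ has).comp_right _)).sub ((hk _ ha).comp_left _)

end App

end CalkinUniv

namespace CalkinUniv

open scoped InnerProductSpace InnerProduct Topology
open ContinuousLinearMap Filter

section Amp

variable {H : Type*} [NormedAddCommGroup H] [InnerProductSpace ℂ H] [CompleteSpace H]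
  {M : Type*} [NormedAddCommGroup M] [InnerProductSpace ℂ M] [CompleteSpace M]

/-- `L` is the countable Hilbert sum of copies of `H`. -/
structure AmpData (H L : Type*) [NormedAddCommGroup H] [InnerProductSpace ℂ H] [CompleteSpace H]
    [NormedAddCommGroup L] [InnerProductSpace ℂ L] [CompleteSpace L] where
  inj : ℕ → H →L[ℂ] L
  inj_same : ∀ k x, ((inj k)†) (inj k x) = x
  inj_ne : ∀ {k l}, k ≠ l → ∀ x, ((inj k)†) (inj l x) = 0
  tendsto : ∀ x, Tendsto (fun N => ∑ k ∈ Finset.range N, inj k (((inj k)†) x)) atTop (𝓝 x)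
  ampl : (H →L[ℂ] H) → L →L[ℂ] L
  ampl_inj : ∀ T k x, ampl T (inj k x) = inj k (T x)
  norm_ampl_le : ∀ T, ‖ampl T‖ ≤ ‖T‖
  exists_push : ∀ f : ℕ → ℕ, Function.Injective f → ∃ s : L →L[ℂ] L, s† ∘L s = 1 ∧
    ∀ k x, s (inj k x) = inj (f k) x

theorem lp_inj_adj (k : ℕ) (x : lp (fun _ : ℕ => H) 2) :
    ((lp.singleContinuousLinearMap ℂ (fun _ : ℕ => H) 2 k)†) x = x k := by
  refine ext_inner_left ℂ fun y => ?_
  rw [adjoint_inner_right, lp.singleContinuousLinearMap_apply, lp.inner_single_left]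

noncomputable def lpAmp (H : Type*) [NormedAddCommGroup H] [InnerProductSpace ℂ H]
    [CompleteSpace H] : AmpData H (lp (fun _ : ℕ => H) 2) where
  inj k := lp.singleContinuousLinearMap ℂ (fun _ : ℕ => H) 2 k
  inj_same k x := by
    rw [lp_inj_adj, lp.singleContinuousLinearMap_apply, lp.single_apply_self]
  inj_ne h x := by
    rw [lp_inj_adj, lp.singleContinuousLinearMap_apply, lp.single_apply_ne _ _ _ h]
  tendsto x := by
    have h1 := (lp.hasSum_single (E := fun _ : ℕ => H) (p := 2) ENNReal.ofNat_ne_top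
      x).tendsto_sum_nat
    refine h1.congr fun N => ?_
    simp only [lp_inj_adj, lp.singleContinuousLinearMap_apply]
  ampl T := lp.mapCLM 2 (fun _ => T) (norm_nonneg T) (fun _ => le_rfl)
  ampl_inj T k x := by
    ext j
    change T ((lp.single 2 k x : lp (fun _ : ℕ => H) 2) j) =
      (lp.single 2 k (T x) : lp (fun _ : ℕ => H) 2) j
    by_cases h : j = k
    · subst h; rw [lp.single_apply_self, lp.single_apply_self]
    · rw [lp.single_apply_ne _ _ _ h, lp.single_apply_ne _ _ _ h, map_zero]
  norm_ampl_le T := lp.norm_mapCLM_le _ _ _ _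
  exists_push f hf := by
    have hV : OrthogonalFamily ℂ (fun _ : ℕ => H) (fun k : ℕ =>
      ((lp.singleContinuousLinearMap ℂ (fun _ : ℕ => H) 2 (f k)).toLinearMap.toLinearIsometry
        (lp.isometry_single (E := fun _ : ℕ => H) (p := 2) (f k)) :
          H →ₗᵢ[ℂ] lp (fun _ : ℕ => H) 2)) := by
      intro i j hij x y
      change ⟪lp.single 2 (f i) x, (lp.single 2 (f j) y : lp (fun _ : ℕ => H) 2)⟫_ℂ = 0
      rw [lp.inner_single_left, lp.single_apply_ne _ _ _ (fun h => hij (hf h)), inner_zero_right]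
    refine ⟨hV.linearIsometry.toContinuousLinearMap, ?_, fun k x => ?_⟩
    · ext1 x
      refine ext_inner_left ℂ fun y => ?_
      rw [comp_apply, adjoint_inner_right]
      exact hV.linearIsometry.inner_map_map _ _
    · exact hV.linearIsometry_apply_single x

variable {L : Type*} [NormedAddCommGroup L] [InnerProductSpace ℂ L] [CompleteSpace L]
  (𝒜 : AmpData H L)

namespace AmpData

theorem inner_inj_ne {k l : ℕ} (h : k ≠ l) (x y : H) : ⟪𝒜.inj k x, 𝒜.inj l y⟫_ℂ = 0 := by
  rw [← adjoint_inner_right, 𝒜.inj_ne h, inner_zero_right]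

theorem vec_ext {x y : L} (h : ∀ k, ((𝒜.inj k)†) x = ((𝒜.inj k)†) y) : x = y := by
  have h1 := 𝒜.tendsto x
  simp only [h] at h1
  exact tendsto_nhds_unique h1 (𝒜.tendsto y)

theorem ext {S T : L →L[ℂ] M} (h : ∀ k x, S (𝒜.inj k x) = T (𝒜.inj k x)) : S = T := by
  ext x
  have s1 := (S.continuous.tendsto _).comp (𝒜.tendsto x)
  have s2 := (T.continuous.tendsto _).comp (𝒜.tendsto x)
  have : (S ∘ fun N => ∑ k ∈ Finset.range N, 𝒜.inj k (((𝒜.inj k)†) x)) =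
      (T ∘ fun N => ∑ k ∈ Finset.range N, 𝒜.inj k (((𝒜.inj k)†) x)) := by
    funext N; simp only [Function.comp_apply, map_sum, h]
  rw [this] at s1
  exact tendsto_nhds_unique s1 s2

theorem ampl_add (S T : H →L[ℂ] H) : 𝒜.ampl (S + T) = 𝒜.ampl S + 𝒜.ampl T :=
  𝒜.ext fun k x => by simp [ampl_inj]

theorem ampl_smul (c : ℂ) (T : H →L[ℂ] H) : 𝒜.ampl (c • T) = c • 𝒜.ampl T :=
  𝒜.ext fun k x => by simp [ampl_inj]

theorem ampl_mul (S T : H →L[ℂ] H) : 𝒜.ampl (S * T) = 𝒜.ampl S * 𝒜.ampl T :=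
  𝒜.ext fun k x => by simp [ampl_inj, mul_ap]

theorem ampl_star (T : H →L[ℂ] H) : 𝒜.ampl (star T) = star (𝒜.ampl T) := by
  refine 𝒜.ext fun k x => 𝒜.vec_ext fun j => ?_
  refine ext_inner_left ℂ fun y => ?_
  rw [ampl_inj, adjoint_inner_right, adjoint_inner_right, star_eq_adjoint, star_eq_adjoint,
    adjoint_inner_right, ampl_inj]
  by_cases h : j = k
  · subst h
    rw [← adjoint_inner_right, ← adjoint_inner_right, inj_same, inj_same, adjoint_inner_right]
  · rw [𝒜.inner_inj_ne h, 𝒜.inner_inj_ne h]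

theorem inj_adj_ampl (T : H →L[ℂ] H) (k : ℕ) (x : L) :
    ((𝒜.inj k)†) (𝒜.ampl T x) = T (((𝒜.inj k)†) x) := by
  have : (𝒜.inj k)† ∘L 𝒜.ampl T = T ∘L (𝒜.inj k)† := by
    refine 𝒜.ext fun j x => ?_
    rw [comp_apply, comp_apply, ampl_inj]
    by_cases h : k = j
    · subst h; rw [inj_same, inj_same]
    · rw [𝒜.inj_ne h, 𝒜.inj_ne h, map_zero]
  exact congrArg (fun S : L →L[ℂ] H => S x) this

noncomputable def push (f : ℕ → ℕ) (hf : Function.Injective f) : L →L[ℂ] L :=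
  (𝒜.exists_push f hf).choose

variable {f : ℕ → ℕ} {hf : Function.Injective f}

theorem push_adj_push : (𝒜.push f hf)† ∘L 𝒜.push f hf = 1 :=
  (𝒜.exists_push f hf).choose_spec.1

theorem push_inj (k : ℕ) (x : H) : 𝒜.push f hf (𝒜.inj k x) = 𝒜.inj (f k) x :=
  (𝒜.exists_push f hf).choose_spec.2 k x

theorem push_adj_inj (k : ℕ) (x : H) :
    ((𝒜.push f hf)†) (𝒜.inj (f k) x) = 𝒜.inj k x := by
  rw [← 𝒜.push_inj (hf := hf)]
  have h := congrArg (fun T : L →L[ℂ] L => T (𝒜.inj k x)) (𝒜.push_adj_push (f := f) (hf := hf))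
  simpa using h

theorem push_adj_inj_ne {m : ℕ} (hm : ∀ k, f k ≠ m) (x : H) :
    ((𝒜.push f hf)†) (𝒜.inj m x) = 0 := by
  refine 𝒜.vec_ext fun j => ?_
  refine ext_inner_left ℂ fun y => ?_
  rw [adjoint_inner_right, adjoint_inner_right, push_inj, 𝒜.inner_inj_ne (hm j)]
  simp

theorem push_ampl (T : H →L[ℂ] H) : 𝒜.push f hf * 𝒜.ampl T = 𝒜.ampl T * 𝒜.push f hf := by
  refine 𝒜.ext fun k x => ?_
  rw [mul_ap, mul_ap, ampl_inj, push_inj, push_inj, ampl_inj]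

/-- projections to tails -/
noncomputable def tail (N : ℕ) : L →L[ℂ] L := 1 - ∑ k ∈ Finset.range N, 𝒜.inj k ∘L (𝒜.inj k)†

theorem tail_inj (N k : ℕ) (x : H) : 𝒜.tail N (𝒜.inj k x) = if k < N then 0 else 𝒜.inj k x := by
  have : ∑ j ∈ Finset.range N, 𝒜.inj j (((𝒜.inj j)†) (𝒜.inj k x)) =
      if k < N then 𝒜.inj k x else 0 := by
    split_ifs with h
    · rw [Finset.sum_eq_single k]
      · rw [inj_same]
      · intro j _ hj; rw [𝒜.inj_ne hj, map_zero]
      · intro h'; exact absurd (Finset.mem_range.2 h) h'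
    · refine Finset.sum_eq_zero fun j hj => ?_
      rw [𝒜.inj_ne, map_zero]
      have := Finset.mem_range.1 hj
      omega
  simp only [tail, sub_apply, one_apply, sum_apply, comp_apply, this]
  split_ifs <;> simp

theorem tail_star (N : ℕ) : star (𝒜.tail N) = 𝒜.tail N := by
  simp only [tail, star_sub, star_one, star_eq_adjoint, map_sum, adjoint_comp, adjoint_adjoint]

theorem tail_mul (N : ℕ) : (𝒜.tail N) * 𝒜.tail N = 𝒜.tail N := by
  refine 𝒜.ext fun k x => ?_
  rw [mul_ap, tail_inj]
  split_ifs with h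
  · simp
  · rw [tail_inj, if_neg h]

theorem norm_tail_le (N : ℕ) : ‖(𝒜.tail N)‖ ≤ 1 := by
  have := CStarRing.norm_star_mul_self (x := (𝒜.tail N))
  rw [tail_star, tail_mul] at this
  nlinarith [norm_nonneg (𝒜.tail N)]

theorem tail_tendsto (x : L) : Tendsto (fun N => 𝒜.tail N x) atTop (𝓝 0) := by
  have h2 := (𝒜.tendsto x).const_sub x
  rw [sub_self] at h2
  refine h2.congr fun N => ?_
  simp only [tail, sub_apply, one_apply, sum_apply, comp_apply]
  rfl

theorem cpt_tail {c : L →L[ℂ] M} (hc : Cpt c) :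
    Tendsto (fun N => ‖c ∘L 𝒜.tail N‖) atTop (𝓝 0) := by
  rw [Metric.tendsto_atTop]
  intro ε hε
  obtain ⟨S, hS, hcS⟩ := hc.exists_finite (ε := ε / 2) (by positivity)
  let e := stdOrthonormalBasis ℂ S
  have t : Tendsto (fun N => ‖c‖ * ∑ i, ‖𝒜.tail N (e i : L)‖) atTop (𝓝 (‖c‖ * ∑ i, 0)) :=
    (tendsto_finsetSum _ fun i _ => by simpa using (𝒜.tail_tendsto (e i : L)).norm).const_mul _
  rw [Finset.sum_const_zero, mul_zero, Metric.tendsto_atTop] at t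
  obtain ⟨N0, hN0⟩ := t (ε / 2) (by positivity)
  refine ⟨N0, fun N hN => ?_⟩
  have hN := hN0 N hN
  rw [Real.dist_0_eq_abs, abs_of_nonneg (by positivity)] at hN ⊢
  have e1 : c ∘L 𝒜.tail N = (c - c ∘L S.starProjection) ∘L 𝒜.tail N +
      c ∘L (S.starProjection ∘L 𝒜.tail N) := by ext x; simp
  clear_value e
  have n1 : ‖(c - c ∘L S.starProjection) ∘L 𝒜.tail N‖ ≤ ε / 2 * 1 := by
    refine (opNorm_comp_le _ _).trans ?_
    gcongr
    exact 𝒜.norm_tail_le N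
  have n2 : ‖S.starProjection ∘L 𝒜.tail N‖ ≤ ∑ i, ‖𝒜.tail N (e i : L)‖ := by
    refine opNorm_le_bound _ (by positivity) fun x => ?_
    have : (S.starProjection (𝒜.tail N x)) = ∑ i, ⟪(e i : L), 𝒜.tail N x⟫_ℂ • (e i : L) := by
      rw [e.starProjection_eq_sum_rankOne]; simp
    rw [comp_apply, this, Finset.sum_mul]
    refine norm_sum_le_of_le _ fun i _ => ?_
    have ne : ‖(e i : L)‖ = 1 := e.orthonormal.1 i
    rw [norm_smul, ne, mul_one]
    rw [← adjoint_inner_left, ← star_eq_adjoint, tail_star]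
    exact norm_inner_le_norm _ _
  rw [e1]
  calc _ ≤ ‖(c - c ∘L S.starProjection) ∘L 𝒜.tail N‖ + ‖c ∘L (S.starProjection ∘L 𝒜.tail N)‖ :=
        norm_add_le _ _
    _ ≤ ε / 2 * 1 + ‖c‖ * ∑ i, ‖𝒜.tail N (e i : L)‖ := by
        gcongr
        refine (opNorm_comp_le _ _).trans ?_
        gcongr
    _ < ε := by linarith

end AmpData

end Amp

end CalkinUniv

namespace CalkinUniv

open scoped InnerProductSpace InnerProduct Topology
open ContinuousLinearMap Filter

section AppAmp

variable {A : Type*} [NonUnitalCStarAlgebra A]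
variable {H H' L : Type*} [NormedAddCommGroup H] [InnerProductSpace ℂ H] [CompleteSpace H]
  [NormedAddCommGroup H'] [InnerProductSpace ℂ H'] [CompleteSpace H']
  [NormedAddCommGroup L] [InnerProductSpace ℂ L] [CompleteSpace L]

theorem App.many {S : Set A} {Φ : A → H →L[ℂ] H} {σ : A → H' →L[ℂ] H'} (h : App S Φ σ ⊤)
    (Y : Submodule ℂ H') [FiniteDimensional ℂ Y] (F : Finset A) (hF : ∀ a ∈ F, a ∈ S)
    {ε : ℝ} (hε : 0 < ε) (N : Submodule ℂ H) [FiniteDimensional ℂ N] (n : ℕ) :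
    ∃ W : ℕ → H' →L[ℂ] H, ∃ M : Submodule ℂ H, FiniteDimensional ℂ M ∧ N ≤ M ∧
      (∀ s < n, ∀ x ∈ Y, W s x ∈ M ∧ ∀ a ∈ F, Φ a (W s x) ∈ M ∧ ((Φ a)†) (W s x) ∈ M) ∧
      (∀ s < n, ∀ x ∈ Y, ∀ y ∈ Y, ⟪W s x, W s y⟫_ℂ = ⟪x, y⟫_ℂ) ∧
      (∀ s < n, ∀ x ∈ Y, ∀ ν ∈ N, ⟪ν, W s x⟫_ℂ = 0) ∧
      (∀ s < n, ∀ a ∈ F, ∀ x ∈ Y, ∀ y ∈ Y,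
        ‖⟪W s x, Φ a (W s y)⟫_ℂ - ⟪x, σ a y⟫_ℂ‖ ≤ ε * ‖x‖ * ‖y‖) ∧
      (∀ s < n, ∀ t < n, s ≠ t → ∀ x ∈ Y, ∀ y ∈ Y, ⟪W s x, W t y⟫_ℂ = 0) ∧
      (∀ s < n, ∀ t < n, s ≠ t → ∀ a ∈ F, ∀ x ∈ Y, ∀ y ∈ Y, ⟪W s x, Φ a (W t y)⟫_ℂ = 0) := by
  classical
  induction n with
  | zero => exact ⟨0, N, inferInstance, le_rfl, by simp, by simp, by simp, by simp, by simp, by simp⟩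
  | succ n ih =>
    obtain ⟨W, M, hM, hNM, i1, i2, i3, i4, i5, i6⟩ := ih
    obtain ⟨w, w1, w2, w3⟩ := h Y inferInstance le_top F hF ε hε M hM
    have w2' : ∀ x ∈ Y, ∀ ν ∈ M, ⟪w x, ν⟫_ℂ = 0 := fun x hx ν hν =>
      inner_eq_zero_symm.1 (w2 x hx ν hν)
    have fd : ∀ T : H' →L[ℂ] H, FiniteDimensional ℂ (Y.map T.toLinearMap) := fun T => inferInstance
    let G : A → Submodule ℂ H := fun a =>
      Y.map (Φ a ∘L w).toLinearMap ⊔ Y.map ((Φ a)† ∘L w).toLinearMap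
    have fdG : ∀ a, FiniteDimensional ℂ (G a) := fun a => by
      have := fd (Φ a ∘L w); have := fd ((Φ a)† ∘L w)
      exact Submodule.finiteDimensional_sup _ _
    have fdF : FiniteDimensional ℂ (F.sup G : Submodule ℂ H) :=
      Submodule.finiteDimensional_finset_sup F G
    have := fd w
    refine ⟨fun s => if s < n then W s else w, M ⊔ (Y.map w.toLinearMap ⊔ F.sup G), inferInstance,
      hNM.trans le_sup_left, ?_, ?_, ?_, ?_, ?_, ?_⟩
    · intro s hs x hx
      by_cases hsn : s < n
      · simp only [hsn, if_true]
        obtain ⟨q1, q2⟩ := i1 s hsn x hx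
        exact ⟨le_sup_left (a := M) q1, fun a ha => ⟨le_sup_left (a := M) (q2 a ha).1,
          le_sup_left (a := M) (q2 a ha).2⟩⟩
      · simp only [hsn, if_false]
        refine ⟨le_sup_right (a := M) (le_sup_left (a := Y.map w.toLinearMap) ⟨x, hx, rfl⟩),
          fun a ha => ?_⟩
        have hG : G a ≤ M ⊔ (Y.map w.toLinearMap ⊔ F.sup G) :=
          (Finset.le_sup ha).trans (le_sup_right.trans le_sup_right)
        exact ⟨hG (le_sup_left (b := Y.map ((Φ a)† ∘L w).toLinearMap) ⟨x, hx, rfl⟩),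
          hG (le_sup_right (a := Y.map (Φ a ∘L w).toLinearMap) ⟨x, hx, rfl⟩)⟩
    · intro s hs x hx y hy
      by_cases hsn : s < n
      · simp only [hsn, if_true]; exact i2 s hsn x hx y hy
      · simp only [hsn, if_false]; exact w1 x hx y hy
    · intro s hs x hx ν hν
      by_cases hsn : s < n
      · simp only [hsn, if_true]; exact i3 s hsn x hx ν hν
      · simp only [hsn, if_false]; exact w2 x hx ν (hNM hν)
    · intro s hs a ha x hx y hy
      by_cases hsn : s < n
      · simp only [hsn, if_true]; exact i4 s hsn a ha x hx y hy
      · simp only [hsn, if_false]; exact w3 a ha x hx y hy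
    · intro s hs t ht hst x hx y hy
      by_cases hsn : s < n <;> by_cases htn : t < n
      · simp only [hsn, htn, if_true]; exact i5 s hsn t htn hst x hx y hy
      · simp only [hsn, htn, if_true, if_false]; exact w2 y hy _ (i1 s hsn x hx).1
      · simp only [hsn, htn, if_true, if_false]; exact w2' x hx _ (i1 t htn y hy).1
      · omega
    · intro s hs t ht hst a ha x hx y hy
      by_cases hsn : s < n <;> by_cases htn : t < n
      · simp only [hsn, htn, if_true]; exact i6 s hsn t htn hst a ha x hx y hy
      · simp only [hsn, htn, if_true, if_false]
        rw [← adjoint_inner_left]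
        exact w2 y hy _ ((i1 s hsn x hx).2 a ha).2
      · simp only [hsn, htn, if_true, if_false]; exact w2' x hx _ ((i1 t htn y hy).2 a ha).1
      · omega

variable (𝒜 : AmpData H' L)

def AmpData.fin : Submodule ℂ L where
  carrier := {x | ∃ n, ∀ k, n ≤ k → ((𝒜.inj k)†) x = 0}
  zero_mem' := ⟨0, fun k _ => map_zero _⟩
  add_mem' := by
    rintro x y ⟨n, hn⟩ ⟨m, hm⟩
    exact ⟨max n m, fun k hk => by
      rw [map_add, hn k ((le_max_left _ _).trans hk), hm k ((le_max_right _ _).trans hk), add_zero]⟩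
  smul_mem' := by
    rintro c x ⟨n, hn⟩
    exact ⟨n, fun k hk => by rw [map_smul, hn k hk, smul_zero]⟩

theorem AmpData.fin_uniform (X : Submodule ℂ L) [FiniteDimensional ℂ X] (hX : X ≤ 𝒜.fin) :
    ∃ n, ∀ x ∈ X, ∀ k, n ≤ k → ((𝒜.inj k)†) x = 0 := by
  classical
  obtain ⟨t, ht⟩ := (Submodule.fg_iff_finiteDimensional X).2 inferInstance
  have h1 : ∀ x : L, ∃ n, x ∈ X → ∀ k, n ≤ k → ((𝒜.inj k)†) x = 0 := by
    intro x
    by_cases hx : x ∈ X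
    · obtain ⟨n, hn⟩ := hX hx; exact ⟨n, fun _ => hn⟩
    · exact ⟨0, fun h => absurd h hx⟩
  choose g hg using h1
  refine ⟨t.sup g, fun x hx k hk => ?_⟩
  have : X ≤ LinearMap.ker ((𝒜.inj k)†).toLinearMap := by
    rw [← ht, Submodule.span_le]
    intro y hy
    have hyX : y ∈ X := by rw [← ht]; exact Submodule.subset_span hy
    exact hg y hyX k ((Finset.le_sup (f := g) hy).trans hk)
  exact this hx

theorem AmpData.sum_eq {n : ℕ} {x : L} (h : ∀ k, n ≤ k → ((𝒜.inj k)†) x = 0) :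
    ∑ k ∈ Finset.range n, 𝒜.inj k (((𝒜.inj k)†) x) = x := by
  refine tendsto_nhds_unique ?_ (𝒜.tendsto x)
  refine tendsto_atTop_of_eventually_const (i₀ := n) fun m hm => ?_
  refine (Finset.sum_subset (Finset.range_mono hm) fun k _ hk => ?_).symm
  rw [h k (by simpa using hk), map_zero]

theorem AmpData.norm_inj_adj (k : ℕ) (x : L) : ‖((𝒜.inj k)†) x‖ ≤ ‖x‖ := by
  have h1 : ‖𝒜.inj k‖ ≤ 1 := by
    refine opNorm_le_bound _ zero_le_one fun x => ?_
    rw [one_mul]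
    refine le_of_sq_le_sq ?_ (norm_nonneg _)
    rw [← re_inner_self', ← adjoint_inner_right, 𝒜.inj_same, re_inner_self']
  have := ((𝒜.inj k)†).le_of_opNorm_le (c := 1) (by rw [LinearIsometryEquiv.norm_map]; exact h1) x
  simpa using this

theorem AmpData.inner_eq {n : ℕ} {x y : L} (h : ∀ k, n ≤ k → ((𝒜.inj k)†) x = 0) :
    ⟪x, y⟫_ℂ = ∑ k ∈ Finset.range n, ⟪((𝒜.inj k)†) x, ((𝒜.inj k)†) y⟫_ℂ := by
  conv_lhs => rw [← 𝒜.sum_eq h, sum_inner]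
  exact Finset.sum_congr rfl fun k _ => (adjoint_inner_right _ _ _).symm

theorem App.amp {S : Set A} {Φ : A → H →L[ℂ] H} {σ : A → H' →L[ℂ] H'} (h : App S Φ σ ⊤) :
    App S Φ (fun a => 𝒜.ampl (σ a)) 𝒜.fin := by
  classical
  intro X hX hXD F hF ε hε N hN
  obtain ⟨n, hn⟩ := 𝒜.fin_uniform X hXD
  let Y : Submodule ℂ H' := (Finset.range n).sup fun k => X.map ((𝒜.inj k)†).toLinearMap
  have hY : FiniteDimensional ℂ Y := Submodule.finiteDimensional_finset_sup _ _
  have hxY : ∀ x ∈ X, ∀ k < n, ((𝒜.inj k)†) x ∈ Y := fun x hx k hk =>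
    Finset.le_sup (f := fun k => X.map ((𝒜.inj k)†).toLinearMap) (Finset.mem_range.2 hk)
      ⟨x, hx, rfl⟩
  obtain ⟨W, M, -, -, -, w2, w3, w4, w5, w6⟩ := h.many Y F hF
    (show 0 < ε / (n + 1) by positivity) N n
  have e : ∀ x, (∑ k ∈ Finset.range n, W k ∘L (𝒜.inj k)†) x =
      ∑ k ∈ Finset.range n, W k (((𝒜.inj k)†) x) := fun x => by simp
  refine ⟨∑ k ∈ Finset.range n, W k ∘L (𝒜.inj k)†, ?_, ?_, ?_⟩
  · intro x hx y hy
    rw [e, e, sum_inner, 𝒜.inner_eq (hn x hx)]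
    refine Finset.sum_congr rfl fun k hk => ?_
    have hk' := Finset.mem_range.1 hk
    rw [inner_sum, Finset.sum_eq_single k]
    · exact w2 k hk' _ (hxY x hx k hk') _ (hxY y hy k hk')
    · intro l hl hlk
      have hl' := Finset.mem_range.1 hl
      exact w5 k hk' l hl' hlk.symm _ (hxY x hx k hk') _ (hxY y hy l hl')
    · intro h; exact absurd hk h
  · intro x hx ν hν
    rw [e, inner_sum]
    refine Finset.sum_eq_zero fun k hk => ?_
    have hk' := Finset.mem_range.1 hk
    exact w3 k hk' _ (hxY x hx k hk') ν hν
  · intro a ha x hx y hy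
    have e1 : ⟪(∑ k ∈ Finset.range n, W k ∘L (𝒜.inj k)†) x,
        Φ a ((∑ k ∈ Finset.range n, W k ∘L (𝒜.inj k)†) y)⟫_ℂ =
        ∑ k ∈ Finset.range n, ⟪W k (((𝒜.inj k)†) x), Φ a (W k (((𝒜.inj k)†) y))⟫_ℂ := by
      rw [e, e, sum_inner]
      refine Finset.sum_congr rfl fun k hk => ?_
      have hk' := Finset.mem_range.1 hk
      rw [map_sum, inner_sum, Finset.sum_eq_single k]
      · intro l hl hlk
        have hl' := Finset.mem_range.1 hl
        exact w6 k hk' l hl' hlk.symm a ha _ (hxY x hx k hk') _ (hxY y hy l hl')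
      · intro h; exact absurd hk h
    rw [e1, 𝒜.inner_eq (hn x hx), ← Finset.sum_sub_distrib]
    have b : ∀ k ∈ Finset.range n, ‖⟪W k (((𝒜.inj k)†) x), Φ a (W k (((𝒜.inj k)†) y))⟫_ℂ -
        ⟪((𝒜.inj k)†) x, ((𝒜.inj k)†) (𝒜.ampl (σ a) y)⟫_ℂ‖ ≤ ε / (n + 1) * ‖x‖ * ‖y‖ := by
      intro k hk
      have hk' := Finset.mem_range.1 hk
      rw [𝒜.inj_adj_ampl]
      refine (w4 k hk' a ha _ (hxY x hx k hk') _ (hxY y hy k hk')).trans ?_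
      gcongr
      · exact 𝒜.norm_inj_adj k x
      · exact 𝒜.norm_inj_adj k y
    refine (norm_sum_le_of_le _ b).trans ?_
    rw [Finset.sum_const, Finset.card_range, nsmul_eq_mul]
    have : (n : ℝ) * (ε / (n + 1)) ≤ ε := by
      rw [mul_div_assoc', div_le_iff₀ (by positivity)]; nlinarith
    calc (n : ℝ) * (ε / (n + 1) * ‖x‖ * ‖y‖) = (n : ℝ) * (ε / (n + 1)) * ‖x‖ * ‖y‖ := by ring
      _ ≤ ε * ‖x‖ * ‖y‖ := by gcongr

theorem AmpData.exists_dense [TopologicalSpace.SeparableSpace H'] :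
    ∃ z : ℕ → L, (∀ i, z i ∈ 𝒜.fin) ∧ DenseRange z := by
  have hd : Dense (𝒜.fin : Set L) := by
    intro x
    refine mem_closure_of_tendsto (𝒜.tendsto x) (Eventually.of_forall fun N => ?_)
    refine ⟨N, fun k hk => ?_⟩
    rw [map_sum]
    refine Finset.sum_eq_zero fun j hj => ?_
    have := Finset.mem_range.1 hj
    exact 𝒜.inj_ne (by omega) _
  have hsep : TopologicalSpace.IsSeparable (𝒜.fin : Set L) := by
    have h1 : TopologicalSpace.IsSeparable (⋃ k, Set.range (𝒜.inj k)) :=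
      TopologicalSpace.IsSeparable.iUnion fun k =>
        TopologicalSpace.isSeparable_range (𝒜.inj k).continuous
    refine (h1.span (R := ℂ)).mono ?_
    rintro x ⟨n, hn⟩
    rw [← 𝒜.sum_eq hn]
    exact Submodule.sum_mem _ fun k _ => Submodule.subset_span (Set.mem_iUnion.2 ⟨k, _, rfl⟩)
  obtain ⟨c, hc, hcc, hcd⟩ := hsep.exists_countable_dense_subset
  have hcd' : Dense c := by
    rw [dense_iff_closure_eq]
    exact Set.eq_univ_of_univ_subset
      (hd.closure_eq ▸ (closure_minimal hcd isClosed_closure))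
  have : c.Nonempty := hcd'.nonempty
  obtain ⟨z, hz⟩ := hcc.exists_eq_range this
  exact ⟨z, fun i => hc (hz ▸ ⟨i, rfl⟩), by rw [DenseRange, ← hz]; exact hcd'⟩

theorem AmpData.isRep {E : NonUnitalStarSubalgebra ℂ A} {σ : A → H' →L[ℂ] H'} (h : IsRep E σ) :
    IsRep E (fun a => 𝒜.ampl (σ a)) where
  map_add a ha b hb := by rw [h.map_add a ha b hb, 𝒜.ampl_add]
  map_smul c a ha := by rw [h.map_smul c a ha, 𝒜.ampl_smul]
  map_mul a ha b hb := by rw [h.map_mul a ha b hb, 𝒜.ampl_mul]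
  map_star a ha := by rw [h.map_star a ha, 𝒜.ampl_star]
  norm_le a ha := (𝒜.norm_ampl_le _).trans (h.norm_le a ha)

/-- existence of an approximate intertwiner on the amplification -/
theorem exists_V_amp {E : NonUnitalStarSubalgebra ℂ A} {Φ : A → H →L[ℂ] H} {σ : A → H' →L[ℂ] H'}
    [TopologicalSpace.SeparableSpace H']
    (hΦ : IsRep E Φ) (hσ : IsRep E σ) (b : ℕ → A) (hbE : ∀ i, b i ∈ E)
    (hb : ∀ a ∈ E, ∀ ε > 0, ∃ i, ‖a - b i‖ < ε) (hApp : App E Φ σ ⊤) :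
    ∃ V : L →L[ℂ] H, V† ∘L V = 1 ∧ ∀ a ∈ E, Cpt (Φ a ∘L V - V ∘L 𝒜.ampl (σ a)) := by
  obtain ⟨z, hz, hzd⟩ := 𝒜.exists_dense
  refine exists_V hΦ (𝒜.isRep hσ) b hbE hb 𝒜.fin ?_ z hz hzd (hApp.amp 𝒜)
  rintro a ha x ⟨n, hn⟩
  exact ⟨n, fun k hk => by rw [𝒜.inj_adj_ampl, hn k hk, map_zero]⟩

end AppAmp

end CalkinUniv

namespace CalkinUniv

open scoped InnerProductSpace InnerProduct Topology
open ContinuousLinearMap Filter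

section Absorb

variable {A : Type*} [NonUnitalCStarAlgebra A]
variable {H H' L X : Type*} [NormedAddCommGroup H] [InnerProductSpace ℂ H] [CompleteSpace H]
  [NormedAddCommGroup H'] [InnerProductSpace ℂ H'] [CompleteSpace H']
  [NormedAddCommGroup L] [InnerProductSpace ℂ L] [CompleteSpace L]
  [NormedAddCommGroup X] [InnerProductSpace ℂ X] [CompleteSpace X]

theorem norm_le_one_of_isom' {T : H →L[ℂ] H'} (h : ∀ x, (T†) (T x) = x) : ‖T‖ ≤ 1 := by
  refine opNorm_le_bound _ zero_le_one fun x => ?_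
  rw [one_mul]
  refine le_of_sq_le_sq ?_ (norm_nonneg _)
  rw [← re_inner_self', ← adjoint_inner_right, h, re_inner_self']

theorem norm_adj_le_one {T : H →L[ℂ] H'} (h : ∀ x, (T†) (T x) = x) : ‖T†‖ ≤ 1 := by
  rw [LinearIsometryEquiv.norm_map]; exact norm_le_one_of_isom' h

def skip (N k : ℕ) : ℕ := if k < N then k else k + 1

theorem skip_inj (N : ℕ) : Function.Injective (skip N) := by
  intro a b h; simp only [skip] at h; split_ifs at h <;> omega

variable (𝒜 : AmpData H' L)

namespace AmpData

noncomputable def sk (N : ℕ) : L →L[ℂ] L := 𝒜.push (skip N) (skip_inj N)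

theorem sk_inj (N k : ℕ) (x : H') : 𝒜.sk N (𝒜.inj k x) = 𝒜.inj (skip N k) x := 𝒜.push_inj k x

theorem sk_adj_sk (N : ℕ) (x : L) : ((𝒜.sk N)†) (𝒜.sk N x) = x := by
  have h := congrArg (fun T : L →L[ℂ] L => T x)
    (𝒜.push_adj_push (f := skip N) (hf := skip_inj N))
  simp only [comp_apply, one_apply] at h
  exact h

theorem sk_adj_lt {N k : ℕ} (h : k < N) (x : H') : ((𝒜.sk N)†) (𝒜.inj k x) = 𝒜.inj k x := by
  have := 𝒜.push_adj_inj (f := skip N) (hf := skip_inj N) k x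
  rwa [skip, if_pos h] at this

theorem sk_adj_gt {N k : ℕ} (h : N ≤ k) (x : H') : ((𝒜.sk N)†) (𝒜.inj (k + 1) x) = 𝒜.inj k x := by
  have := 𝒜.push_adj_inj (f := skip N) (hf := skip_inj N) k x
  rwa [skip, if_neg (by omega)] at this

theorem sk_adj_self (N : ℕ) (x : H') : ((𝒜.sk N)†) (𝒜.inj N x) = 0 := by
  refine 𝒜.push_adj_inj_ne (fun k => ?_) x
  simp only [skip]; split_ifs <;> omega

theorem inj_adj_sk (N : ℕ) (x : L) : ((𝒜.inj N)†) (𝒜.sk N x) = 0 := by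
  refine ext_inner_left ℂ fun y => ?_
  rw [adjoint_inner_right, ← adjoint_inner_left, sk_adj_self]; simp

theorem sk_sk_adj (N : ℕ) (x : L) :
    𝒜.sk N (((𝒜.sk N)†) x) = x - 𝒜.inj N (((𝒜.inj N)†) x) := by
  have : 𝒜.sk N ∘L (𝒜.sk N)† = 1 - 𝒜.inj N ∘L (𝒜.inj N)† := by
    refine 𝒜.ext fun k x => ?_
    simp only [comp_apply, sub_apply, one_apply]
    rcases lt_trichotomy k N with h | h | h
    · rw [𝒜.sk_adj_lt h, sk_inj, skip, if_pos h, 𝒜.inj_ne (by omega)]; simp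
    · subst h; rw [sk_adj_self, 𝒜.inj_same]; simp
    · obtain ⟨k, rfl⟩ : ∃ m, k = m + 1 := ⟨k - 1, by omega⟩
      rw [𝒜.sk_adj_gt (by omega), sk_inj, skip, if_neg (by omega), 𝒜.inj_ne (by omega)]; simp
  simpa using congrArg (fun T : L →L[ℂ] L => T x) this

theorem inj_adj_sk_succ (N : ℕ) (x : L) :
    ((𝒜.inj N)†) (𝒜.sk (N + 1) x) = ((𝒜.inj N)†) x := by
  refine ext_inner_left ℂ fun y => ?_
  rw [adjoint_inner_right, ← adjoint_inner_left, 𝒜.sk_adj_lt (by omega), adjoint_inner_right]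

theorem sk_adj_sk_succ (N : ℕ) (x : L) :
    ((𝒜.sk N)†) (𝒜.sk (N + 1) x) = x - 𝒜.inj N (((𝒜.inj N)†) x) := by
  have : (𝒜.sk N)† ∘L 𝒜.sk (N + 1) = 1 - 𝒜.inj N ∘L (𝒜.inj N)† := by
    refine 𝒜.ext fun k x => ?_
    simp only [comp_apply, sub_apply, one_apply, sk_inj]
    rcases lt_trichotomy k N with h | h | h
    · rw [skip, if_pos (by omega), 𝒜.sk_adj_lt h, 𝒜.inj_ne (by omega)]; simp
    · subst h; rw [skip, if_pos (by omega), sk_adj_self, 𝒜.inj_same]; simp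
    · rw [skip, if_neg (by omega), 𝒜.sk_adj_gt (by omega), 𝒜.inj_ne (by omega)]; simp
  simpa using congrArg (fun T : L →L[ℂ] L => T x) this

theorem sk_sub_tail (N : ℕ) : (𝒜.sk N - 1) * 𝒜.tail N = 𝒜.sk N - 1 := by
  refine 𝒜.ext fun k x => ?_
  rw [mul_ap, tail_inj]
  split_ifs with h
  · simp [sk_inj, skip, h]
  · rfl

theorem tail_sk_sub (N : ℕ) : 𝒜.tail N * (𝒜.sk N - 1) = 𝒜.sk N - 1 := by
  refine 𝒜.ext fun k x => ?_
  have e1 : (1 : L →L[ℂ] L) (𝒜.inj k x) = 𝒜.inj k x := rfl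
  rw [mul_ap, sub_apply, e1, sk_inj, map_sub, tail_inj, tail_inj]
  by_cases h : k < N
  · rw [skip, if_pos h, if_pos h, sub_self, sub_self]
  · rw [skip, if_neg h, if_neg h, if_neg (by omega)]

theorem tail_inj_self (N : ℕ) : 𝒜.tail N ∘L 𝒜.inj N = 𝒜.inj N := by
  ext x; simp [tail_inj]

theorem norm_sk_sub (N : ℕ) : ‖𝒜.sk N - 1‖ ≤ 2 := by
  refine (norm_sub_le _ _).trans ?_
  have h1 := norm_le_one_of_isom' (𝒜.sk_adj_sk N)
  have h2 : ‖(1 : L →L[ℂ] L)‖ ≤ 1 := norm_id_le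
  linarith

theorem norm_inj (N : ℕ) : ‖𝒜.inj N‖ ≤ 1 := norm_le_one_of_isom' (𝒜.inj_same N)

end AmpData

/-- Relations used for absorption. -/
theorem absorb_data {E : NonUnitalStarSubalgebra ℂ A} {Φ : A → H →L[ℂ] H} {σ : A → H' →L[ℂ] H'}
    (hΦ : IsRep E Φ) (hσ : IsRep E σ) (𝒜 : AmpData H' L) (V : L →L[ℂ] H) (hV : V† ∘L V = 1)
    (hc : ∀ a ∈ E, Cpt (Φ a ∘L V - V ∘L 𝒜.ampl (σ a))) :
    ∃ (t : ℕ → H →L[ℂ] H) (v : ℕ → H' →L[ℂ] H),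
      (∀ N x, ((t N)†) (t N x) = x) ∧ (∀ N x, ((v N)†) (v N x) = x) ∧
      (∀ N x, t N (((t N)†) x) = x - v N (((v N)†) x)) ∧ (∀ N x, ((v N)†) (t N x) = 0) ∧
      (∀ N x, ((t N)†) (v N x) = 0) ∧ (∀ N x, ((t N)†) (v (N + 1) x) = v N x) ∧
      (∀ N x, ((v N)†) (t (N + 1) x) = ((v N)†) x) ∧
      (∀ N x, ((t N)†) (t (N + 1) x) = x - v N (((v N)†) x)) ∧
      (∀ N x, ((v N)†) (v (N + 1) x) = 0) ∧
      (∀ a ∈ E, ∀ N, Cpt (Φ a ∘L t N - t N ∘L Φ a)) ∧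
      (∀ a ∈ E, ∀ N, Cpt (Φ a ∘L v N - v N ∘L σ a)) ∧
      (∀ a ∈ E, Tendsto (fun N => ‖Φ a ∘L t N - t N ∘L Φ a‖) atTop (𝓝 0)) ∧
      (∀ a ∈ E, Tendsto (fun N => ‖Φ a ∘L v N - v N ∘L σ a‖) atTop (𝓝 0)) := by
  have hVx : ∀ x, (V†) (V x) = x := fun x => by
    simpa using congrArg (fun T : L →L[ℂ] L => T x) hV
  have hVn : ‖V‖ ≤ 1 := norm_le_one_of_isom' hVx
  have hVn' : ‖V†‖ ≤ 1 := norm_adj_le_one hVx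
  let t : ℕ → H →L[ℂ] H := fun N => 1 + V ∘L (𝒜.sk N - 1) ∘L V†
  let v : ℕ → H' →L[ℂ] H := fun N => V ∘L 𝒜.inj N
  have ht : ∀ N x, t N x = x - V ((V†) x) + V (𝒜.sk N ((V†) x)) := by
    intro N x; simp [t]; abel
  have ht' : ∀ N x, ((t N)†) x = x - V ((V†) x) + V (((𝒜.sk N)†) ((V†) x)) := by
    intro N x
    have : (t N)† = 1 + V ∘L ((𝒜.sk N)† - 1) ∘L V† := by
      simp only [t, map_add, adjoint_comp, adjoint_adjoint, map_sub]
      have : (1 : H →L[ℂ] H)† = 1 := by rw [← star_eq_adjoint, star_one]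
      have h2 : (1 : L →L[ℂ] L)† = 1 := by rw [← star_eq_adjoint, star_one]
      rw [this, h2]; rfl
    rw [this]; simp; abel
  have hv : ∀ N x, v N x = V (𝒜.inj N x) := fun N x => rfl
  have hv' : ∀ N x, ((v N)†) x = ((𝒜.inj N)†) ((V†) x) := by
    intro N x; simp [v, adjoint_comp]
  let c : A → L →L[ℂ] H := fun a => Φ a ∘L V - V ∘L 𝒜.ampl (σ a)
  have key1 : ∀ a, ∀ N, Φ a ∘L v N - v N ∘L σ a = (c a ∘L 𝒜.tail N) ∘L 𝒜.inj N := by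
    intro a N
    rw [comp_assoc (c a), 𝒜.tail_inj_self]
    ext x; simp [c, v, 𝒜.ampl_inj]
  have key2 : ∀ a ∈ E, ∀ N, Φ a ∘L t N - t N ∘L Φ a =
      (c a ∘L 𝒜.tail N) ∘L (𝒜.sk N - 1) ∘L V† -
      V ∘L (𝒜.sk N - 1) ∘L (c (star a) ∘L 𝒜.tail N)† := by
    intro a ha N
    have e1 : (c a ∘L 𝒜.tail N) ∘L (𝒜.sk N - 1) = c a ∘L (𝒜.sk N - 1) := by
      rw [comp_assoc]; congr 1; exact 𝒜.tail_sk_sub N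
    have e2 : (𝒜.sk N - 1) ∘L (c (star a) ∘L 𝒜.tail N)† = (𝒜.sk N - 1) ∘L (c (star a))† := by
      rw [adjoint_comp, ← comp_assoc]; congr 1
      rw [← star_eq_adjoint, 𝒜.tail_star]; exact 𝒜.sk_sub_tail N
    have e3 : (c (star a))† = V† ∘L Φ a - 𝒜.ampl (σ a) ∘L V† := by
      simp only [c, map_sub, adjoint_comp]
      rw [hΦ.map_star a ha, hσ.map_star a ha, 𝒜.ampl_star, star_eq_adjoint, star_eq_adjoint,
        adjoint_adjoint, adjoint_adjoint]
    rw [← comp_assoc, e1, e2, e3]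
    have hcomm : ∀ x, 𝒜.sk N (𝒜.ampl (σ a) x) = 𝒜.ampl (σ a) (𝒜.sk N x) := fun x => by
      rw [← mul_ap, ← mul_ap]
      exact congrArg (fun T : L →L[ℂ] L => T x) (𝒜.push_ampl (σ a))
    ext x
    simp [c, t, hcomm]
    abel
  refine ⟨t, v, ?_, ?_, ?_, ?_, ?_, ?_, ?_, ?_, ?_, ?_, ?_, ?_, ?_⟩
  · intro N x; simp [ht, ht', hVx, 𝒜.sk_adj_sk]
  · intro N x; simp [hv, hv', hVx, 𝒜.inj_same]
  · intro N x; simp [ht, ht', hv, hv', hVx, 𝒜.sk_sk_adj]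
  · intro N x; simp [ht, hv', hVx, 𝒜.inj_adj_sk]
  · intro N x; simp [ht', hv, hVx, 𝒜.sk_adj_self]
  · intro N x; simp [ht', hv, hVx, 𝒜.sk_adj_gt (le_refl N)]
  · intro N x; simp [ht, hv', hVx, 𝒜.inj_adj_sk_succ]
  · intro N x; simp [ht, ht', hv, hv', hVx, 𝒜.sk_adj_sk_succ]
  · intro N x; simp [hv, hv', hVx, 𝒜.inj_ne (Nat.ne_of_lt (Nat.lt_succ_self N))]
  · intro a ha N
    rw [key2 a ha N]
    exact ((hc a ha).comp_right _ |>.comp_right _).sub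
      ((((hc _ (star_mem ha)).comp_right _).adj.comp_left _).comp_left _)
  · intro a ha N
    rw [key1 a N]
    exact ((hc a ha).comp_right _).comp_right _
  · intro a ha
    have l1 := 𝒜.cpt_tail (hc a ha)
    have l2 := 𝒜.cpt_tail (hc _ (star_mem ha))
    have l3 := (l1.mul_const 2).add (l2.mul_const 2)
    rw [zero_mul, add_zero] at l3
    refine squeeze_zero (fun _ => norm_nonneg _) (fun N => ?_) l3
    rw [key2 a ha N]
    refine (norm_sub_le _ _).trans ?_
    have n1 : ‖(𝒜.sk N - 1) ∘L V†‖ ≤ 2 * 1 :=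
      (opNorm_comp_le _ _).trans (by gcongr; exact 𝒜.norm_sk_sub N)
    have n2 : ‖(𝒜.sk N - 1) ∘L (c (star a) ∘L 𝒜.tail N)†‖ ≤ 2 * ‖c (star a) ∘L 𝒜.tail N‖ :=
      (opNorm_comp_le _ _).trans (by
        rw [LinearIsometryEquiv.norm_map]; gcongr; exact 𝒜.norm_sk_sub N)
    gcongr
    · refine (opNorm_comp_le _ _).trans ?_
      gcongr
      linarith
    · refine (opNorm_comp_le _ _).trans ?_
      calc _ ≤ 1 * (2 * ‖c (star a) ∘L 𝒜.tail N‖) := by gcongr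
        _ = _ := by ring
  · intro a ha
    have l1 := 𝒜.cpt_tail (hc a ha)
    refine squeeze_zero (fun _ => norm_nonneg _) (fun N => ?_) l1
    rw [key1 a N]
    refine (opNorm_comp_le _ _).trans ?_
    calc _ ≤ ‖c a ∘L 𝒜.tail N‖ * 1 := by gcongr; exact 𝒜.norm_inj N
      _ = _ := by rw [mul_one]

/-- `X` is the direct sum of `H` and `H'`. -/
structure DSum (j : H →L[ℂ] X) (j' : H' →L[ℂ] X) : Prop where
  a1 : ∀ x, (j†) (j x) = x
  a2 : ∀ x, (j'†) (j' x) = x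
  a3 : ∀ x, (j†) (j' x) = 0
  a4 : ∀ x, (j'†) (j x) = 0
  a5 : ∀ x, j ((j†) x) + j' ((j'†) x) = x

theorem DSum.symm {j : H →L[ℂ] X} {j' : H' →L[ℂ] X} (h : DSum j j') : DSum j' j :=
  ⟨h.a2, h.a1, h.a4, h.a3, fun x => by rw [add_comm, h.a5]⟩

noncomputable def dsum (j : H →L[ℂ] X) (j' : H' →L[ℂ] X) (Φ : A → H →L[ℂ] H)
    (σ : A → H' →L[ℂ] H') : A → X →L[ℂ] X :=
  fun a => j ∘L Φ a ∘L j† + j' ∘L σ a ∘L j'†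

theorem dsum_symm (j : H →L[ℂ] X) (j' : H' →L[ℂ] X) (Φ : A → H →L[ℂ] H)
    (σ : A → H' →L[ℂ] H') : dsum j' j σ Φ = dsum j j' Φ σ := by
  funext a; simp only [dsum]; rw [add_comm]

theorem absorb {E : NonUnitalStarSubalgebra ℂ A} {Φ : A → H →L[ℂ] H} {σ : A → H' →L[ℂ] H'}
    (hΦ : IsRep E Φ) (hσ : IsRep E σ) (𝒜 : AmpData H' L) (V : L →L[ℂ] H) (hV : V† ∘L V = 1)
    (hc : ∀ a ∈ E, Cpt (Φ a ∘L V - V ∘L 𝒜.ampl (σ a)))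
    {j : H →L[ℂ] X} {j' : H' →L[ℂ] X} (hj : DSum j j') :
    ∃ T : X →L[ℂ] H, T† ∘L T = 1 ∧ T ∘L T† = 1 ∧ Kapp (E : Set A) Φ (conj T (dsum j j' Φ σ)) := by
  obtain ⟨t, v, r1, r2, r3, r4, r5, r6, r7, r8, r9, c1, c2, l1, l2⟩ :=
    absorb_data hΦ hσ 𝒜 V hV hc
  let T : ℕ → X →L[ℂ] H := fun N => t N ∘L j† + v N ∘L j'†
  have hT : ∀ N x, T N x = t N ((j†) x) + v N ((j'†) x) := fun N x => by simp [T]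
  have hT' : ∀ N x, ((T N)†) x = j (((t N)†) x) + j' (((v N)†) x) := fun N x => by
    simp [T, adjoint_comp]
  have T1 : ∀ N x, ((T N)†) (T N x) = x := by
    intro N x
    simp [hT, hT', r1, r2, r4, r5, hj.a5]
  have T2 : ∀ N x, T N (((T N)†) x) = x := by
    intro N x
    simp [hT, hT', hj.a1, hj.a2, hj.a3, hj.a4, r3]
  have TT1 : ∀ N, (T N)† ∘L T N = 1 := fun N => by ext x; simp [T1]
  have TT2 : ∀ N, T N ∘L (T N)† = 1 := fun N => by ext x; simp [T2]
  set Ψ := dsum j j' Φ σ with hΨ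
  have hΨx : ∀ a x, Ψ a x = j (Φ a ((j†) x)) + j' (σ a ((j'†) x)) := fun a x => by
    simp [hΨ, dsum]
  have hD : ∀ a N, Φ a ∘L T N - T N ∘L Ψ a =
      (Φ a ∘L t N - t N ∘L Φ a) ∘L j† + (Φ a ∘L v N - v N ∘L σ a) ∘L j'† := by
    intro a N
    ext x
    simp [hT, hΨx, hj.a1, hj.a2, hj.a3, hj.a4]
    abel
  have hDc : ∀ a ∈ E, ∀ N, Cpt (Φ a ∘L T N - T N ∘L Ψ a) := by
    intro a ha N
    rw [hD]
    exact ((c1 a ha N).comp_right _).add ((c2 a ha N).comp_right _)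
  let R : ℕ → X →L[ℂ] X := fun N => (T N)† ∘L T (N + 1)
  have hRx : ∀ N x, R N x = j ((j†) x - v N (((v N)†) ((j†) x))) + j (v N ((j'†) x)) +
      j' (((v N)†) ((j†) x)) := by
    intro N x
    simp [R, hT, hT', r6, r7, r8, r9]
  have hRs : ∀ N, star (R N) = R N := by
    intro N
    have : R N = j ∘L (1 - v N ∘L (v N)†) ∘L j† + (j ∘L v N ∘L j'† + j' ∘L (v N)† ∘L j†) := by
      ext x; rw [hRx]; simp; abel
    rw [this, star_eq_adjoint]
    simp only [map_add, adjoint_comp, adjoint_adjoint, map_sub]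
    have h1 : (1 : H →L[ℂ] H)† = 1 := by rw [← star_eq_adjoint, star_one]
    rw [h1]
    ext x; simp; abel
  have hRR : ∀ N, R N * R N = 1 := by
    intro N
    have h0 : R N * R N = (R N)† * R N := by rw [← star_eq_adjoint, hRs]
    rw [h0]
    ext x
    simp [mul_ap, R, adjoint_comp, T1, T2]
  have hRc : ∀ a ∈ E, ∀ N, Cpt (R N * Ψ a - Ψ a * R N) := by
    intro a ha N
    have : R N * Ψ a - Ψ a * R N = -((T N)† ∘L (Φ a ∘L T (N + 1) - T (N + 1) ∘L Ψ a)) +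
        ((T N)† ∘L (Φ a ∘L T N - T N ∘L Ψ a)) ∘L ((T N)† ∘L T (N + 1)) := by
      ext x
      simp [mul_ap, R, T1, T2]
    rw [this]
    exact ((hDc a ha (N + 1)).comp_left _).neg.add (((hDc a ha N).comp_left _).comp_right _)
  have step : ∀ N, Kapp (E : Set A) (conj (T N) Ψ) (conj (T (N + 1)) Ψ) := by
    intro N
    have k := (Kapp.reflection (E := (E : Set A)) (hRs N) (hRR N)
      (fun a ha => hRc a ha N)).conj (T N) (TT1 N) (TT2 N)
    convert k using 1
    funext a
    have e1 : ∀ x, T N (R N x) = T (N + 1) x := fun x => by simp [R, T2]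
    have e2 : ∀ x, R N (((T N)†) x) = ((T (N + 1))†) x := by
      intro x
      conv_lhs => rw [← hRs N, star_eq_adjoint]
      simp [R, adjoint_comp, T2]
    ext x
    simp [conj, mul_ap, e1, e2]
  have all : ∀ N, Kapp (E : Set A) (conj (T N) Ψ) (conj (T 0) Ψ) := by
    intro N
    induction N with
    | zero => exact Kapp.refl _ _
    | succ N ih => exact (step N).symm.trans ih
  refine ⟨T 0, TT1 0, TT2 0, Kapp.of_limit fun F hF ε hε => ?_⟩
  have ev : ∀ᶠ N in atTop, ∀ a ∈ F, ‖conj (T N) Ψ a - Φ a‖ ≤ ε := by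
    rw [Finset.eventually_all]
    intro a ha
    have l := (l1 a (hF a ha)).add (l2 a (hF a ha))
    rw [add_zero] at l
    filter_upwards [l.eventually (gt_mem_nhds hε)] with N hN
    refine le_trans ?_ hN.le
    have e : conj (T N) Ψ a - Φ a = -((Φ a ∘L T N - T N ∘L Ψ a) ∘L (T N)†) := by
      ext x; simp [conj, T2]
    have e' : ‖(T N)†‖ ≤ 1 := norm_adj_le_one (T1 N)
    rw [e, norm_neg]
    refine (opNorm_comp_le _ _).trans ?_
    calc _ ≤ ‖Φ a ∘L T N - T N ∘L Ψ a‖ * 1 := by gcongr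
      _ ≤ _ := ?_
    rw [mul_one, hD]
    refine (norm_add_le _ _).trans ?_
    have f1 : ‖j†‖ ≤ 1 := norm_adj_le_one hj.a1
    have f2 : ‖j'†‖ ≤ 1 := norm_adj_le_one hj.a2
    gcongr
    · exact (opNorm_comp_le _ _).trans (mul_le_of_le_one_right (norm_nonneg _) f1)
    · exact (opNorm_comp_le _ _).trans (mul_le_of_le_one_right (norm_nonneg _) f2)
  obtain ⟨N, hN⟩ := ev.exists
  exact ⟨_, all N, hN⟩

theorem conj_conj {H'' : Type*} [NormedAddCommGroup H''] [InnerProductSpace ℂ H''] [CompleteSpace H'']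
    (S : H' →L[ℂ] H'') (T : H →L[ℂ] H') (Ψ : A → H →L[ℂ] H) :
    conj S (conj T Ψ) = conj (S ∘L T) Ψ := by
  funext a; ext x; simp [conj, adjoint_comp]

theorem exists_dsum (H H' : Type*) [NormedAddCommGroup H] [InnerProductSpace ℂ H] [CompleteSpace H]
  [NormedAddCommGroup H'] [InnerProductSpace ℂ H'] [CompleteSpace H'] :
    ∃ (j : H →L[ℂ] WithLp 2 (H × H')) (j' : H' →L[ℂ] WithLp 2 (H × H')), DSum j j' := by
  let e := (WithLp.prodContinuousLinearEquiv 2 ℂ H H').symm.toContinuousLinearMap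
  let j : H →L[ℂ] WithLp 2 (H × H') := e ∘L (ContinuousLinearMap.inl ℂ H H')
  let j' : H' →L[ℂ] WithLp 2 (H × H') := e ∘L (ContinuousLinearMap.inr ℂ H H')
  have hj : ∀ x, j x = WithLp.toLp 2 (x, 0) := fun x => rfl
  have hj' : ∀ x, j' x = WithLp.toLp 2 (0, x) := fun x => rfl
  have k : ∀ x, (j†) x = x.fst := fun x => by
    refine ext_inner_left ℂ fun y => ?_
    rw [adjoint_inner_right, hj, WithLp.prod_inner_apply]; simp
  have k' : ∀ x, (j'†) x = x.snd := fun x => by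
    refine ext_inner_left ℂ fun y => ?_
    rw [adjoint_inner_right, hj', WithLp.prod_inner_apply]; simp
  refine ⟨j, j', ?_, ?_, ?_, ?_, ?_⟩
  · intro x; rw [k, hj]; rfl
  · intro x; rw [k', hj']; rfl
  · intro x; rw [k, hj']; rfl
  · intro x; rw [k', hj]; rfl
  · intro x; rw [k, k', hj, hj', ← WithLp.toLp_add, Prod.mk_add_mk, add_zero, zero_add]; rfl

/-- Two-sided absorption: mutually approximable representations are equivalent. -/
theorem two_sided {E : NonUnitalStarSubalgebra ℂ A} {Φ : A → H →L[ℂ] H} {σ : A → H' →L[ℂ] H'}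
    [TopologicalSpace.SeparableSpace H] [TopologicalSpace.SeparableSpace H']
    (hΦ : IsRep E Φ) (hσ : IsRep E σ) (b : ℕ → A) (hbE : ∀ i, b i ∈ E)
    (hb : ∀ a ∈ E, ∀ ε > 0, ∃ i, ‖a - b i‖ < ε) (h1 : App E Φ σ ⊤) (h2 : App E σ Φ ⊤) :
    ∃ U : H' →L[ℂ] H, U† ∘L U = 1 ∧ U ∘L U† = 1 ∧ Kapp (E : Set A) Φ (conj U σ) := by
  obtain ⟨V, hV, hVc⟩ := exists_V_amp (lpAmp H') hΦ hσ b hbE hb h1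
  obtain ⟨V', hV', hVc'⟩ := exists_V_amp (lpAmp H) hσ hΦ b hbE hb h2
  obtain ⟨j, j', hj⟩ := exists_dsum H H'
  obtain ⟨T, T1, T2, TK⟩ := absorb hΦ hσ (lpAmp H') V hV hVc hj
  obtain ⟨T', T1', T2', TK'⟩ := absorb hσ hΦ (lpAmp H) V' hV' hVc' hj.symm
  rw [dsum_symm] at TK'
  have U1 : (T ∘L T'†)† ∘L (T ∘L T'†) = 1 := by
    rw [adjoint_comp, adjoint_adjoint, comp_assoc, ← comp_assoc (T†), T1]
    exact T2'
  have U2 : (T ∘L T'†) ∘L (T ∘L T'†)† = 1 := by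
    rw [adjoint_comp, adjoint_adjoint, comp_assoc, ← comp_assoc (T'†), T1']
    exact T2
  refine ⟨T ∘L T'†, U1, U2, ?_⟩
  have k := TK'.symm.conj _ U1 U2
  rw [conj_conj, comp_assoc, T1'] at k
  exact TK.trans k

end Absorb

end CalkinUniv

namespace CalkinUniv

open scoped InnerProductSpace InnerProduct Topology
open ContinuousLinearMap Filter

section Good

variable {A : Type*} [NonUnitalCStarAlgebra A]
variable {H H' K : Type*} [NormedAddCommGroup H] [InnerProductSpace ℂ H] [CompleteSpace H]
  [NormedAddCommGroup H'] [InnerProductSpace ℂ H'] [CompleteSpace H']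
  [NormedAddCommGroup K] [InnerProductSpace ℂ K] [CompleteSpace K]

/-- Weak version of `App`. -/
def WApp (S : Set A) (Φ : A → H →L[ℂ] H) (σ : A → H' →L[ℂ] H') : Prop :=
  ∀ X : Submodule ℂ H', FiniteDimensional ℂ X → ∀ F : Finset A, (∀ a ∈ F, a ∈ S) →
    ∀ ε > 0, ∃ W : H' →L[ℂ] H,
      (∀ x ∈ X, ∀ y ∈ X, ⟪W x, W y⟫_ℂ = ⟪x, y⟫_ℂ) ∧
      ∀ a ∈ F, ∀ x ∈ X, ∀ y ∈ X, ‖⟪W x, Φ a (W y)⟫_ℂ - ⟪x, σ a y⟫_ℂ‖ ≤ ε * ‖x‖ * ‖y‖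

theorem WApp.mono {S S' : Set A} {Φ : A → H →L[ℂ] H} {σ : A → H' →L[ℂ] H'}
    (h : WApp S' Φ σ) (hS : S ⊆ S') : WApp S Φ σ :=
  fun X hX F hF => h X hX F fun a ha => hS (hF a ha)

theorem norm_eq_of_isom {X : Submodule ℂ H'} {W : H' →L[ℂ] H}
    (h : ∀ x ∈ X, ∀ y ∈ X, ⟪W x, W y⟫_ℂ = ⟪x, y⟫_ℂ) {x : H'} (hx : x ∈ X) : ‖W x‖ = ‖x‖ := by
  have := congrArg Complex.re (h x hx x hx)
  rw [re_inner_self', re_inner_self'] at this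
  exact (sq_eq_sq₀ (norm_nonneg _) (norm_nonneg _)).1 this

theorem App.trans {S : Set A} {Φ : A → H →L[ℂ] H} {σ : A → H' →L[ℂ] H'} {π : A → K →L[ℂ] K}
    (h1 : App S Φ π ⊤) (h2 : WApp S π σ) : App S Φ σ ⊤ := by
  intro X hX _ F hF ε hε N hN
  obtain ⟨W1, i1, a1⟩ := h2 X hX F hF (ε / 2) (by positivity)
  obtain ⟨W2, i2, n2, a2⟩ := h1 (X.map W1.toLinearMap) inferInstance le_top F hF (ε / 2)
    (by positivity) N hN
  have m : ∀ x ∈ X, W1 x ∈ X.map W1.toLinearMap := fun x hx => ⟨x, hx, rfl⟩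
  refine ⟨W2 ∘L W1, ?_, ?_, ?_⟩
  · intro x hx y hy
    rw [comp_apply, comp_apply, i2 _ (m x hx) _ (m y hy), i1 x hx y hy]
  · intro x hx ν hν
    exact n2 _ (m x hx) ν hν
  · intro a ha x hx y hy
    have b1 := a1 a ha x hx y hy
    have b2 := a2 a ha _ (m x hx) _ (m y hy)
    rw [norm_eq_of_isom i1 hx, norm_eq_of_isom i1 hy] at b2
    rw [comp_apply, comp_apply]
    calc _ ≤ ‖⟪W2 (W1 x), Φ a (W2 (W1 y))⟫_ℂ - ⟪W1 x, π a (W1 y)⟫_ℂ‖ +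
          ‖⟪W1 x, π a (W1 y)⟫_ℂ - ⟪x, σ a y⟫_ℂ‖ := norm_sub_le_norm_sub_add_norm_sub _ _ _
      _ ≤ ε / 2 * ‖x‖ * ‖y‖ + ε / 2 * ‖x‖ * ‖y‖ := add_le_add b2 b1
      _ = _ := by ring

theorem App.conj {S : Set A} {σ : A → H' →L[ℂ] H'} {π : A → K →L[ℂ] K} (h : App S σ π ⊤)
    (U : H' →L[ℂ] H) (h1 : U† ∘L U = 1) : App S (CalkinUniv.conj U σ) π ⊤ := by
  have hU : ∀ x, (U†) (U x) = x := fun x => by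
    simpa using congrArg (fun T : H' →L[ℂ] H' => T x) h1
  intro X hX _ F hF ε hε N hN
  obtain ⟨W, i1, n1, a1⟩ := h X hX le_top F hF ε hε (N.map (U†).toLinearMap) inferInstance
  refine ⟨U ∘L W, ?_, ?_, ?_⟩
  · intro x hx y hy
    rw [comp_apply, comp_apply, ← adjoint_inner_right, hU, i1 x hx y hy]
  · intro x hx ν hν
    rw [comp_apply, ← adjoint_inner_left]
    exact n1 x hx _ ⟨ν, hν, rfl⟩
  · intro a ha x hx y hy
    have e : ⟪(U ∘L W) x, CalkinUniv.conj U σ a ((U ∘L W) y)⟫_ℂ = ⟪W x, σ a (W y)⟫_ℂ := by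
      simp only [CalkinUniv.conj, comp_apply]
      rw [← adjoint_inner_right, hU, hU]
    rw [e]
    exact a1 a ha x hx y hy

theorem WApp.conj {S : Set A} {σ : A → H' →L[ℂ] H'} {π : A → K →L[ℂ] K} (h : WApp S π σ)
    (U : H' →L[ℂ] H) (h1 : U† ∘L U = 1) (h2 : U ∘L U† = 1) : WApp S π (CalkinUniv.conj U σ) := by
  have hU : ∀ x, U ((U†) x) = x := fun x => by
    simpa using congrArg (fun T : H →L[ℂ] H => T x) h2
  intro X hX F hF ε hε
  obtain ⟨W, i1, a1⟩ := h (X.map (U†).toLinearMap) inferInstance F hF ε hε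
  have m : ∀ x ∈ X, (U†) x ∈ X.map (U†).toLinearMap := fun x hx => ⟨x, hx, rfl⟩
  have i0 : ∀ x y, ⟪(U†) x, (U†) y⟫_ℂ = ⟪x, y⟫_ℂ := fun x y => by
    rw [adjoint_inner_right, hU]
  have n0 : ∀ x, ‖(U†) x‖ = ‖x‖ := fun x =>
    norm_eq_of_isom (X := ⊤) (fun x _ y _ => i0 x y) trivial
  refine ⟨W ∘L U†, ?_, ?_⟩
  · intro x hx y hy
    rw [comp_apply, comp_apply, i1 _ (m x hx) _ (m y hy), i0]
  · intro a ha x hx y hy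
    have := a1 a ha _ (m x hx) _ (m y hy)
    rw [n0, n0] at this
    have e : ⟪x, CalkinUniv.conj U σ a y⟫_ℂ = ⟪(U†) x, σ a ((U†) y)⟫_ℂ := by
      simp only [CalkinUniv.conj, comp_apply]
      rw [← adjoint_inner_left]
    rw [e]; exact this

theorem App.approx {S : Set A} {Φ : A → H →L[ℂ] H} {π : A → K →L[ℂ] K}
    (h : ∀ F : Finset A, (∀ a ∈ F, a ∈ S) → ∀ ε > 0, ∃ Θ : A → H →L[ℂ] H, App (F : Set A) Θ π ⊤ ∧
      ∀ a ∈ F, ‖Θ a - Φ a‖ ≤ ε) : App S Φ π ⊤ := by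
  intro X hX _ F hF ε hε N hN
  obtain ⟨Θ, hΘ, hd⟩ := h F hF (ε / 2) (by positivity)
  obtain ⟨W, i1, n1, a1⟩ := hΘ X hX le_top F (fun a ha => ha) (ε / 2) (by positivity) N hN
  refine ⟨W, i1, n1, fun a ha x hx y hy => ?_⟩
  have b1 := a1 a ha x hx y hy
  have b2 : ‖⟪W x, Φ a (W y)⟫_ℂ - ⟪W x, Θ a (W y)⟫_ℂ‖ ≤ ε / 2 * ‖x‖ * ‖y‖ := by
    rw [← inner_sub_right, ← sub_apply]
    refine (norm_inner_le_norm _ _).trans ?_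
    have c1 := (Φ a - Θ a).le_of_opNorm_le (c := ε / 2) (by rw [norm_sub_rev]; exact hd a ha) (W y)
    rw [norm_eq_of_isom i1 hx]
    rw [norm_eq_of_isom i1 hy] at c1
    calc _ ≤ ‖x‖ * (ε / 2 * ‖y‖) := by gcongr
      _ = _ := by ring
  calc _ ≤ _ := norm_sub_le_norm_sub_add_norm_sub _ ⟪W x, Θ a (W y)⟫_ℂ _
    _ ≤ ε / 2 * ‖x‖ * ‖y‖ + ε / 2 * ‖x‖ * ‖y‖ := add_le_add b2 b1
    _ = _ := by ring

theorem WApp.approx {S : Set A} {Φ : A → H →L[ℂ] H} {π : A → K →L[ℂ] K}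
    (h : ∀ F : Finset A, (∀ a ∈ F, a ∈ S) → ∀ ε > 0, ∃ Θ : A → H →L[ℂ] H, WApp (F : Set A) π Θ ∧
      ∀ a ∈ F, ‖Θ a - Φ a‖ ≤ ε) : WApp S π Φ := by
  intro X hX F hF ε hε
  obtain ⟨Θ, hΘ, hd⟩ := h F hF (ε / 2) (by positivity)
  obtain ⟨W, i1, a1⟩ := hΘ X hX F (fun a ha => ha) (ε / 2) (by positivity)
  refine ⟨W, i1, fun a ha x hx y hy => ?_⟩
  have b1 := a1 a ha x hx y hy
  have b2 : ‖⟪x, Θ a y⟫_ℂ - ⟪x, Φ a y⟫_ℂ‖ ≤ ε / 2 * ‖x‖ * ‖y‖ := by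
    rw [← inner_sub_right, ← sub_apply]
    refine (norm_inner_le_norm _ _).trans ?_
    have c1 := (Θ a - Φ a).le_of_opNorm_le (c := ε / 2) (hd a ha) y
    calc _ ≤ ‖x‖ * (ε / 2 * ‖y‖) := by gcongr
      _ = _ := by ring
  calc _ ≤ _ := norm_sub_le_norm_sub_add_norm_sub _ ⟪x, Θ a y⟫_ℂ _
    _ ≤ ε / 2 * ‖x‖ * ‖y‖ + ε / 2 * ‖x‖ * ‖y‖ := add_le_add b1 b2
    _ = _ := by ring

theorem IsRep.conj {E : NonUnitalStarSubalgebra ℂ A} {σ : A → H' →L[ℂ] H'} (h : IsRep E σ)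
    (U : H' →L[ℂ] H) (h1 : U† ∘L U = 1) : IsRep E (CalkinUniv.conj U σ) := by
  have hU : ∀ x, (U†) (U x) = x := fun x => by
    simpa using congrArg (fun T : H' →L[ℂ] H' => T x) h1
  refine ⟨?_, ?_, ?_, ?_, ?_⟩
  · intro a ha b hb; simp only [CalkinUniv.conj, h.map_add a ha b hb]; ext x; simp
  · intro c a ha; simp only [CalkinUniv.conj, h.map_smul c a ha]; ext x; simp
  · intro a ha b hb; simp only [CalkinUniv.conj, h.map_mul a ha b hb]; ext x; simp [mul_ap, hU]
  · intro a ha; simp only [CalkinUniv.conj, h.map_star a ha, star_eq_adjoint, adjoint_comp,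
      adjoint_adjoint, comp_assoc]
  · intro a ha
    simp only [CalkinUniv.conj]
    have n1 := norm_le_one_of_isom' hU
    have n2 := norm_adj_le_one hU
    calc _ ≤ ‖U‖ * ‖σ a ∘L U†‖ := opNorm_comp_le _ _
      _ ≤ 1 * (‖σ a‖ * ‖U†‖) := by gcongr; exact opNorm_comp_le _ _
      _ ≤ 1 * (‖a‖ * 1) := by gcongr; exact h.norm_le a ha
      _ = ‖a‖ := by ring

/-- From weak to strong approximation, using commuting orthogonal isometries. -/
theorem App.of_wapp {S : Set A} {ρ : A → H →L[ℂ] H} {π : A → K →L[ℂ] K} (h : WApp S ρ π)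
    (s : ℕ → H →L[ℂ] H) (s1 : ∀ j x y, ⟪s j x, s j y⟫_ℂ = ⟪x, y⟫_ℂ)
    (s2 : ∀ i j, i ≠ j → ∀ x y, ⟪s i x, s j y⟫_ℂ = 0)
    (s3 : ∀ a ∈ S, ∀ j x, ρ a (s j x) = s j (ρ a x)) : App S ρ π ⊤ := by
  classical
  intro X hX _ F hF ε hε N hN
  obtain ⟨W, i1, a1⟩ := h X hX F hF ε hε
  let k := Module.finrank ℂ (X →ₗ[ℂ] N) + 1
  let f : (Fin k → ℂ) →ₗ[ℂ] (X →ₗ[ℂ] N) :=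
    { toFun := fun c => N.orthogonalProjectionOnto.toLinearMap ∘ₗ
        (∑ j, c j • (s j ∘L W)).toLinearMap ∘ₗ X.subtype
      map_add' := by
        intro c d; ext x; simp [add_smul, Finset.sum_add_distrib]
      map_smul' := by
        intro c d; ext x; simp [mul_smul, Finset.smul_sum] }
  obtain ⟨c, hc, hc0⟩ := (Submodule.ne_bot_iff _).1 (LinearMap.ker_ne_bot_of_finrank_lt (f := f)
    (by rw [Module.finrank_fin_fun]; exact Nat.lt_succ_self _))
  have hpos : 0 < ∑ j, ‖c j‖ ^ 2 := by
    obtain ⟨j, hj⟩ : ∃ j, c j ≠ 0 := Function.ne_iff.1 hc0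
    exact Finset.sum_pos' (fun _ _ => by positivity) ⟨j, Finset.mem_univ _, by positivity⟩
  let r : ℂ := ((Real.sqrt (∑ j, ‖c j‖ ^ 2))⁻¹ : ℝ)
  have hr : starRingEnd ℂ r * r * ∑ j, starRingEnd ℂ (c j) * c j = 1 := by
    have e1 : ∑ j, starRingEnd ℂ (c j) * c j = ((∑ j, ‖c j‖ ^ 2 : ℝ) : ℂ) := by
      push_cast
      exact Finset.sum_congr rfl fun j _ => Complex.conj_mul' _
    rw [e1, Complex.conj_ofReal, ← Complex.ofReal_mul, ← Complex.ofReal_mul, ← mul_inv,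
      Real.mul_self_sqrt hpos.le, inv_mul_cancel₀ hpos.ne', Complex.ofReal_one]
  let T : K →L[ℂ] H := r • ∑ j, c j • (s j ∘L W)
  have hT : ∀ x, T x = r • ∑ j, c j • s j (W x) := fun x => by simp [T]
  have key : ∀ x y, ⟪T x, r • ∑ j, c j • s j y⟫_ℂ = ⟪W x, y⟫_ℂ := by
    intro x y
    rw [hT, inner_smul_left, inner_smul_right, sum_inner]
    have : ∀ i ∈ Finset.univ, ⟪c i • s i (W x), ∑ j, c j • s j y⟫_ℂ =
        (starRingEnd ℂ (c i) * c i) * ⟪W x, y⟫_ℂ := by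
      intro i _
      rw [inner_sum, Finset.sum_eq_single i]
      · rw [inner_smul_left, inner_smul_right, s1, mul_assoc]
      · intro j _ hj
        rw [inner_smul_left, inner_smul_right, s2 i j (by
          intro h; exact hj (Fin.ext h.symm)), mul_zero, mul_zero]
      · simp
    rw [Finset.sum_congr rfl this, ← Finset.sum_mul, ← mul_assoc, ← mul_assoc, hr, one_mul]
  refine ⟨T, ?_, ?_, ?_⟩
  · intro x hx y hy
    rw [hT y, key, i1 x hx y hy]
  · intro x hx ν hν
    have := congrArg (fun g : X →ₗ[ℂ] N => g ⟨x, hx⟩) (LinearMap.mem_ker.1 hc)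
    simp only [f, LinearMap.coe_mk, AddHom.coe_mk, LinearMap.comp_apply, LinearMap.zero_apply,
      Submodule.subtype_apply] at this
    have h0 : (∑ j, c j • (s j ∘L W)) x ∈ Nᗮ := by
      rw [← Submodule.orthogonalProjectionOnto_eq_zero_iff]; exact this
    have h1 : T x ∈ Nᗮ := by
      simp only [T, smul_apply]; exact Submodule.smul_mem _ _ h0
    exact (Submodule.mem_orthogonal _ _).1 h1 ν hν
  · intro a ha x hx y hy
    have e : ρ a (T y) = r • ∑ j, c j • s j (ρ a (W y)) := by
      rw [hT, map_smul, map_sum]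
      congr 1
      exact Finset.sum_congr rfl fun j _ => by rw [map_smul, s3 a (hF a ha)]
    rw [e, key]
    exact a1 a ha x hx y hy

/-- A universal model: a faithful representation with infinite multiplicity. -/
structure Model (A K : Type*) [NonUnitalCStarAlgebra A] [NormedAddCommGroup K]
    [InnerProductSpace ℂ K] [CompleteSpace K] where
  π : A →⋆ₙₐ[ℂ] (K →L[ℂ] K)
  inj : Function.Injective π
  s : ℕ → K →L[ℂ] K
  s1 : ∀ j x y, ⟪s j x, s j y⟫_ℂ = ⟪x, y⟫_ℂ
  s2 : ∀ i j, i ≠ j → ∀ x y, ⟪s i x, s j y⟫_ℂ = 0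
  s3 : ∀ a j x, π a (s j x) = s j (π a x)

structure Good (𝓜 : Model A K) (E : NonUnitalStarSubalgebra ℂ A) (Φ : A → H →L[ℂ] H) : Prop where
  rep : IsRep E Φ
  app : App E Φ 𝓜.π ⊤
  wapp : WApp E 𝓜.π Φ

theorem Good.mono {𝓜 : Model A K} {E E' : NonUnitalStarSubalgebra ℂ A} {Φ : A → H →L[ℂ] H}
    (h : Good 𝓜 E' Φ) (hE : E ≤ E') : Good 𝓜 E Φ :=
  ⟨h.rep.mono hE, h.app.mono hE le_rfl, h.wapp.mono hE⟩

theorem Good.conj {𝓜 : Model A K} {E : NonUnitalStarSubalgebra ℂ A} {σ : A → H' →L[ℂ] H'}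
    (h : Good 𝓜 E σ) (U : H' →L[ℂ] H) (h1 : U† ∘L U = 1) (h2 : U ∘L U† = 1) :
    Good 𝓜 E (CalkinUniv.conj U σ) :=
  ⟨h.rep.conj U h1, h.app.conj U h1, h.wapp.conj U h1 h2⟩

end Good

end CalkinUniv

namespace CalkinUniv

open scoped InnerProductSpace InnerProduct Topology
open ContinuousLinearMap Filter

section Rich

theorem countable_data {α X : Type*} [TopologicalSpace X] [SecondCountableTopology X] (d : α → X) :
    ∃ C : Set α, C.Countable ∧ ∀ p, d p ∈ closure (d '' C) := by
  obtain ⟨s, hs, hd⟩ := TopologicalSpace.exists_countable_dense (Set.range d)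
  have hch : ∀ y : Set.range d, ∃ p, d p = y.1 := fun y => y.2
  choose f hf using hch
  refine ⟨f '' s, hs.image f, fun p => ?_⟩
  have h1 : (⟨d p, p, rfl⟩ : Set.range d) ∈ closure s := hd _
  have h2 := image_closure_subset_closure_image continuous_subtype_val
    (Set.mem_image_of_mem (Subtype.val) h1)
  refine closure_mono ?_ h2
  rintro _ ⟨y, hy, rfl⟩
  exact ⟨f y, ⟨y, hy, rfl⟩, hf y⟩

variable {K : Type*} [NormedAddCommGroup K] [InnerProductSpace ℂ K] [CompleteSpace K]

theorem rich_vectors (T : ℕ → K →L[ℂ] K) : ∃ Ξ : Set K, Ξ.Countable ∧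
    ∀ n (v : Fin n → K), Orthonormal ℂ v → ∀ m : ℕ, ∀ δ > 0, ∃ w : Fin n → K, Orthonormal ℂ w ∧
      (∀ i, w i ∈ Ξ) ∧ ∀ l < m, ∀ i j, ‖⟪w i, T l (w j)⟫_ℂ - ⟪v i, T l (v j)⟫_ℂ‖ < δ := by
  have h := fun n : ℕ => countable_data
    (fun (v : {v : Fin n → K // Orthonormal ℂ v}) =>
      (fun (l : ℕ) (i j : Fin n) => ⟪v.1 i, T l (v.1 j)⟫_ℂ))
  choose C hC hd using h
  refine ⟨⋃ n, ⋃ v ∈ C n, Set.range v.1, ?_, ?_⟩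
  · exact Set.countable_iUnion fun n => (hC n).biUnion fun v _ => Set.countable_range _
  · intro n v hv m δ hδ
    have h1 := hd n ⟨v, hv⟩
    rw [mem_closure_iff_nhds] at h1
    let d : {v : Fin n → K // Orthonormal ℂ v} → ℕ → Fin n → Fin n → ℂ :=
      fun v l i j => ⟪v.1 i, T l (v.1 j)⟫_ℂ
    obtain ⟨_, hz, w, hw, rfl⟩ := h1 {z | ∀ l : Fin m, ∀ i j,
        ‖z l i j - ⟪v i, T l (v j)⟫_ℂ‖ < δ} (by
      have ho : IsOpen {z : ℕ → Fin n → Fin n → ℂ | ∀ l : Fin m, ∀ i j,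
        ‖z l i j - ⟪v i, T l (v j)⟫_ℂ‖ < δ} := by
        simp only [Set.setOf_forall]
        refine isOpen_iInter_of_finite fun l => isOpen_iInter_of_finite fun i =>
          isOpen_iInter_of_finite fun j => ?_
        exact isOpen_lt (by fun_prop) continuous_const
      refine ho.mem_nhds ?_
      intro l i j
      simpa using hδ)
    refine ⟨w.1, w.2, fun i => ?_, fun l hl i j => hz ⟨l, hl⟩ i j⟩
    simp only [Set.mem_iUnion]
    exact ⟨n, w, hw, i, rfl⟩

theorem exists_inv {ι : Type*} [Countable ι] (g : ι → K →L[ℂ] K) {Ξ : Set K} (hΞ : Ξ.Countable) :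
    ∃ L : Submodule ℂ K, IsClosed (L : Set K) ∧ TopologicalSpace.IsSeparable (L : Set K) ∧ Ξ ⊆ L ∧
      ∀ i, ∀ x ∈ L, g i x ∈ L := by
  have : Countable Ξ := hΞ.to_subtype
  set R : Set K := Set.range (fun p : List ι × Ξ => (p.1.map g).prod p.2.1) with hR
  refine ⟨(Submodule.span ℂ R).topologicalClosure, Submodule.isClosed_topologicalClosure _,
    ?_, ?_, ?_⟩
  · rw [Submodule.topologicalClosure_coe]
    exact ((Set.countable_range _).isSeparable.span (R := ℂ)).closure
  · intro x hx
    refine Submodule.le_topologicalClosure _ (Submodule.subset_span ⟨([], ⟨x, hx⟩), ?_⟩)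
    simp
  · intro i
    have h1 : ∀ x ∈ Submodule.span ℂ R, g i x ∈ Submodule.span ℂ R := by
      intro x hx
      have : Submodule.span ℂ R ≤ (Submodule.span ℂ R).comap (g i).toLinearMap := by
        rw [Submodule.span_le]
        rintro _ ⟨⟨l, x⟩, rfl⟩
        exact Submodule.subset_span ⟨(i :: l, x), by simp⟩
      exact this hx
    intro x hx
    exact map_mem_closure (g i).continuous hx h1

end Rich

end CalkinUniv

namespace CalkinUniv

open scoped InnerProductSpace InnerProduct Topology
open ContinuousLinearMap Filter

section Rich2

variable {A : Type*} [NonUnitalCStarAlgebra A]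
variable {K : Type*} [NormedAddCommGroup K] [InnerProductSpace ℂ K] [CompleteSpace K]

theorem sum_form_bound {n : ℕ} (T : K →L[ℂ] K) (v w : Fin n → K) (x y : Fin n → ℂ) {δ cx cy : ℝ}
    (hδ : 0 ≤ δ) (hcx : 0 ≤ cx)
    (hx : ∀ i, ‖x i‖ ≤ cx) (hy : ∀ i, ‖y i‖ ≤ cy)
    (h : ∀ i j, ‖⟪w i, T (w j)⟫_ℂ - ⟪v i, T (v j)⟫_ℂ‖ ≤ δ) :
    ‖⟪∑ i, x i • w i, T (∑ i, y i • w i)⟫_ℂ - ⟪∑ i, x i • v i, T (∑ i, y i • v i)⟫_ℂ‖ ≤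
      (n * n * δ) * cx * cy := by
  have e : ∀ w : Fin n → K, ⟪∑ i, x i • w i, T (∑ i, y i • w i)⟫_ℂ =
      ∑ i, ∑ j, starRingEnd ℂ (x i) * (y j * ⟪w i, T (w j)⟫_ℂ) := by
    intro w
    rw [sum_inner]
    refine Finset.sum_congr rfl fun i _ => ?_
    rw [map_sum, inner_sum]
    refine Finset.sum_congr rfl fun j _ => ?_
    rw [map_smul, inner_smul_left, inner_smul_right]
  rw [e, e, ← Finset.sum_sub_distrib]
  have : (n * n * δ) * cx * cy = ∑ i : Fin n, ∑ j : Fin n, cx * (cy * δ) := by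
    simp; ring
  rw [this]
  refine norm_sum_le_of_le _ fun i _ => ?_
  rw [← Finset.sum_sub_distrib]
  refine norm_sum_le_of_le _ fun j _ => ?_
  rw [← mul_sub, ← mul_sub, norm_mul, norm_mul, RCLike.norm_conj]
  have := hx i
  have := hy j
  have := h i j
  have : 0 ≤ cy := (norm_nonneg _).trans (hy j)
  gcongr
  

theorem exists_rich (𝓜 : Model A K) (E : NonUnitalStarSubalgebra ℂ A) (b : ℕ → A)
    (hbE : ∀ i, b i ∈ E) (hb : ∀ a ∈ E, ∀ ε > 0, ∃ i, ‖a - b i‖ < ε) :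
    ∃ (L : Submodule ℂ K) (_ : CompleteSpace L) (_ : TopologicalSpace.SeparableSpace L)
      (ρ : A → L →L[ℂ] L), Good 𝓜 E ρ := by
  classical
  obtain ⟨Ξ, hΞ, hrich⟩ := rich_vectors (fun l => 𝓜.π (b l))
  obtain ⟨L, hLc, hLs, hΞL, hinv⟩ := exists_inv (Sum.elim (fun l => 𝓜.π (b l)) 𝓜.s) hΞ
  have hLC : CompleteSpace L := hLc.completeSpace_coe
  have hLS : TopologicalSpace.SeparableSpace L := hLs.separableSpace
  have hπn : ∀ a, ‖𝓜.π a‖ ≤ ‖a‖ := fun a => NonUnitalStarAlgHom.norm_apply_le 𝓜.π a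
  have hπ : ∀ a ∈ E, ∀ x ∈ L, 𝓜.π a x ∈ L := by
    intro a ha x hx
    have : 𝓜.π a x ∈ closure (L : Set K) := by
      rw [Metric.mem_closure_iff]
      intro ε hε
      obtain ⟨i, hi⟩ := hb a ha (ε / (‖x‖ + 1)) (by positivity)
      refine ⟨𝓜.π (b i) x, hinv (Sum.inl i) x hx, ?_⟩
      rw [dist_eq_norm, ← sub_apply, ← map_sub]
      refine ((𝓜.π (a - b i)).le_of_opNorm_le (hπn _) x).trans_lt ?_
      rw [lt_div_iff₀ (by positivity)] at hi
      nlinarith [norm_nonneg (a - b i), norm_nonneg x]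
    rwa [hLc.closure_eq] at this
  set incl : L →L[ℂ] K := L.subtypeL with hincl
  have hi : ∀ x y : L, ⟪incl x, incl y⟫_ℂ = ⟪x, y⟫_ℂ := fun x y => rfl
  have hin : ∀ x : L, ‖incl x‖ = ‖x‖ := fun x => rfl
  have hinj : ∀ x y : L, incl x = incl y → x = y := fun x y h => Subtype.ext h
  have hia : ∀ x : L, (incl†) (incl x) = x := by
    intro x
    refine ext_inner_left ℂ fun y => ?_
    rw [adjoint_inner_right, hi]
  have hai : ∀ z ∈ L, incl ((incl†) z) = z := by
    intro z hz
    have := hia ⟨z, hz⟩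
    exact congrArg incl this
  set ρ : A → L →L[ℂ] L := fun a => incl† ∘L 𝓜.π a ∘L incl with hρ
  have hρi : ∀ a x y, ⟪x, ρ a y⟫_ℂ = ⟪incl x, 𝓜.π a (incl y)⟫_ℂ := by
    intro a x y
    simp only [hρ, comp_apply, adjoint_inner_right]
  have hρE : ∀ a ∈ E, ∀ x, incl (ρ a x) = 𝓜.π a (incl x) := by
    intro a ha x
    simp only [hρ, comp_apply]
    exact hai _ (hπ a ha _ x.2)
  have hrep : IsRep E ρ := by
    constructor
    · intro a ha b hb; ext x; simp [hρ]
    · intro c a ha; ext x; simp [hρ]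
    · intro a ha c hc
      ext1 x
      apply hinj
      rw [hρE _ (E.mul_mem ha hc), mul_ap, hρE a ha, hρE c hc, map_mul, mul_ap]
    · intro a ha
      simp only [hρ, map_star, star_eq_adjoint, adjoint_comp, adjoint_adjoint, comp_assoc]
    · intro a ha
      refine opNorm_le_bound _ (norm_nonneg _) fun x => ?_
      rw [← hin, hρE a ha, ← hin]
      exact (𝓜.π a).le_of_opNorm_le (hπn a) _
  have hw1 : WApp (E : Set A) 𝓜.π ρ := by
    intro X hX F hF ε hε
    refine ⟨incl, fun x _ y _ => hi x y, fun a ha x _ y _ => ?_⟩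
    rw [hρi, sub_self, norm_zero]; positivity
  have hw2 : WApp (E : Set A) ρ 𝓜.π := by
    intro X hX F hF ε hε
    have hch : ∀ a : A, ∃ l, a ∈ F → ‖a - b l‖ < ε / 3 := by
      intro a
      by_cases ha : a ∈ F
      · obtain ⟨l, hl⟩ := hb a (hF a ha) (ε / 3) (by positivity)
        exact ⟨l, fun _ => hl⟩
      · exact ⟨0, fun h => absurd h ha⟩
    choose l hl using hch
    set n := Module.finrank ℂ X with hn
    let v := stdOrthonormalBasis ℂ X
    have hv : Orthonormal ℂ (fun i => (v i : K)) := by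
      have := v.orthonormal
      exact this.comp_linearIsometry X.subtypeₗᵢ
    set δ := ε / (3 * (n * n + 1)) with hδ
    have hδ0 : 0 < δ := by positivity
    have hnδ : n * n * δ ≤ ε / 3 := by
      rw [hδ, mul_div_assoc', div_le_div_iff₀ (by positivity) (by positivity)]
      nlinarith
    obtain ⟨w, hw, hwΞ, hwd⟩ := hrich n _ hv (F.sup l + 1) δ hδ0
    let w' : Fin n → L := fun i => ⟨w i, hΞL (hwΞ i)⟩
    let W : K →L[ℂ] L := ∑ i, (innerSL ℂ ((v i : X) : K)).smulRight (w' i)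
    have hW : ∀ x, W x = ∑ i, ⟪((v i : X) : K), x⟫_ℂ • w' i := by
      intro x; simp [W, sum_apply]
    have hW2 : ∀ x, incl (W x) = ∑ i, ⟪((v i : X) : K), x⟫_ℂ • w i := by
      intro x; rw [hW, map_sum]; rfl
    have hX2 : ∀ x ∈ X, x = ∑ i, ⟪((v i : X) : K), x⟫_ℂ • ((v i : X) : K) := by
      intro x hx
      have := congrArg (Subtype.val) (v.sum_repr' ⟨x, hx⟩)
      refine this.symm.trans ?_
      simp
    have hiso : ∀ x ∈ X, ∀ y ∈ X, ⟪W x, W y⟫_ℂ = ⟪x, y⟫_ℂ := by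
      intro x hx y hy
      rw [← hi, hW2, hW2, hw.inner_sum]
      conv_rhs => rw [hX2 x hx, hX2 y hy, hv.inner_sum]
    have hco : ∀ x (i : Fin n), ‖⟪((v i : X) : K), x⟫_ℂ‖ ≤ ‖x‖ := by
      intro x i
      have := norm_inner_le_norm (𝕜 := ℂ) ((v i : X) : K) x
      rwa [show ‖((v i : X) : K)‖ = 1 from hv.1 i, one_mul] at this
    refine ⟨W, hiso, ?_⟩
    intro a ha x hx y hy
    have h1 : ‖⟪W x, ρ (b (l a)) (W y)⟫_ℂ - ⟪x, 𝓜.π (b (l a)) y⟫_ℂ‖ ≤ ε / 3 * ‖x‖ * ‖y‖ := by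
      rw [hρi, hW2, hW2]
      have hle : l a < F.sup l + 1 := Nat.lt_succ_of_le (Finset.le_sup ha)
      have := sum_form_bound (𝓜.π (b (l a))) (fun i => ((v i : X) : K)) w
        (fun i => ⟪((v i : X) : K), x⟫_ℂ) (fun i => ⟪((v i : X) : K), y⟫_ℂ) hδ0.le (norm_nonneg x)
        (hco x) (hco y) (fun i j => (hwd (l a) hle i j).le)
      beta_reduce at this
      rw [← hX2 x hx, ← hX2 y hy] at this
      refine this.trans ?_
      gcongr
    have h2 : ‖⟪W x, ρ a (W y)⟫_ℂ - ⟪W x, ρ (b (l a)) (W y)⟫_ℂ‖ ≤ ε / 3 * ‖x‖ * ‖y‖ := by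
      rw [hρi, hρi, ← inner_sub_right, ← sub_apply, ← map_sub]
      refine (norm_inner_le_norm _ _).trans ?_
      have e1 : ‖incl (W x)‖ = ‖x‖ := norm_eq_of_isom hiso hx
      have e2 : ‖incl (W y)‖ = ‖y‖ := norm_eq_of_isom hiso hy
      have := (𝓜.π (a - b (l a))).le_of_opNorm_le ((hπn _).trans (hl a ha).le) (incl (W y))
      rw [e2] at this
      rw [e1]
      nlinarith [norm_nonneg x]
    have h3 : ‖⟪x, 𝓜.π a y⟫_ℂ - ⟪x, 𝓜.π (b (l a)) y⟫_ℂ‖ ≤ ε / 3 * ‖x‖ * ‖y‖ := by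
      rw [← inner_sub_right, ← sub_apply, ← map_sub]
      refine (norm_inner_le_norm _ _).trans ?_
      have := (𝓜.π (a - b (l a))).le_of_opNorm_le ((hπn _).trans (hl a ha).le) y
      nlinarith [norm_nonneg x]
    calc _ = ‖(⟪W x, ρ a (W y)⟫_ℂ - ⟪W x, ρ (b (l a)) (W y)⟫_ℂ) +
          (⟪W x, ρ (b (l a)) (W y)⟫_ℂ - ⟪x, 𝓜.π (b (l a)) y⟫_ℂ) -
          (⟪x, 𝓜.π a y⟫_ℂ - ⟪x, 𝓜.π (b (l a)) y⟫_ℂ)‖ := by congr 1; ring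
      _ ≤ _ := norm_sub_le _ _
      _ ≤ _ := add_le_add (norm_add_le _ _) le_rfl
      _ ≤ _ := by linarith
  refine ⟨L, hLC, hLS, ρ, hrep, ?_, hw1⟩
  have hsL : ∀ j (x : L), incl ((incl†) (𝓜.s j (incl x))) = 𝓜.s j (incl x) := fun j x =>
    hai _ (hinv (Sum.inr j) _ x.2)
  refine App.of_wapp hw2 (fun j => incl† ∘L 𝓜.s j ∘L incl) ?_ ?_ ?_
  · intro j x y
    rw [← hi]
    simp only [comp_apply, hsL, 𝓜.s1, hi]
  · intro i j hij x y
    rw [← hi]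
    simp only [comp_apply, hsL, 𝓜.s2 i j hij]
  · intro a ha j x
    apply hinj
    rw [hρE a ha]
    simp only [comp_apply, hsL, 𝓜.s3]
    rw [← hρE a ha]

end Rich2

end CalkinUniv

namespace CalkinUniv

open scoped InnerProductSpace InnerProduct Topology
open ContinuousLinearMap Filter

section Steps

variable {A : Type*} [NonUnitalCStarAlgebra A]
variable {H H' K : Type*} [NormedAddCommGroup H] [InnerProductSpace ℂ H] [CompleteSpace H]
  [NormedAddCommGroup H'] [InnerProductSpace ℂ H'] [CompleteSpace H']
  [NormedAddCommGroup K] [InnerProductSpace ℂ K] [CompleteSpace K]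

def Sep (E : NonUnitalStarSubalgebra ℂ A) : Prop :=
  ∃ b : ℕ → A, (∀ i, b i ∈ E) ∧ ∀ a ∈ E, ∀ ε > 0, ∃ i, ‖a - b i‖ < ε

theorem extend [TopologicalSpace.SeparableSpace H] (𝓜 : Model A K)
    {E E' : NonUnitalStarSubalgebra ℂ A} (hE : E ≤ E') (hs : Sep E) (hs' : Sep E')
    {Φ : A → H →L[ℂ] H} (hΦ : Good 𝓜 E Φ) :
    ∃ Φ' : A → H →L[ℂ] H, Good 𝓜 E' Φ' ∧ Kapp (E : Set A) Φ Φ' := by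
  obtain ⟨b, hb1, hb2⟩ := hs
  obtain ⟨b', hb1', hb2'⟩ := hs'
  obtain ⟨L, hL1, hL2, ρ, hρ⟩ := exists_rich 𝓜 E' b' hb1' hb2'
  have hρE := hρ.mono hE
  obtain ⟨U, h1, h2, h3⟩ := two_sided hΦ.rep hρE.rep b hb1 hb2 (hΦ.app.trans hρE.wapp)
    (hρE.app.trans hΦ.wapp)
  exact ⟨conj U ρ, hρ.conj U h1 h2, h3⟩

theorem isom_of_orthonormal (X : Submodule ℂ H') [FiniteDimensional ℂ X]
    (w : Fin (Module.finrank ℂ X) → H) (hw : Orthonormal ℂ w) : ∃ W : H' →L[ℂ] H,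
      (∀ x ∈ X, ∀ y ∈ X, ⟪W x, W y⟫_ℂ = ⟪x, y⟫_ℂ) ∧ ∀ x, W x ∈ Submodule.span ℂ (Set.range w) := by
  let v := stdOrthonormalBasis ℂ X
  have hv : Orthonormal ℂ (fun i => (v i : H')) := by
    have := v.orthonormal
    exact this.comp_linearIsometry X.subtypeₗᵢ
  let W : H' →L[ℂ] H := ∑ i, (innerSL ℂ ((v i : X) : H')).smulRight (w i)
  have hW : ∀ x, W x = ∑ i, ⟪((v i : X) : H'), x⟫_ℂ • w i := by
    intro x; simp [W, sum_apply]
  have hX2 : ∀ x ∈ X, x = ∑ i, ⟪((v i : X) : H'), x⟫_ℂ • ((v i : X) : H') := by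
    intro x hx
    have := congrArg (Subtype.val) (v.sum_repr' ⟨x, hx⟩)
    refine this.symm.trans ?_
    simp
  refine ⟨W, ?_, ?_⟩
  · intro x hx y hy
    rw [hW, hW, hw.inner_sum]
    conv_rhs => rw [hX2 x hx, hX2 y hy, hv.inner_sum]
  · intro x
    rw [hW]
    exact Submodule.sum_mem _ fun i _ => Submodule.smul_mem _ _ (Submodule.subset_span ⟨i, rfl⟩)

theorem exists_orthonormal (hM : ¬ FiniteDimensional ℂ H) (n : ℕ) :
    ∃ w : Fin n → H, Orthonormal ℂ w := by
  have h : (n : Cardinal) ≤ Module.rank ℂ H := by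
    have : Cardinal.aleph0 ≤ Module.rank ℂ H := by
      by_contra h
      exact hM (Module.rank_lt_aleph0_iff.1 (not_le.1 h))
    exact (Cardinal.natCast_lt_aleph0).le.trans this
  obtain ⟨s, hs, hl⟩ := exists_finset_linearIndependent_of_le_rank h
  have hf : Module.finrank ℂ (Submodule.span ℂ (s : Set H)) = n := by
    rw [finrank_span_finset_eq_card hl, hs]
  have : FiniteDimensional ℂ (Submodule.span ℂ (s : Set H)) :=
    FiniteDimensional.span_finset ℂ s
  let v := (stdOrthonormalBasis ℂ (Submodule.span ℂ (s : Set H))).reindex (finCongr hf)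
  refine ⟨fun i => (v i : H), ?_⟩
  exact v.orthonormal.comp_linearIsometry (Submodule.subtypeₗᵢ _)

theorem exists_isom (hM : ¬ FiniteDimensional ℂ H) (X : Submodule ℂ H') [FiniteDimensional ℂ X]
    (N : Submodule ℂ H) [FiniteDimensional ℂ N] : ∃ W : H' →L[ℂ] H,
      (∀ x ∈ X, ∀ y ∈ X, ⟪W x, W y⟫_ℂ = ⟪x, y⟫_ℂ) ∧ ∀ x ∈ X, ∀ ν ∈ N, ⟪ν, W x⟫_ℂ = 0 := by
  have hM' : ¬ FiniteDimensional ℂ Nᗮ := by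
    intro h
    apply hM
    have : FiniteDimensional ℂ (N ⊔ Nᗮ : Submodule ℂ H) := Submodule.finiteDimensional_sup _ _
    rw [Submodule.sup_orthogonal_of_hasOrthogonalProjection] at this
    exact Module.Finite.equiv (Submodule.topEquiv (R := ℂ) (M := H))
  obtain ⟨w, hw⟩ := exists_orthonormal hM' (Module.finrank ℂ X)
  obtain ⟨W, h1, h2⟩ := isom_of_orthonormal X (fun i => (w i : H))
    (hw.comp_linearIsometry (Submodule.subtypeₗᵢ _))
  refine ⟨W, h1, fun x hx ν hν => ?_⟩
  have : Submodule.span ℂ (Set.range fun i => (w i : H)) ≤ Nᗮ := by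
    rw [Submodule.span_le]; rintro _ ⟨i, rfl⟩; exact (w i).2
  exact (Submodule.mem_orthogonal _ _).1 (this (h2 x)) ν hν

theorem Model.infinite [Nontrivial A] (𝓜 : Model A K) : ¬ FiniteDimensional ℂ K := by
  have hK : Nontrivial K := by
    by_contra h
    rw [not_nontrivial_iff_subsingleton] at h
    obtain ⟨a, ha⟩ := exists_ne (0 : A)
    exact ha (𝓜.inj (by ext x; exact Subsingleton.elim _ _))
  obtain ⟨ξ, hξ⟩ := exists_norm_eq K (zero_le_one)
  have ho : Orthonormal ℂ (fun j => 𝓜.s j ξ) := by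
    rw [orthonormal_iff_ite]
    intro i j
    split_ifs with h
    · subst h; rw [𝓜.s1, inner_self_eq_norm_sq_to_K, hξ]; simp
    · exact 𝓜.s2 i j h _ _
  intro h
  have := ho.linearIndependent.finite
  exact not_finite ℕ

theorem good_bot [Nontrivial A] (𝓜 : Model A K) (hH : ¬ FiniteDimensional ℂ H) :
    Good 𝓜 ⊥ (fun _ => (0 : H →L[ℂ] H)) := by
  have hb : ∀ a : A, a ∈ (((⊥ : NonUnitalStarSubalgebra ℂ A)) : Set A) → a = 0 := fun a ha => by
    simpa using ha
  refine ⟨⟨by simp, by simp, by simp, by simp, by simp⟩, ?_, ?_⟩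
  · intro X hX _ F hF ε hε N hN
    obtain ⟨W, h1, h2⟩ := exists_isom (H := H) hH X N
    refine ⟨W, h1, h2, fun a ha x hx y hy => ?_⟩
    rw [hb a (hF a ha)]
    simp; positivity
  · intro X hX F hF ε hε 
    obtain ⟨W, h1, h2⟩ := exists_isom (H := K) 𝓜.infinite X ⊥
    refine ⟨W, h1, fun a ha x hx y hy => ?_⟩
    rw [hb a (hF a ha)]
    simp; positivity

end Steps

end CalkinUniv

namespace CalkinUniv

open scoped InnerProductSpace InnerProduct Topology
open ContinuousLinearMap Filter

section Limit

variable {A : Type*} [NonUnitalCStarAlgebra A]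
variable {H K : Type*} [NormedAddCommGroup H] [InnerProductSpace ℂ H] [CompleteSpace H]
  [NormedAddCommGroup K] [InnerProductSpace ℂ K] [CompleteSpace K]

theorem limit_step (𝓜 : Model A K) (E : ℕ → NonUnitalStarSubalgebra ℂ A) (hmono : Monotone E)
    (hsep : ∀ k, Sep (E k)) (Φ : ℕ → A → H →L[ℂ] H) (hg : ∀ k, Good 𝓜 (E k) (Φ k))
    (hK : ∀ k, Kapp (E k : Set A) (Φ k) (Φ (k + 1))) (E' : NonUnitalStarSubalgebra ℂ A)
    (hE' : ∀ a, a ∈ E' ↔ ∃ k, a ∈ E k) :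
    ∃ Φ' : A → H →L[ℂ] H, Good 𝓜 E' Φ' ∧ ∀ k, Kapp (E k : Set A) (Φ k) Φ' := by
  classical
  choose b hbE hb using hsep
  let F : ℕ → Finset A := fun k =>
    ((Finset.range (k + 1)) ×ˢ (Finset.range (k + 1))).image (fun p => b p.1 p.2)
  have hF : ∀ k, ∀ a ∈ F k, a ∈ E k := by
    intro k a ha
    simp only [F, Finset.mem_image, Finset.mem_product, Finset.mem_range] at ha
    obtain ⟨p, ⟨h1, h2⟩, rfl⟩ := ha
    exact hmono (by omega) (hbE p.1 p.2)
  have hF2 : ∀ i j k, i ≤ k → j ≤ k → b i j ∈ F k := by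
    intro i j k hi hj
    simp only [F, Finset.mem_image, Finset.mem_product, Finset.mem_range]
    exact ⟨(i, j), ⟨by simpa using by omega, by simpa using by omega⟩, rfl⟩
  have hv := fun k => hK k (F k) (hF k) ((1 / 2) ^ k) (by positivity)
  choose v v1 v2 v3 v4 using hv
  let u : ℕ → H →L[ℂ] H := fun k => Nat.rec 1 (fun k w => w * v k) k
  have hu : ∀ k, u (k + 1) = u k * v k := fun k => rfl
  have u1 : ∀ k, star (u k) * u k = 1 := by
    intro k
    induction k with
    | zero => simp [u]
    | succ k ih => rw [hu, star_mul, mul_assoc, ← mul_assoc (star (u k)), ih, one_mul, v1]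
  have u2 : ∀ k, u k * star (u k) = 1 := by
    intro k
    induction k with
    | zero => simp [u]
    | succ k ih => rw [hu, star_mul, mul_assoc, ← mul_assoc (v k), v2, one_mul, ih]
  have u3 : ∀ k, Cpt (u k - 1) := by
    intro k
    induction k with
    | zero => simpa [u] using Cpt.zero
    | succ k ih =>
      have : u (k + 1) - 1 = u k * (v k - 1) + (u k - 1) := by rw [hu]; noncomm_ring
      rw [this]
      exact ((v3 k).comp_left (u k)).add ih
  let Ψ : ℕ → A → H →L[ℂ] H := fun k => conj (u k) (Φ k)
  have hΨ : ∀ k a, Ψ k a = u k * Φ k a * star (u k) := fun k a => by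
    simp only [Ψ, conj, star_eq_adjoint]; rfl
  have hΨg : ∀ k, Good 𝓜 (E k) (Ψ k) := fun k => (hg k).conj (u k) (u1 k) (u2 k)
  have hstep : ∀ k, ∀ a ∈ F k, ‖Ψ (k + 1) a - Ψ k a‖ ≤ (1 / 2) ^ k := by
    intro k a ha
    have e : Ψ (k + 1) a - Ψ k a =
        u k * (v k * Φ (k + 1) a * star (v k) - Φ k a) * star (u k) := by
      rw [hΨ k, hΨ (k + 1), hu, star_mul]; noncomm_ring
    rw [e]
    exact (norm_conj_le (u1 k)).trans (v4 k a ha)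
  have hcb : ∀ i j, CauchySeq (fun k => Ψ k (b i j)) := by
    intro i j
    rw [← cauchySeq_shift (max i j)]
    refine cauchySeq_of_le_geometric (1 / 2) 1 (by norm_num) fun k => ?_
    rw [dist_comm, dist_eq_norm, one_mul]
    have := hstep (k + max i j) (b i j) (hF2 i j _ (by omega) (by omega))
    rw [show k + 1 + max i j = k + max i j + 1 by omega]
    refine this.trans ?_
    exact pow_le_pow_of_le_one (by norm_num) (by norm_num) (by omega)
  have hc : ∀ a ∈ E', CauchySeq (fun k => Ψ k a) := by
    intro a ha
    obtain ⟨i, hi⟩ := (hE' a).1 ha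
    rw [Metric.cauchySeq_iff']
    intro ε hε
    obtain ⟨j, hj⟩ := hb i a hi (ε / 3) (by positivity)
    obtain ⟨N, hN⟩ := Metric.cauchySeq_iff'.1 (hcb i j) (ε / 3) (by positivity)
    obtain ⟨N, hN⟩ : ∃ N, ∀ n ≥ N, i ≤ n ∧ dist (Ψ n (b i j)) (Ψ N (b i j)) < ε / 3 := by
      have := Metric.cauchySeq_iff.1 (hcb i j) (ε / 3) (by positivity)
      obtain ⟨N, hN⟩ := this
      exact ⟨max i N, fun n hn => ⟨by omega, hN n (by omega) _ (by omega)⟩⟩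
    refine ⟨N, fun n hn => ?_⟩
    have key : ∀ n, i ≤ n → ‖Ψ n a - Ψ n (b i j)‖ < ε / 3 := by
      intro n hn
      rw [← (hΨg n).rep.map_sub (hmono hn hi) (hmono hn (hbE i j))]
      exact ((hΨg n).rep.norm_le _ (sub_mem (hmono hn hi) (hmono hn (hbE i j)))).trans_lt hj
    have k1 := key n (hN n hn).1
    have k2 := key N (hN N le_rfl).1
    have k3 := (hN n hn).2
    rw [dist_eq_norm] at k3 ⊢
    calc ‖Ψ n a - Ψ N a‖ = ‖(Ψ n a - Ψ n (b i j)) + (Ψ n (b i j) - Ψ N (b i j)) -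
          (Ψ N a - Ψ N (b i j))‖ := by congr 1; abel
      _ ≤ _ := norm_sub_le _ _
      _ ≤ _ := add_le_add (norm_add_le _ _) le_rfl
      _ < ε := by linarith
  have hlim : ∀ a, ∃ T, a ∈ E' → Tendsto (fun k => Ψ k a) atTop (𝓝 T) := by
    intro a
    by_cases ha : a ∈ E'
    · obtain ⟨T, hT⟩ := cauchySeq_tendsto_of_complete (hc a ha)
      exact ⟨T, fun _ => hT⟩
    · exact ⟨0, fun h => absurd h ha⟩
  choose Φ' hΦ' using hlim
  have hev : ∀ a ∈ E', ∀ᶠ k in atTop, a ∈ E k := by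
    intro a ha
    obtain ⟨i, hi⟩ := (hE' a).1 ha
    filter_upwards [eventually_ge_atTop i] with k hk using hmono hk hi
  have hrep : IsRep E' Φ' := by
    constructor
    · intro a ha c hc
      refine tendsto_nhds_unique_of_eventuallyEq (hΦ' _ (E'.add_mem ha hc))
        ((hΦ' a ha).add (hΦ' c hc)) ?_
      filter_upwards [hev a ha, hev c hc] with k h1 h2 using (hΨg k).rep.map_add a h1 c h2
    · intro c a ha
      refine tendsto_nhds_unique_of_eventuallyEq (hΦ' _ (SMulMemClass.smul_mem c ha))
        ((hΦ' a ha).const_smul c) ?_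
      filter_upwards [hev a ha] with k h1 using (hΨg k).rep.map_smul c a h1
    · intro a ha c hc
      refine tendsto_nhds_unique_of_eventuallyEq (hΦ' _ (E'.mul_mem ha hc))
        ((hΦ' a ha).mul (hΦ' c hc)) ?_
      filter_upwards [hev a ha, hev c hc] with k h1 h2 using (hΨg k).rep.map_mul a h1 c h2
    · intro a ha
      refine tendsto_nhds_unique_of_eventuallyEq (hΦ' _ (star_mem ha))
        ((hΦ' a ha).star) ?_
      filter_upwards [hev a ha] with k h1 using (hΨg k).rep.map_star a h1
    · intro a ha
      refine le_of_tendsto (hΦ' a ha).norm ?_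
      filter_upwards [hev a ha] with k h1 using (hΨg k).rep.norm_le a h1
  have happ : ∀ G : Finset A, (∀ a ∈ G, a ∈ E') → ∀ ε > 0, ∀ m, ∃ k, m ≤ k ∧ (∀ a ∈ G, a ∈ E k) ∧
      ∀ a ∈ G, ‖Ψ k a - Φ' a‖ ≤ ε := by
    intro G hG ε hε m
    have h1 : ∀ᶠ k in atTop, ∀ a ∈ G, a ∈ E k :=
      (Filter.eventually_all_finset G).2 fun a ha => hev a (hG a ha)
    have h2 : ∀ᶠ k in atTop, ∀ a ∈ G, ‖Ψ k a - Φ' a‖ ≤ ε := by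
      refine (Filter.eventually_all_finset G).2 fun a ha => ?_
      have := Metric.tendsto_nhds.1 (hΦ' a (hG a ha)) ε hε
      filter_upwards [this] with k hk
      rw [← dist_eq_norm]; exact hk.le
    obtain ⟨k, a1, a2, a3⟩ := (h1.and (h2.and (eventually_ge_atTop m))).exists
    exact ⟨k, a3, a1, a2⟩
  refine ⟨Φ', ⟨hrep, ?_, ?_⟩, ?_⟩
  · refine App.approx fun G hG ε hε => ?_
    obtain ⟨k, -, h1, h2⟩ := happ G hG ε hε 0
    exact ⟨Ψ k, (hΨg k).app.mono h1 le_rfl, h2⟩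
  · refine WApp.approx fun G hG ε hε => ?_
    obtain ⟨k, -, h1, h2⟩ := happ G hG ε hε 0
    exact ⟨Ψ k, (hΨg k).wapp.mono h1, h2⟩
  · intro m
    have hKm : ∀ k, m ≤ k → Kapp (E m : Set A) (Φ m) (Φ k) := by
      intro k hk
      induction k, hk using Nat.le_induction with
      | base => exact Kapp.refl _ _
      | succ k hk ih => exact ih.trans ((hK k).mono (hmono hk))
    refine Kapp.symm (Kapp.of_limit fun G hG ε hε => ?_)
    obtain ⟨k, hmk, h1, h2⟩ := happ G (fun a ha => (hE' a).2 ⟨m, hG a ha⟩) ε hε m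
    refine ⟨Ψ k, Kapp.trans ?_ (hKm k hmk).symm, h2⟩
    intro G' hG' ε' hε'
    refine ⟨u k, u1 k, u2 k, u3 k, fun a _ => ?_⟩
    rw [hΨ, sub_self, norm_zero]; exact hε'.le

end Limit

end CalkinUniv

namespace CalkinUniv

open scoped InnerProductSpace InnerProduct Topology
open ContinuousLinearMap Filter

section Chain

theorem general_rec {I β : Type*} [LinearOrder I] [WellFoundedLT I] [Nonempty β]
    (G : I → β → Prop) (R : I → β → β → Prop)
    (step : ∀ x (f : I → β), (∀ y < x, G y (f y)) → (∀ y < x, ∀ z < y, R z (f z) (f y)) →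
      ∃ g, G x g ∧ ∀ y < x, R y (f y) g) :
    ∃ Φ : I → β, ∀ x, G x (Φ x) ∧ ∀ y < x, R y (Φ y) (Φ x) := by
  classical
  let ext : ∀ x : I, (∀ y, y < x → β) → I → β := fun x f y =>
    if h : y < x then f y h else Classical.arbitrary β
  let P : ∀ x : I, (I → β) → β → Prop := fun x f g => G x g ∧ ∀ y < x, R y (f y) g
  let rec1 : ∀ x : I, (∀ y, y < x → β) → β := fun x f =>
    Classical.epsilon (P x (ext x f))
  let Φ : I → β := (wellFounded_lt (α := I)).fix rec1
  have hΦ : ∀ x, Φ x = Classical.epsilon (P x (ext x fun y _ => Φ y)) := fun x =>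
    (wellFounded_lt (α := I)).fix_eq rec1 x
  refine ⟨Φ, fun x => ?_⟩
  induction x using WellFoundedLT.induction with
  | _ x ih =>
  have he : ∀ y < x, ext x (fun y _ => Φ y) y = Φ y := fun y hy => by simp [ext, hy]
  obtain hg := step x (ext x fun y _ => Φ y)
    (fun y hy => by rw [he y hy]; exact (ih y hy).1)
    (fun y hy z hz => by rw [he y hy, he z (hz.trans hy)]; exact (ih y hy).2 z hz)
  have h2 : P x (ext x fun y _ => Φ y) (Φ x) := by
    rw [hΦ x]; exact Classical.epsilon_spec hg
  exact ⟨h2.1, fun y hy => by rw [← he y hy]; exact h2.2 y hy⟩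

variable {A : Type*} [NonUnitalCStarAlgebra A]
variable {H K : Type*} [NormedAddCommGroup H] [InnerProductSpace ℂ H] [CompleteSpace H]
  [NormedAddCommGroup K] [InnerProductSpace ℂ K] [CompleteSpace K]

theorem sep_bot : Sep (⊥ : NonUnitalStarSubalgebra ℂ A) :=
  ⟨fun _ => 0, fun _ => zero_mem _, fun a ha ε hε => ⟨0, by
    have : a = 0 := NonUnitalStarAlgebra.mem_bot.1 ha
    simpa [this] using hε⟩⟩

theorem exists_union (E : ℕ → NonUnitalStarSubalgebra ℂ A) (hmono : Monotone E) :
    ∃ E' : NonUnitalStarSubalgebra ℂ A, ∀ a, a ∈ E' ↔ ∃ k, a ∈ E k := by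
  refine ⟨{ carrier := {a | ∃ k, a ∈ E k}, add_mem' := ?_, zero_mem' := ⟨0, zero_mem _⟩,
            mul_mem' := ?_, smul_mem' := ?_, star_mem' := ?_ }, fun a => Iff.rfl⟩
  · rintro a b ⟨i, hi⟩ ⟨j, hj⟩
    exact ⟨max i j, add_mem (hmono (le_max_left i j) hi) (hmono (le_max_right i j) hj)⟩
  · rintro a b ⟨i, hi⟩ ⟨j, hj⟩
    exact ⟨max i j, mul_mem (hmono (le_max_left i j) hi) (hmono (le_max_right i j) hj)⟩
  · rintro c a ⟨i, hi⟩
    exact ⟨i, SMulMemClass.smul_mem c hi⟩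
  · rintro a ⟨i, hi⟩
    exact ⟨i, star_mem hi⟩

theorem sep_union (E : ℕ → NonUnitalStarSubalgebra ℂ A) (hsep : ∀ k, Sep (E k))
    {E' : NonUnitalStarSubalgebra ℂ A} (h : ∀ a, a ∈ E' ↔ ∃ k, a ∈ E k) : Sep E' := by
  choose b hbE hb using hsep
  refine ⟨fun n => b n.unpair.1 n.unpair.2, fun n => (h _).2 ⟨_, hbE _ _⟩, fun a ha ε hε => ?_⟩
  obtain ⟨k, hk⟩ := (h a).1 ha
  obtain ⟨i, hi⟩ := hb k a hk ε hε
  exact ⟨Nat.pair k i, by simpa using hi⟩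

theorem chain [TopologicalSpace.SeparableSpace H] [Nontrivial A] (hH : ¬ FiniteDimensional ℂ H)
    (𝓜 : Model A K) {I : Type*} [LinearOrder I] [WellFoundedLT I]
    (hI : ∀ x : I, (Set.Iio x).Countable) (E : I → NonUnitalStarSubalgebra ℂ A) (hE : Monotone E)
    (hs : ∀ x, Sep (E x)) : ∃ Φ : I → A → H →L[ℂ] H,
      ∀ x, Good 𝓜 (E x) (Φ x) ∧ ∀ y < x, Kapp (E y : Set A) (Φ y) (Φ x) := by
  refine general_rec (fun x Φ => Good 𝓜 (E x) Φ) (fun y Φ Ψ => Kapp (E y : Set A) Φ Ψ) ?_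
  intro x f hf1 hf2
  by_cases hne : (Set.Iio x).Nonempty
  · have hne' : Nonempty (Set.Iio x) := hne.to_subtype
    have hc : Countable (Set.Iio x) := (hI x).to_subtype
    obtain ⟨e, he⟩ := exists_surjective_nat (Set.Iio x)
    let y : ℕ →o Set.Iio x := partialSups e
    have hEm : Monotone (fun k => E (y k)) := fun i j hij => hE (y.monotone hij)
    obtain ⟨E', hE'⟩ := exists_union (fun k => E (y k)) hEm
    have hK : ∀ i j : Set.Iio x, i ≤ j → Kapp (E i : Set A) (f i) (f j) := by
      intro i j hij
      rcases hij.lt_or_eq with h | h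
      · exact hf2 j j.2 i h
      · rw [h]; exact Kapp.refl _ _
    obtain ⟨Φ', hg, hk⟩ := limit_step 𝓜 (fun k => E (y k)) hEm (fun k => hs _) (fun k => f (y k))
      (fun k => hf1 _ (y k).2) (fun k => hK _ _ (y.monotone (Nat.le_succ k))) E' hE'
    have hle : E' ≤ E x := by
      intro a ha
      obtain ⟨k, hk⟩ := (hE' a).1 ha
      exact hE (le_of_lt (y k).2) hk
    obtain ⟨Φ'', hg', hk'⟩ := extend 𝓜 hle (sep_union (fun k => E (y k)) (fun k => hs _) hE') (hs x) hg
    refine ⟨Φ'', hg', fun z hz => ?_⟩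
    obtain ⟨k, hk2⟩ := he ⟨z, hz⟩
    have hzy : (⟨z, hz⟩ : Set.Iio x) ≤ y k := by
      rw [← hk2]; exact le_partialSups e k
    have h1 := hK ⟨z, hz⟩ (y k) hzy
    have h2 : E z ≤ E (y k) := hE hzy
    have h3 : E z ≤ E' := fun a ha => (hE' a).2 ⟨k, h2 ha⟩
    exact (h1.trans ((hk k).mono h2)).trans (hk'.mono h3)
  · obtain ⟨Φ', h1, h2⟩ := extend 𝓜 (bot_le : ⊥ ≤ E x) sep_bot (hs x) (good_bot (H := H) 𝓜 hH)
    refine ⟨Φ', h1, fun y hy => absurd ⟨y, hy⟩ hne⟩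

end Chain

end CalkinUniv

namespace CalkinUniv

open scoped InnerProductSpace InnerProduct Topology
open ContinuousLinearMap Filter

section Filtration

variable {A : Type} [NonUnitalCStarAlgebra A]

theorem countable_semigroup_closure {t : Set A} (ht : t.Countable) :
    ((Subsemigroup.closure t : Subsemigroup A) : Set A).Countable := by
  have : Countable t := ht.to_subtype
  let f : t × List t → A := fun p => (p.2.map Subtype.val).foldl (· * ·) p.1.1
  let S : Subsemigroup A :=
    { carrier := Set.range f
      mul_mem' := by
        rintro _ _ ⟨⟨a, l⟩, rfl⟩ ⟨⟨a', l'⟩, rfl⟩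
        refine ⟨(a, l ++ a' :: l'), ?_⟩
        simp only [f, List.map_append, List.foldl_append, List.map_cons, List.foldl_cons]
        exact List.foldl_assoc }
  have h : Subsemigroup.closure t ≤ S := by
    rw [Subsemigroup.closure_le]
    intro a ha
    exact ⟨(⟨a, ha⟩, []), rfl⟩
  exact (Set.countable_range f).mono h

theorem sep_closure_adjoin {t : Set A} (ht : t.Countable) :
    Sep (NonUnitalStarAlgebra.adjoin ℂ t).topologicalClosure := by
  have h1 : TopologicalSpace.IsSeparable
      ((NonUnitalStarAlgebra.adjoin ℂ t : NonUnitalStarSubalgebra ℂ A) : Set A) := by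
    have e := NonUnitalStarAlgebra.adjoin_eq_span (R := ℂ) t
    have e2 : ((NonUnitalStarAlgebra.adjoin ℂ t : NonUnitalStarSubalgebra ℂ A) : Set A) =
        (Submodule.span ℂ (Subsemigroup.closure (t ∪ star t) : Set A) : Set A) := by
      rw [← e]; rfl
    rw [e2]
    refine (Set.Countable.isSeparable (countable_semigroup_closure ?_)).span (R := ℂ)
    refine ht.union ?_
    rw [← Set.image_star]
    exact ht.image _
  have h2 : TopologicalSpace.IsSeparable
      (((NonUnitalStarAlgebra.adjoin ℂ t).topologicalClosure : NonUnitalStarSubalgebra ℂ A) : Set A) :=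
    h1.closure
  have h3 := h2.separableSpace
  set E := (NonUnitalStarAlgebra.adjoin ℂ t).topologicalClosure
  have hne : Nonempty (E : Set A) := ⟨⟨0, zero_mem E⟩⟩
  refine ⟨fun i => (TopologicalSpace.denseSeq (E : Set A) i).1, fun i => Subtype.coe_prop _, ?_⟩
  intro a ha ε hε
  obtain ⟨i, hi⟩ := (TopologicalSpace.denseRange_denseSeq (E : Set A)).exists_dist_lt ⟨a, ha⟩ hε
  refine ⟨i, ?_⟩
  rw [← dist_eq_norm]; exact hi

theorem exists_filtration (hA : ∃ s : Set A, Dense s ∧ #s ≤ Cardinal.aleph 1) :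
    ∃ (I : Type) (_ : LinearOrder I) (_ : WellFoundedLT I), (∀ x : I, (Set.Iio x).Countable) ∧
      ∃ E : I → NonUnitalStarSubalgebra ℂ A, Monotone E ∧ (∀ x, Sep (E x)) ∧ ∀ a, ∃ x, a ∈ E x := by
  obtain ⟨s, hs, hc⟩ := hA
  let I := (Cardinal.aleph 1).ord.ToType
  have hI : #I = Cardinal.aleph 1 := by simp [I]
  have hIio : ∀ x : I, (Set.Iio x).Countable := by
    intro x
    have h : #(Set.Iio x) < Cardinal.aleph 1 := by
      have := Cardinal.mk_Iio_lt x (by simp [I])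
      rwa [hI] at this
    rw [← Set.countable_coe_iff, ← Cardinal.mk_le_aleph0_iff]
    rw [← Order.lt_succ_iff, Cardinal.succ_aleph0]; exact h
  have hIic : ∀ x : I, (Set.Iic x).Countable := by
    intro x
    rw [← Set.Iio_insert]; exact (hIio x).insert x
  have hsne : Nonempty s := hs.nonempty.to_subtype
  have hemb : Nonempty (s ↪ I) := by
    rw [← Cardinal.le_def, hI]; exact hc
  obtain ⟨emb⟩ := hemb
  let d : I → A := fun x => (Function.invFun emb x).1
  have hd : ∀ a ∈ s, ∃ x, d x = a := fun a ha =>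
    ⟨emb ⟨a, ha⟩, by simp only [d]; rw [Function.leftInverse_invFun emb.injective]⟩
  refine ⟨I, inferInstance, inferInstance, hIio,
    fun x => (NonUnitalStarAlgebra.adjoin ℂ (d '' Set.Iic x)).topologicalClosure, ?_, ?_, ?_⟩
  · intro x y hxy
    refine NonUnitalStarSubalgebra.topologicalClosure_mono (NonUnitalStarAlgebra.adjoin_mono ?_)
    exact Set.image_mono (Set.Iic_subset_Iic.2 hxy)
  · intro x
    exact sep_closure_adjoin ((hIic x).image d)
  · intro a
    obtain ⟨u, hu, hlim⟩ := mem_closure_iff_seq_limit.1 (hs a)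
    choose z hz using fun n => hd (u n) (hu n)
    have hcount : (⋃ n, Set.Iic (z n)).Countable := Set.countable_iUnion fun n => hIic _
    have hex : ∃ y : I, y ∉ ⋃ n, Set.Iic (z n) := by
      by_contra hcon
      push Not at hcon
      have h1 : (Set.univ : Set I).Countable := hcount.mono fun y _ => hcon y
      have h2 : Countable I := Set.countable_univ_iff.1 h1
      have h3 : #I ≤ ℵ₀ := Cardinal.mk_le_aleph0
      rw [hI] at h3
      exact absurd h3 (not_le.2 Cardinal.aleph0_lt_aleph_one)
    obtain ⟨y, hy⟩ := hex
    simp only [Set.mem_iUnion, Set.mem_Iic, not_exists, not_le] at hy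
    refine ⟨y, ?_⟩
    refine mem_closure_of_tendsto hlim (Eventually.of_forall fun n => ?_)
    rw [← hz]
    exact NonUnitalStarAlgebra.subset_adjoin ℂ _ ⟨z n, (hy n).le, rfl⟩

end Filtration

section Final

variable {A : Type} [NonUnitalCStarAlgebra A]
variable {H K : Type} [NormedAddCommGroup H] [InnerProductSpace ℂ H] [CompleteSpace H]
  [NormedAddCommGroup K] [InnerProductSpace ℂ K] [CompleteSpace K]

theorem Good.eq_zero {𝓜 : Model A K} {E : NonUnitalStarSubalgebra ℂ A} {Φ : A → H →L[ℂ] H}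
    (h : Good 𝓜 E Φ) {a : A} (ha : a ∈ E) (hc : Cpt (Φ a)) : a = 0 := by
  apply 𝓜.inj
  rw [map_zero]
  ext ξ
  rw [zero_apply]
  have key : ∀ ε > 0, ‖𝓜.π a ξ‖ ^ 2 ≤ (ε * ‖ξ‖) ^ 2 + ε * ‖ξ‖ * ‖ξ‖ := by
    intro ε hε
    obtain ⟨N, hN, hT⟩ := hc.exists_finite hε
    have hξ : ξ ∈ Submodule.span ℂ {ξ} := Submodule.mem_span_singleton_self ξ
    have hmem : star a * a ∈ E := mul_mem (star_mem ha) ha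
    obtain ⟨W, w1, w2, w3⟩ := h.app (Submodule.span ℂ {ξ}) inferInstance le_top {star a * a}
      (by simpa using hmem) ε hε N hN
    have h3 := w3 (star a * a) (by simp) ξ hξ ξ hξ
    rw [h.rep.map_mul _ (star_mem ha) _ ha, h.rep.map_star _ ha, map_mul, map_star, mul_ap, mul_ap,
      star_eq_adjoint, star_eq_adjoint, adjoint_inner_right, adjoint_inner_right] at h3
    have h4 := (Complex.abs_re_le_norm _).trans h3
    rw [Complex.sub_re, re_inner_self', re_inner_self'] at h4
    have h5 : N.starProjection (W ξ) = 0 := by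
      rw [Submodule.starProjection_apply_eq_zero_iff, Submodule.mem_orthogonal]
      exact fun ν hν => w2 ξ hξ ν hν
    have h6 : ‖Φ a (W ξ)‖ ≤ ε * ‖ξ‖ := by
      have := (Φ a - Φ a ∘L N.starProjection).le_of_opNorm_le hT (W ξ)
      rwa [sub_apply, comp_apply, h5, map_zero, sub_zero, norm_eq_of_isom w1 hξ] at this
    have h7 : ‖Φ a (W ξ)‖ ^ 2 ≤ (ε * ‖ξ‖) ^ 2 := by gcongr
    have := (abs_le.1 h4).1
    linarith
  have hlim : Tendsto (fun ε : ℝ => (ε * ‖ξ‖) ^ 2 + ε * ‖ξ‖ * ‖ξ‖) (𝓝[>] 0) (𝓝 0) := by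
    have : Continuous (fun ε : ℝ => (ε * ‖ξ‖) ^ 2 + ε * ‖ξ‖ * ‖ξ‖) := by fun_prop
    have h := this.tendsto 0
    simp only [zero_mul, ne_eq, OfNat.ofNat_ne_zero, not_false_eq_true, zero_pow, add_zero] at h
    exact h.mono_left nhdsWithin_le_nhds
  have h0 : ‖𝓜.π a ξ‖ ^ 2 ≤ 0 := by
    refine ge_of_tendsto hlim ?_
    filter_upwards [self_mem_nhdsWithin] with ε hε using key ε hε
  have : ‖𝓜.π a ξ‖ = 0 := by nlinarith [norm_nonneg (𝓜.π a ξ)]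
  exact norm_eq_zero.1 this

theorem main_of_model [TopologicalSpace.SeparableSpace H] [Nontrivial A]
    (hH : ¬ FiniteDimensional ℂ H) (𝓜 : Model A K)
    (Q : Type) [CStarAlgebra Q] (π : (H →L[ℂ] H) →⋆ₐ[ℂ] Q)
    (hker : ∀ T : H →L[ℂ] H, π T = 0 ↔ IsCompactOperator T)
    (hA : ∃ s : Set A, Dense s ∧ #s ≤ Cardinal.aleph 1) :
    ∃ φ : A →⋆ₙₐ[ℂ] Q, Function.Injective φ := by
  obtain ⟨I, _, _, hI, E, hE, hs, hcov⟩ := exists_filtration hA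
  obtain ⟨Φ, hΦ⟩ := chain (H := H) hH 𝓜 hI E hE hs
  choose x hx using hcov
  have hlt : ∀ y z a, y < z → a ∈ E y → π (Φ y a) = π (Φ z a) := by
    intro y z a hyz ha
    have := ((hΦ z).2 y hyz).cpt ha
    rw [cpt_iff, ← hker, map_sub, sub_eq_zero] at this
    exact this
  have key : ∀ y a, a ∈ E y → π (Φ (x a) a) = π (Φ y a) := by
    intro y a ha
    rcases lt_trichotomy (x a) y with h | h | h
    · exact hlt _ _ _ h (hx a)
    · rw [h]
    · exact (hlt _ _ _ h ha).symm
  have hmax : ∀ a b, ∃ y, a ∈ E y ∧ b ∈ E y := fun a b =>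
    ⟨max (x a) (x b), hE (le_max_left _ _) (hx a), hE (le_max_right _ _) (hx b)⟩
  let φ : A →⋆ₙₐ[ℂ] Q :=
    { toFun := fun a => π (Φ (x a) a)
      map_smul' := by
        intro c a
        have h : c • a ∈ E (x a) := SMulMemClass.smul_mem c (hx a)
        rw [key _ _ h, (hΦ (x a)).1.rep.map_smul c a (hx a), map_smul]; rfl
      map_zero' := by
        have h := (hΦ (x 0)).1.rep.map_smul 0 0 (hx 0)
        rw [zero_smul, zero_smul] at h
        rw [h, map_zero]
      map_add' := by
        intro a b
        obtain ⟨y, ha, hb⟩ := hmax a b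
        rw [key y a ha, key y b hb, key y (a + b) (add_mem ha hb), (hΦ y).1.rep.map_add a ha b hb,
          map_add]
      map_mul' := by
        intro a b
        obtain ⟨y, ha, hb⟩ := hmax a b
        rw [key y a ha, key y b hb, key y (a * b) (mul_mem ha hb), (hΦ y).1.rep.map_mul a ha b hb,
          map_mul]
      map_star' := by
        intro a
        rw [key _ _ (star_mem (hx a)), (hΦ (x a)).1.rep.map_star a (hx a), map_star] }
  refine ⟨φ, ?_⟩
  rw [injective_iff_map_eq_zero]
  intro a ha
  have h1 : π (Φ (x a) a) = 0 := ha
  rw [hker, ← cpt_iff] at h1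
  exact (hΦ (x a)).1.eq_zero (hx a) h1

end Final

end CalkinUniv

namespace CalkinUniv

open scoped InnerProductSpace InnerProduct Topology
open ContinuousLinearMap Filter

section GNSModel

variable {A : Type} [NonUnitalCStarAlgebra A]

open scoped ComplexOrder in
theorem exists_positive_functional [PartialOrder A] [StarOrderedRing A] (b : A) (hb : 0 ≤ b)
    (hb0 : b ≠ 0) : ∃ F : A →ₚ[ℂ] ℂ, F b ≠ 0 := by
  have hx : -b ∉ ProperCone.positive ℝ A := by
    intro h
    have h' : 0 ≤ -b := by simpa using h
    exact hb0 (le_antisymm (by simpa using h') hb)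
  obtain ⟨f, hf, hfb⟩ := ProperCone.hyperplane_separation_point (ProperCone.positive ℝ A) hx
  let g : Module.Dual ℝ A :=
    { toFun := fun x => (f x + f (star x)) / 2
      map_add' := by intro x y; simp [star_add]; ring
      map_smul' := by intro c x; simp; ring }
  have hg : ∀ x : A, g x = (f x + f (star x)) / 2 := fun x => rfl
  let F : Module.Dual ℂ A := Module.Dual.extendRCLike g
  have hF : ∀ x : A, IsSelfAdjoint x → F x = (f x : ℂ) := by
    intro x hxs
    have h1 : g x = f x := by rw [hg, hxs.star_eq]; ring
    have h2 : g (Complex.I • x) = 0 := by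
      rw [hg, star_smul, hxs.star_eq]
      simp
    change (Module.Dual.extendRCLike g : Module.Dual ℂ A) x = _
    rw [Module.Dual.extendRCLike_apply]
    have h3 : g ((RCLike.I : ℂ) • x) = 0 := h2
    rw [h3, h1]
    simp
  have hpos : ∀ x : A, 0 ≤ x → 0 ≤ F x := by
    intro x hx0
    rw [hF x (IsSelfAdjoint.of_nonneg hx0)]
    have := hf x (by simpa using hx0)
    exact_mod_cast this
  refine ⟨PositiveLinearMap.mk₀ F hpos, ?_⟩
  change F b ≠ 0
  rw [hF b (IsSelfAdjoint.of_nonneg hb)]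
  simp at hfb
  exact_mod_cast hfb.ne'

structure RepOn (A : Type) [NonUnitalCStarAlgebra A] where
  K : Type
  [i1 : NormedAddCommGroup K]
  [i2 : InnerProductSpace ℂ K]
  [i3 : CompleteSpace K]
  π : A →⋆ₙₐ[ℂ] (K →L[ℂ] K)

attribute [instance] RepOn.i1 RepOn.i2 RepOn.i3

theorem exists_rep_ne (a : A) (ha : a ≠ 0) : ∃ R : RepOn A, R.π a ≠ 0 := by
  letI := CStarAlgebra.spectralOrder A
  haveI := CStarAlgebra.spectralOrderedRing A
  have h1 : a * star a ≠ 0 := by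
    simpa using ha
  obtain ⟨F, hF⟩ := exists_positive_functional (star (a * star a) * (a * star a))
    (star_mul_self_nonneg _) ((CStarRing.star_mul_self_eq_zero_iff _).not.mpr h1)
  refine ⟨⟨F.GNS, F.gnsNonUnitalStarAlgHom⟩, ?_⟩
  intro h
  change F.gnsNonUnitalStarAlgHom a = 0 at h
  have h2 := F.gnsNonUnitalStarAlgHom_apply_coe (a := a) (b := F.toPreGNS (star a))
  rw [h] at h2
  have h3 : ‖F.leftMulMapPreGNS a (F.toPreGNS (star a))‖ = 0 := by
    rw [← UniformSpace.Completion.norm_coe, ← h2]; simp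
  have h4 := F.preGNS_norm_sq (F.leftMulMapPreGNS a (F.toPreGNS (star a)))
  rw [h3] at h4
  apply hF
  simpa using h4.symm

theorem exists_faithful (A : Type) [NonUnitalCStarAlgebra A] :
    ∃ R : RepOn A, Function.Injective R.π := by
  classical
  choose R hR using fun i : {a : A // a ≠ 0} => exists_rep_ne i.1 i.2
  have hb : ∀ a i, ‖(R i).π a‖ ≤ ‖a‖ := fun a i => NonUnitalStarAlgHom.norm_apply_le (R i).π a
  let T : A → (lp (fun i => (R i).K) 2 →L[ℂ] lp (fun i => (R i).K) 2) := fun a =>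
    lp.mapCLM 2 (fun i => (R i).π a) (norm_nonneg a) (hb a)
  have hT : ∀ a x i, T a x i = (R i).π a (x i) := fun a x i => rfl
  let Φ : A →⋆ₙₐ[ℂ] (lp (fun i => (R i).K) 2 →L[ℂ] lp (fun i => (R i).K) 2) :=
    { toFun := T
      map_smul' := by
        intro c a; ext x i; simp [hT]
      map_zero' := by ext x i; simp [hT]
      map_add' := by intro a b; ext x i; simp [hT]
      map_mul' := by intro a b; ext x i; simp [hT]
      map_star' := by
        intro a
        rw [star_eq_adjoint]
        refine (eq_adjoint_iff _ _).mpr fun x y => ?_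
        rw [lp.inner_eq_tsum, lp.inner_eq_tsum]
        refine tsum_congr fun i => ?_
        rw [hT, hT, map_star, star_eq_adjoint, adjoint_inner_left] }
  refine ⟨⟨lp (fun i => (R i).K) 2, Φ⟩, ?_⟩
  refine (injective_iff_map_eq_zero Φ).mpr fun a ha => ?_
  by_contra hne
  apply hR ⟨a, hne⟩
  ext x
  have h := hT a (lp.single 2 ⟨a, hne⟩ x) ⟨a, hne⟩
  have h0 : T a = 0 := ha
  rw [h0] at h
  simpa using h.symm

theorem exists_model (A : Type) [NonUnitalCStarAlgebra A] :
    ∃ (K : Type) (_ : NormedAddCommGroup K) (_ : InnerProductSpace ℂ K) (_ : CompleteSpace K),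
      Nonempty (Model A K) := by
  obtain ⟨R, hR⟩ := exists_faithful A
  let 𝒜 := lpAmp R.K
  have hf : ∀ j : ℕ, Function.Injective (fun k : ℕ => Nat.pair j k) := by
    intro j k l h
    have := Nat.pair_eq_pair.mp h
    exact this.2
  refine ⟨lp (fun _ : ℕ => R.K) 2, inferInstance, inferInstance, inferInstance, ⟨?_⟩⟩
  refine
    { π := 
        { toFun := fun a => 𝒜.ampl (R.π a)
          map_smul' := by intro c a; simp [𝒜.ampl_smul]
          map_zero' := by
            refine 𝒜.ext fun k x => ?_
            rw [𝒜.ampl_inj]; simp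
          map_add' := by intro a b; simp [𝒜.ampl_add]
          map_mul' := by intro a b; simp [𝒜.ampl_mul]
          map_star' := by intro a; simp only [map_star]; exact 𝒜.ampl_star _ }
      inj := ?_
      s := fun j => 𝒜.push _ (hf j)
      s1 := ?_
      s2 := ?_
      s3 := ?_ }
  · refine (injective_iff_map_eq_zero _).mpr fun a ha => ?_
    apply hR
    rw [map_zero]
    ext x
    have h1 : 𝒜.ampl (R.π a) = 0 := ha
    have h2 := 𝒜.ampl_inj (R.π a) 0 x
    rw [h1] at h2
    have h3 := 𝒜.inj_same 0 (R.π a x)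
    rw [← h2] at h3
    simpa using h3.symm
  · intro j x y
    have h := congrArg (fun T : lp (fun _ : ℕ => R.K) 2 →L[ℂ] lp (fun _ : ℕ => R.K) 2 => T y)
      (𝒜.push_adj_push (hf := hf j))
    rw [← adjoint_inner_right]
    congr 1
  · intro i j hij x y
    have h : (𝒜.push _ (hf i))† * 𝒜.push _ (hf j) = 0 := by
      refine 𝒜.ext fun k x => ?_
      rw [mul_ap, 𝒜.push_inj, 𝒜.push_adj_inj_ne]
      · simp
      · intro l h
        exact hij (Nat.pair_eq_pair.mp h).1
    rw [← adjoint_inner_right, ← mul_ap, h]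
    simp
  · intro a j x
    have h := congrArg (fun T : lp (fun _ : ℕ => R.K) 2 →L[ℂ] lp (fun _ : ℕ => R.K) 2 => T x)
      (𝒜.push_ampl (hf := hf j) (R.π a))
    exact h.symm

end GNSModel

end CalkinUniv


/-- In the Calkin algebra setup below, `Q` plays the role of the Calkin algebra
`Q(H) = B(H)/K(H)`: it is a C*-algebra equipped with a surjective unital
*-homomorphism `π : B(H) → Q` whose kernel is exactly the ideal of compact operators. -/
theorem calkin_is_aleph_one_universal
    (H : Type) [NormedAddCommGroup H] [InnerProductSpace ℂ H] [CompleteSpace H]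
    [TopologicalSpace.SeparableSpace H] (hH : ¬ FiniteDimensional ℂ H)
    (Q : Type) [CStarAlgebra Q] (π : (H →L[ℂ] H) →⋆ₐ[ℂ] Q)
    (hsurj : Function.Surjective π)
    (hker : ∀ T : H →L[ℂ] H, π T = 0 ↔ IsCompactOperator T)
    (A : Type) [NonUnitalCStarAlgebra A]
    (hA : ∃ s : Set A, Dense s ∧ #s ≤ Cardinal.aleph 1) :
    ∃ φ : A →⋆ₙₐ[ℂ] Q, Function.Injective φ := by
  rcases subsingleton_or_nontrivial A with hs | hn
  · exact ⟨0, fun x y _ => Subsingleton.elim x y⟩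
  · obtain ⟨K, i1, i2, i3, ⟨M⟩⟩ := CalkinUniv.exists_model A
    exact CalkinUniv.main_of_model hH M Q π hker hA
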